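/- arXiv:2407.05460 — 3 statements merged into one kernel-verified Lean document; each statement's English description precedes it below -/
import Mathlib

section
/- Let Ψ_K be a uniformly random bijection from [K]×[K] to {1,…,K²} and let the starting profile BRD(0) be chosen uniformly at random on [K]×[K], independently of Ψ_K. Let Λ(BRD(2K)) be the rank (by increasing potential value) of the pure Nash equilibrium reached by the best-response dynamics. Then for every ε ∈ [0,1/2), lim_{K→∞} P( Λ(BRD(2K)) ≤ εK ) = (1 − √(1−2ε)) · exp(√(1−2ε)). -/
open scoped Classical

noncomputable section

/-- `p` is a pure Nash equilibrium of the potential `Ψ`: a strict minimum of `Ψ`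
in its row and in its column. -/
def IsPNE {K : ℕ} (Ψ : Fin K × Fin K → ℝ) (p : Fin K × Fin K) : Prop :=
  (∀ a' : Fin K, a' ≠ p.1 → Ψ p < Ψ (a', p.2)) ∧
  (∀ b' : Fin K, b' ≠ p.2 → Ψ p < Ψ (p.1, b'))

/-- Real-valued potential associated with a bijection into `Fin (K^2)`,
taking values in `{1, …, K²}`. -/
def pot {K : ℕ} (Ψ : (Fin K × Fin K) ≃ Fin (K ^ 2)) (p : Fin K × Fin K) : ℝ :=
  (Ψ p : ℕ) + 1

/-- The minimizer of the potential `Ψ` in column `b` (the best response of the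
row player to `b`). -/
noncomputable def argminRow {K : ℕ} (Ψ : Fin K × Fin K → ℝ) (b : Fin K) : Fin K :=
  have : Nonempty (Fin K) := ⟨b⟩
  Classical.choose (Finite.exists_min fun a : Fin K => Ψ (a, b))

/-- The minimizer of the potential `Ψ` in row `a` (the best response of the
column player to `a`). -/
noncomputable def argminCol {K : ℕ} (Ψ : Fin K × Fin K → ℝ) (a : Fin K) : Fin K :=
  have : Nonempty (Fin K) := ⟨a⟩
  Classical.choose (Finite.exists_min fun b : Fin K => Ψ (a, b))

/-- Best-response dynamics for the potential `Ψ` started at `p₀`: at even times the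
row player moves to the minimizer of the current column, at odd times the column
player moves to the minimizer of the current row (staying put if already there). -/
noncomputable def BRD {K : ℕ} (Ψ : Fin K × Fin K → ℝ) (p₀ : Fin K × Fin K) :
    ℕ → Fin K × Fin K
  | 0 => p₀
  | t + 1 =>
    let p := BRD Ψ p₀ t
    if Even t then (argminRow Ψ p.2, p.2) else (p.1, argminCol Ψ p.1)

/-- The set of pure Nash equilibria of the potential given by the bijection `Ψ`. -/
def pneFinset {K : ℕ} (Ψ : (Fin K × Fin K) ≃ Fin (K ^ 2)) : Finset (Fin K × Fin K) :=
  Finset.univ.filter fun p => IsPNE (pot Ψ) p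

/-- The rank of `η` among the PNE of `Ψ`, ordered by increasing potential value
(the PNE with smallest potential has rank `1`). -/
def rankPNE {K : ℕ} (Ψ : (Fin K × Fin K) ≃ Fin (K ^ 2)) (η : Fin K × Fin K) : ℕ :=
  ((pneFinset Ψ).filter fun p => Ψ p ≤ Ψ η).card

/-- The basin of attraction of `η`: the set of profiles from which the
best-response dynamics is absorbed at `η` (within `2K` steps). -/
noncomputable def BoA {K : ℕ} (Ψ : (Fin K × Fin K) ≃ Fin (K ^ 2))
    (η : Fin K × Fin K) : Finset (Fin K × Fin K) :=
  Finset.univ.filter fun p => BRD (pot Ψ) p (2 * K) = η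

/-- The size of the basin of attraction of the PNE of `Ψ` with the `j`-th smallest
potential value, set to `0` if `Ψ` has fewer than `j` PNE. -/
noncomputable def basinOfRank {K : ℕ} (Ψ : (Fin K × Fin K) ≃ Fin (K ^ 2)) (j : ℕ) : ℕ :=
  ∑ η ∈ (pneFinset Ψ).filter fun η => rankPNE Ψ η = j, (BoA Ψ η).card

/-- Bijections with prescribed values on `C` and prescribed ranges on `S`. -/
def constrainedEquivs {X Y : Type*} [Fintype X] [Fintype Y] (C : Finset X) (v : X → Y)
    (S : Finset X) (T : X → Finset Y) : Finset (X ≃ Y) :=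
  Finset.univ.filter fun f => (∀ c ∈ C, f c = v c) ∧ ∀ p ∈ S, f p ∈ T p

lemma injOn_update_insert {X Y : Type*} {C : Finset X} {v : X → Y} (hv : Set.InjOn v C)
    {p : X} (hpC : p ∉ C) {y : Y} (hy : y ∉ C.image v) :
    Set.InjOn (Function.update v p y) (insert p C : Finset X) := by
  have hne : ∀ c ∈ C, c ≠ p := fun c hc h => hpC (h ▸ hc)
  rw [Finset.coe_insert, Set.injOn_insert (by simpa using hpC)]
  refine ⟨fun a ha b hb h => ?_, ?_⟩
  · rw [Function.update_of_ne (hne a ha), Function.update_of_ne (hne b hb)] at h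
    exact hv ha hb h
  · rintro ⟨c, hc, h⟩
    rw [Function.update_of_ne (hne c hc), Function.update_self] at h
    exact hy (Finset.mem_image.2 ⟨c, hc, h⟩)

section Counting

variable {X Y : Type*} [Fintype X] [Fintype Y]

lemma card_constrainedEquivs_empty (hXY : Fintype.card X = Fintype.card Y) (C : Finset X)
    (v : X → Y) (hv : Set.InjOn v C) (T : X → Finset Y) :
    (constrainedEquivs C v ∅ T).card = (Fintype.card X - C.card).factorial := by
  let e₀ : (C : Set X) ≃ (v '' C : Set Y) := Equiv.Set.imageOfInjOn v C hv
  have h1 : (constrainedEquivs C v ∅ T).card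
      = Fintype.card {e : X ≃ Y // ∀ x : (C : Set X), e x = e₀ x} := by
    rw [Fintype.card_subtype]
    congr 1
    ext f
    simp [constrainedEquivs, e₀, Equiv.Set.imageOfInjOn]
  have hX : Fintype.card ((C : Set X)ᶜ : Set X) = Fintype.card X - C.card := by
    rw [Fintype.card_compl_set]; simp
  have hY : Fintype.card ((v '' C : Set Y)ᶜ : Set Y) = Fintype.card Y - C.card := by
    rw [Fintype.card_compl_set, ← Fintype.card_congr e₀]; simp
  rw [h1, Fintype.card_congr (Equiv.Set.compl e₀),
    Fintype.card_equiv (Fintype.equivOfCardEq (by rw [hX, hY, hXY])), hX]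

lemma card_constrainedEquivs_insert (C : Finset X) (v : X → Y)
    (S : Finset X) (T : X → Finset Y) (p : X) (hpC : p ∉ C) :
    (constrainedEquivs C v (insert p S) T).card
      = ∑ y ∈ T p \ C.image v,
          (constrainedEquivs (insert p C) (Function.update v p y) S T).card := by
  have hne : ∀ c ∈ C, c ≠ p := fun c hc h => hpC (h ▸ hc)
  rw [Finset.card_eq_sum_card_fiberwise (f := fun f : X ≃ Y => f p) (t := T p \ C.image v)]
  · refine Finset.sum_congr rfl fun y hy => congrArg _ ?_
    ext f
    simp only [constrainedEquivs, Finset.mem_filter, Finset.mem_univ, true_and,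
      Finset.forall_mem_insert, Function.update_self]
    constructor
    · rintro ⟨⟨h1, -, h3⟩, h4⟩
      exact ⟨⟨h4, fun c hc => by rw [Function.update_of_ne (hne c hc)]; exact h1 c hc⟩, h3⟩
    · rintro ⟨⟨h4, h1⟩, h3⟩
      refine ⟨⟨fun c hc => ?_, ?_, h3⟩, h4⟩
      · rw [h1 c hc, Function.update_of_ne (hne c hc)]
      · rw [h4]; exact (Finset.mem_sdiff.1 hy).1
  · intro f hf
    simp only [constrainedEquivs, Finset.coe_filter, Finset.mem_univ, true_and,
      Finset.forall_mem_insert, Set.mem_ofPred_eq] at hf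
    simp only [Finset.coe_sdiff, Finset.coe_image, Set.mem_sdiff, Finset.mem_coe, hf.2.1,
      Set.mem_image, not_exists, not_and, true_and]
    intro c hc h
    rw [← hf.1 c hc] at h
    exact hne c hc (f.injective h)

lemma le_card_constrainedEquivs (hXY : Fintype.card X = Fintype.card Y) (M : ℕ)
    (T : X → Finset Y) (r : X → ℝ) (S : Finset X) :
    ∀ (C : Finset X) (v : X → Y), Set.InjOn v C → Disjoint C S → C.card + S.card ≤ M →
      (∀ p ∈ S, 0 ≤ r p ∧ r p ≤ 1 ∧ r p * (Fintype.card X - M) ≤ (T p).card - M) →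
      ((Fintype.card X - C.card).factorial : ℝ) * ∏ p ∈ S, r p
        ≤ (constrainedEquivs C v S T).card := by
  induction S using Finset.induction_on with
  | empty =>
    intro C v hv _ _ _
    rw [card_constrainedEquivs_empty hXY C v hv]; simp
  | insert p S hpS ih =>
    intro C v hv hd hM hr
    have hpC : p ∉ C := fun h => Finset.disjoint_left.1 hd h (Finset.mem_insert_self _ _)
    rw [card_constrainedEquivs_insert C v S T p hpC, Finset.prod_insert hpS]
    push_cast
    have hprod : 0 ≤ ∏ q ∈ S, r q :=
      Finset.prod_nonneg fun q hq => (hr q (Finset.mem_insert_of_mem hq)).1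
    have hlt : C.card < Fintype.card X := by
      rw [← Finset.card_univ]
      exact Finset.card_lt_card (Finset.ssubset_univ_iff.2 fun h => hpC (h ▸ Finset.mem_univ p))
    have key : ∀ y ∈ T p \ C.image v,
        ((Fintype.card X - C.card - 1).factorial : ℝ) * ∏ q ∈ S, r q ≤
          (constrainedEquivs (insert p C) (Function.update v p y) S T).card := by
      intro y hy
      have := ih (insert p C) (Function.update v p y)
        (injOn_update_insert hv hpC (Finset.mem_sdiff.1 hy).2)
        (by
          rw [Finset.disjoint_insert_left]
          exact ⟨hpS, hd.mono_right (Finset.subset_insert _ _)⟩)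
        (by
          rw [Finset.card_insert_of_notMem hpC]
          rw [Finset.card_insert_of_notMem hpS] at hM
          omega)
        (fun q hq => hr q (Finset.mem_insert_of_mem hq))
      rwa [Finset.card_insert_of_notMem hpC, ← Nat.sub_sub] at this
    refine le_trans ?_ (Finset.sum_le_sum key)
    rw [Finset.sum_const, nsmul_eq_mul]
    have hcard : ((T p).card : ℝ) - C.card ≤ ((T p \ C.image v).card : ℝ) := by
      have h1 := Finset.le_card_sdiff (C.image v) (T p)
      have h2 : (C.image v).card ≤ C.card := Finset.card_image_le
      have h3 : (T p).card ≤ (T p \ C.image v).card + C.card := by omega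
      have : ((T p).card : ℝ) ≤ (T p \ C.image v).card + C.card := by exact_mod_cast h3
      linarith
    obtain ⟨h0, h1, h2⟩ := hr p (Finset.mem_insert_self _ _)
    have hCM : (C.card : ℝ) ≤ M := by
      have : C.card ≤ M := by omega
      exact_mod_cast this
    have hfac : ((Fintype.card X - C.card).factorial : ℝ)
        = ((Fintype.card X : ℝ) - C.card) * (Fintype.card X - C.card - 1).factorial := by
      rw [← Nat.mul_factorial_pred (by omega : Fintype.card X - C.card ≠ 0), Nat.cast_mul,
        Nat.cast_sub hlt.le]
    have hle : r p * ((Fintype.card X : ℝ) - C.card) ≤ ((T p \ C.image v).card : ℝ) := by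
      nlinarith
    rw [hfac]
    calc _ = (r p * ((Fintype.card X : ℝ) - C.card)) *
          ((Fintype.card X - C.card - 1).factorial * ∏ q ∈ S, r q) := by ring
      _ ≤ _ := mul_le_mul_of_nonneg_right hle (by positivity)

lemma card_constrainedEquivs_le (hXY : Fintype.card X = Fintype.card Y)
    (T : X → Finset Y) (r : X → ℝ) (τ : X → ℕ) (hT : ∀ p q, τ p ≤ τ q → T p ⊆ T q)
    (S : Finset X) :
    ∀ (C : Finset X) (v : X → Y), Set.InjOn v C → Disjoint C S →
      (∀ p ∈ S, 0 ≤ r p ∧ r p ≤ 1 ∧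
        ((T p \ C.image v).card : ℝ) ≤ r p * (Fintype.card X - C.card)) →
      ((constrainedEquivs C v S T).card : ℝ)
        ≤ ((Fintype.card X - C.card).factorial : ℝ) * ∏ p ∈ S, r p := by
  induction S using Finset.induction_on_min_value τ with
  | empty =>
    intro C v hv _ _
    rw [card_constrainedEquivs_empty hXY C v hv]; simp
  | insert p S hpS hmin ih =>
    intro C v hv hd hr
    have hpC : p ∉ C := fun h => Finset.disjoint_left.1 hd h (Finset.mem_insert_self _ _)
    rw [card_constrainedEquivs_insert C v S T p hpC, Finset.prod_insert hpS]
    push_cast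
    have hprod : 0 ≤ ∏ q ∈ S, r q :=
      Finset.prod_nonneg fun q hq => (hr q (Finset.mem_insert_of_mem hq)).1
    have hlt : C.card < Fintype.card X := by
      rw [← Finset.card_univ]
      exact Finset.card_lt_card (Finset.ssubset_univ_iff.2 fun h => hpC (h ▸ Finset.mem_univ p))
    have key : ∀ y ∈ T p \ C.image v,
        ((constrainedEquivs (insert p C) (Function.update v p y) S T).card : ℝ) ≤
        ((Fintype.card X - C.card - 1).factorial : ℝ) * ∏ q ∈ S, r q := by
      intro y hy
      have := ih (insert p C) (Function.update v p y)
        (injOn_update_insert hv hpC (Finset.mem_sdiff.1 hy).2)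
        (by
          rw [Finset.disjoint_insert_left]
          exact ⟨hpS, hd.mono_right (Finset.subset_insert _ _)⟩)
        (by
          intro q hq
          obtain ⟨h0, h1, h2⟩ := hr q (Finset.mem_insert_of_mem hq)
          refine ⟨h0, h1, ?_⟩
          have himg : (insert p C).image (Function.update v p y) = insert y (C.image v) := by
            rw [Finset.image_insert, Function.update_self]
            congr 1
            refine Finset.image_congr fun c hc => Function.update_of_ne ?_ _ _
            rintro rfl
            exact hpC hc
          have hyq : y ∈ T q \ C.image v := by
            rw [Finset.mem_sdiff] at hy ⊢
            exact ⟨hT p q (hmin q hq) hy.1, hy.2⟩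
          rw [himg, Finset.sdiff_insert, Finset.card_erase_of_mem hyq,
            Finset.card_insert_of_notMem hpC]
          rw [Nat.cast_sub (Finset.card_pos.2 ⟨y, hyq⟩)]
          push_cast
          nlinarith)
      rwa [Finset.card_insert_of_notMem hpC, ← Nat.sub_sub] at this
    refine le_trans (Finset.sum_le_sum key) ?_
    rw [Finset.sum_const, nsmul_eq_mul]
    obtain ⟨h0, h1, h2⟩ := hr p (Finset.mem_insert_self _ _)
    have hfac : ((Fintype.card X - C.card).factorial : ℝ)
        = ((Fintype.card X : ℝ) - C.card) * (Fintype.card X - C.card - 1).factorial := by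
      rw [← Nat.mul_factorial_pred (by omega : Fintype.card X - C.card ≠ 0), Nat.cast_mul,
        Nat.cast_sub hlt.le]
    rw [hfac]
    calc _ ≤ (r p * ((Fintype.card X : ℝ) - C.card)) *
          ((Fintype.card X - C.card - 1).factorial * ∏ q ∈ S, r q) :=
            mul_le_mul_of_nonneg_right h2 (by positivity)
      _ = _ := by ring

end Counting

section Paths

variable {K : ℕ}

/-- The cell at the crossing of line `a` and line `b`, where line `a` is a column if `t` is even
and a row if `t` is odd, and line `b` is of the other kind. -/
def cell (t : ℕ) (a b : Fin K) : Fin K × Fin K := if Even t then (b, a) else (a, b)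

lemma cell_succ (t : ℕ) (a b : Fin K) : cell (t + 1) b a = cell t a b := by
  by_cases h : Even t <;> simp [cell, h, Nat.even_add_one]

/-- The last cell of a path of lines. -/
def endCell {j : ℕ} (x : Fin (j + 2) → Fin K) : Fin K × Fin K :=
  cell j (x (Fin.last j).castSucc) (x (Fin.last j).succ)

/-- `x` is the sequence of lines, with distinct labels, visited by the best-response dynamics of
`Ψ` started in column `x 0` until absorption at `endCell x`. -/
def IsPath (Ψ : (Fin K × Fin K) ≃ Fin (K ^ 2)) {j : ℕ} (x : Fin (j + 2) → Fin K) : Prop :=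
  Function.Injective x ∧
  (∀ t : Fin (j + 1), ∀ y, y ≠ x t.succ →
    Ψ (cell t (x t.castSucc) (x t.succ)) < Ψ (cell t (x t.castSucc) y)) ∧
  ∀ y, y ≠ x (Fin.last j).castSucc →
    Ψ (endCell x) < Ψ (cell (j + 1) (x (Fin.last (j + 1))) y)

/-- The line along which the best-response dynamics moves at time `t`. -/
def brdLine (Ψ : Fin K × Fin K → ℝ) (p : Fin K × Fin K) (t : ℕ) : Fin K :=
  if Even t then (BRD Ψ p t).2 else (BRD Ψ p t).1

lemma argminRow_eq {Ψ : Fin K × Fin K → ℝ} {b z : Fin K}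
    (h : ∀ y, y ≠ z → Ψ (z, b) < Ψ (y, b)) : argminRow Ψ b = z := by
  by_contra hne
  have : Nonempty (Fin K) := ⟨b⟩
  have h1 := Classical.choose_spec (Finite.exists_min fun a : Fin K => Ψ (a, b)) z
  exact absurd (h _ hne) (not_lt.2 h1)

lemma argminCol_eq {Ψ : Fin K × Fin K → ℝ} {a z : Fin K}
    (h : ∀ y, y ≠ z → Ψ (a, z) < Ψ (a, y)) : argminCol Ψ a = z := by
  by_contra hne
  have : Nonempty (Fin K) := ⟨a⟩
  have h1 := Classical.choose_spec (Finite.exists_min fun b : Fin K => Ψ (a, b)) z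
  exact absurd (h _ hne) (not_lt.2 h1)

lemma pot_lt_pot {Ψ : (Fin K × Fin K) ≃ Fin (K ^ 2)} {p q : Fin K × Fin K} :
    pot Ψ p < pot Ψ q ↔ Ψ p < Ψ q := by
  rw [pot, pot, add_lt_add_iff_right, Nat.cast_lt, Fin.val_fin_lt]

lemma BRD_succ_of_min {Ψ : Fin K × Fin K → ℝ} {p : Fin K × Fin K} {t : ℕ} {z : Fin K}
    (h : ∀ y, y ≠ z → Ψ (cell t (brdLine Ψ p t) z) < Ψ (cell t (brdLine Ψ p t) y)) :
    BRD Ψ p (t + 1) = cell t (brdLine Ψ p t) z ∧ brdLine Ψ p (t + 1) = z := by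
  by_cases ht : Even t
  · simp only [brdLine, cell, ht, if_true, Nat.even_add_one, not_true_eq_false, if_false, BRD]
      at h ⊢
    rw [argminRow_eq h]
    exact ⟨rfl, rfl⟩
  · simp only [brdLine, cell, ht, if_false, Nat.even_add_one, not_false_eq_true, if_true, BRD]
      at h ⊢
    rw [argminCol_eq h]
    exact ⟨rfl, rfl⟩

lemma BRD_eq_of_isPNE {Ψ : Fin K × Fin K → ℝ} {p η : Fin K × Fin K} (hη : IsPNE Ψ η) {t : ℕ}
    (ht : BRD Ψ p t = η) (k : ℕ) : BRD Ψ p (t + k) = η := by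
  induction k with
  | zero => exact ht
  | succ k ih =>
    rw [← add_assoc, BRD]
    simp only [ih]
    split_ifs
    · rw [argminRow_eq hη.1]
    · rw [argminCol_eq hη.2]

variable {Ψ : (Fin K × Fin K) ≃ Fin (K ^ 2)} {j : ℕ} {x : Fin (j + 2) → Fin K}

lemma IsPath.isPNE (hx : IsPath Ψ x) : IsPNE (pot Ψ) (endCell x) := by
  obtain ⟨-, h1, h2⟩ := hx
  have h1 := h1 (Fin.last j)
  simp only [IsPNE, pot_lt_pot]
  by_cases hj : Even j
  · simp only [endCell, cell, hj, if_true, Nat.even_add_one, not_true_eq_false, if_false,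
      Fin.val_last, Fin.succ_last] at h1 h2 ⊢
    exact ⟨h1, h2⟩
  · simp only [endCell, cell, hj, if_false, Nat.even_add_one, not_false_eq_true, if_true,
      Fin.val_last, Fin.succ_last] at h1 h2 ⊢
    exact ⟨h2, h1⟩

lemma IsPath.brdLine_eq (hx : IsPath Ψ x) {p : Fin K × Fin K} (hp : p.2 = x 0) (i : ℕ)
    (hi : i < j + 2) : brdLine (pot Ψ) p i = x ⟨i, hi⟩ := by
  induction i with
  | zero => simpa [brdLine, BRD] using hp
  | succ i ih =>
    have ih := ih (by omega)
    have h := hx.2.1 ⟨i, by omega⟩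
    refine (BRD_succ_of_min fun y hy => ?_).2
    rw [pot_lt_pot, ih]
    exact h y hy

lemma IsPath.BRD_eq (hx : IsPath Ψ x) {p : Fin K × Fin K} (hp : p.2 = x 0) :
    BRD (pot Ψ) p (j + 1) = endCell x := by
  have h := hx.2.1 (Fin.last j)
  have hl := hx.brdLine_eq hp j (by omega)
  have := (BRD_succ_of_min (Ψ := pot Ψ) (p := p) (t := j) (z := x (Fin.last j).succ)
    fun y hy => by rw [pot_lt_pot, hl]; exact h y hy).1
  rw [this, hl]
  rfl

lemma IsPath.BRD_absorbed (hx : IsPath Ψ x) {p : Fin K × Fin K} (hp : p.2 = x 0) :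
    BRD (pot Ψ) p (2 * K) = endCell x := by
  have hK : j + 2 ≤ K := by simpa using Fintype.card_le_of_injective x hx.1
  have := BRD_eq_of_isPNE hx.isPNE (hx.BRD_eq hp) (2 * K - (j + 1))
  rwa [Nat.add_sub_cancel' (by omega)] at this

lemma IsPath.brdLine_after (hx : IsPath Ψ x) {p : Fin K × Fin K} (hp : p.2 = x 0) :
    brdLine (pot Ψ) p (j + 2) = x (Fin.last j).castSucc := by
  have hl := hx.brdLine_eq hp (j + 1) (by omega)
  refine (BRD_succ_of_min fun y hy => ?_).2
  rw [pot_lt_pot, hl]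
  have := hx.2.2 y hy
  rw [endCell, ← cell_succ] at this
  exact this

lemma IsPath.length_le (hx : IsPath Ψ x) {j' : ℕ} {x' : Fin (j' + 2) → Fin K}
    (hx' : IsPath Ψ x') (h0 : x 0 = x' 0) : j' ≤ j := by
  by_contra! h
  have e1 := hx.brdLine_after (p := (x 0, x 0)) rfl
  have e2 := hx.brdLine_eq (p := (x 0, x 0)) rfl j (by omega)
  have e3 := hx'.brdLine_eq (p := (x 0, x 0)) h0 (j + 2) (by omega)
  have e4 := hx'.brdLine_eq (p := (x 0, x 0)) h0 j (by omega)
  have : x' ⟨j + 2, by omega⟩ = x' ⟨j, by omega⟩ := by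
    rw [← e3, ← e4, e1, e2]; rfl
  simpa using hx'.1 this

lemma IsPath.sigma_eq (hx : IsPath Ψ x) {j' : ℕ} {x' : Fin (j' + 2) → Fin K}
    (hx' : IsPath Ψ x') (h0 : x 0 = x' 0) :
    (⟨j, x⟩ : Σ j : ℕ, Fin (j + 2) → Fin K) = ⟨j', x'⟩ := by
  obtain rfl : j = j' := le_antisymm (hx'.length_le hx h0.symm) (hx.length_le hx' h0)
  congr 1
  funext i
  have e1 := hx.brdLine_eq (p := (x 0, x 0)) rfl i i.2
  have e2 := hx'.brdLine_eq (p := (x 0, x 0)) h0 i i.2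
  exact e1.symm.trans e2

/-- The paths of `j + 2` lines of `Ψ` ending at a cell whose value lies in `[α, β)`. -/
def paths (Ψ : (Fin K × Fin K) ≃ Fin (K ^ 2)) (j α β : ℕ) : Finset (Fin (j + 2) → Fin K) :=
  Finset.univ.filter fun x => IsPath Ψ x ∧ α ≤ (Ψ (endCell x) : ℕ) ∧ (Ψ (endCell x) : ℕ) < β

lemma sum_card_paths_le (Ψ : (Fin K × Fin K) ≃ Fin (K ^ 2)) (J : ℕ) (α β : ℕ → ℕ)
    (P : Fin (K ^ 2) → Prop) [DecidablePred P]
    (hP : ∀ j (y : Fin (K ^ 2)), α j ≤ y → y < β j → P y) :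
    K * ∑ j ∈ Finset.range J, (paths Ψ j (α j) (β j)).card
      ≤ (Finset.univ.filter fun p : Fin K × Fin K => P (Ψ (BRD (pot Ψ) p (2 * K)))).card := by
  rw [← Finset.card_sigma]
  have hK : K = (Finset.univ : Finset (Fin K)).card := by simp
  refine (congrArg (· * _) hK).le.trans ?_
  rw [← Finset.card_product]
  refine Finset.card_le_card_of_injOn (fun q => (q.1, q.2.2 0)) ?_ ?_
  · rintro ⟨a, j, x⟩ h
    simp only [Finset.coe_product, Set.mem_prod, Finset.mem_coe, Finset.mem_sigma, paths,
      Finset.mem_filter, Finset.mem_univ, true_and] at h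
    obtain ⟨-, hx, h1, h2⟩ := h
    simp only [Finset.mem_coe, Finset.mem_filter, Finset.mem_univ, true_and]
    rw [hx.BRD_absorbed rfl]
    exact hP j _ h1 h2
  · rintro ⟨a, j, x⟩ h ⟨a', j', x'⟩ h' heq
    simp only [Finset.coe_product, Set.mem_prod, Finset.mem_coe, Finset.mem_sigma, paths,
      Finset.mem_filter, Finset.mem_univ, true_and] at h h'
    simp only [Prod.mk.injEq] at heq
    rw [Prod.mk.injEq]
    exact ⟨heq.1, h.2.1.sigma_eq h'.2.1 heq.2⟩

/-- The pure Nash equilibria of `Ψ` with value smaller than `V` (values starting from `0`). -/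
def pneBelow (Ψ : (Fin K × Fin K) ≃ Fin (K ^ 2)) (V : ℕ) : Finset (Fin K × Fin K) :=
  (pneFinset Ψ).filter fun p => (Ψ p : ℕ) < V

lemma card_paths_zero_le (Ψ : (Fin K × Fin K) ≃ Fin (K ^ 2)) (V : ℕ) :
    (paths Ψ 0 0 V).card ≤ (pneBelow Ψ V).card := by
  refine Finset.card_le_card_of_injOn endCell ?_ ?_
  · intro x hx
    simp only [paths, Finset.mem_coe, Finset.mem_filter, Finset.mem_univ, true_and] at hx
    simp only [pneBelow, pneFinset, Finset.mem_coe, Finset.mem_filter, Finset.mem_univ, true_and]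
    exact ⟨hx.1.isPNE, hx.2.2⟩
  · intro x _ x' _ h
    simp only [endCell, cell, Even.zero, if_true, Prod.mk.injEq] at h
    funext i
    fin_cases i
    · exact h.2
    · exact h.1

lemma card_pneBelow_le (Ψ : (Fin K × Fin K) ≃ Fin (K ^ 2)) (V : ℕ) :
    (pneBelow Ψ V).card ≤ K := by
  have hK : (Finset.univ : Finset (Fin K)).card = K := by simp
  refine le_of_le_of_eq ?_ hK
  refine Finset.card_le_card_of_injOn Prod.fst (fun _ _ => Finset.mem_coe.2 (Finset.mem_univ _)) ?_
  rintro ⟨a, b⟩ hp ⟨a', b'⟩ hq (rfl : a = a')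
  simp only [pneBelow, pneFinset, Finset.mem_coe, Finset.mem_filter, Finset.mem_univ,
    true_and] at hp hq
  by_contra hne
  have hb : b' ≠ b := fun h => hne (by rw [h])
  exact lt_asymm (hp.1.2 b' hb) (hq.1.2 b hb.symm)

end Paths

/-- The fraction of `{0, …, N - 1}` that is at least `k`. -/
def tailFrac (N k : ℕ) : ℝ := ((N - k : ℕ) : ℝ) / N

lemma tailFrac_nonneg (N k : ℕ) : 0 ≤ tailFrac N k := by unfold tailFrac; positivity

lemma tailFrac_le_one (N k : ℕ) : tailFrac N k ≤ 1 := by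
  unfold tailFrac
  refine div_le_one_of_le₀ ?_ (by positivity)
  exact_mod_cast Nat.sub_le N k

section PathCount

variable {K j : ℕ} {x : Fin (j + 2) → Fin K}

lemma cell_eq_cell (hx : Function.Injective x) {i : Fin (j + 2)} {s : Fin (j + 1)} {y : Fin K}
    (h : cell i (x i) y = cell s (x s.castSucc) (x s.succ)) :
    (i = s.castSucc ∧ y = x s.succ) ∨ (i = s.succ ∧ y = x s.castSucc) := by
  by_cases hi : Even (i : ℕ) <;> by_cases hs : Even (s : ℕ) <;>
    simp only [cell, hi, hs, if_true, if_false, Prod.mk.injEq] at h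
  · exact Or.inl ⟨hx h.2, h.1⟩
  · exact Or.inr ⟨hx h.2, h.1⟩
  · exact Or.inr ⟨hx h.1, h.2⟩
  · exact Or.inl ⟨hx h.1, h.2⟩

/-- The cell crossed by the path `x` at step `t`. -/
def pathCell (x : Fin (j + 2) → Fin K) (t : Fin (j + 1)) : Fin K × Fin K :=
  cell t (x t.castSucc) (x t.succ)

lemma pathCell_injective (hx : Function.Injective x) : Function.Injective (pathCell x) := by
  intro t s h
  rcases cell_eq_cell hx (i := t.castSucc) (y := x t.succ) (s := s) h with h | h
  · exact Fin.castSucc_injective _ h.1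
  · have h1 := congrArg Fin.val h.1
    have h2 := congrArg Fin.val (hx h.2)
    simp only [Fin.val_castSucc, Fin.val_succ] at h1 h2
    omega

/-- The cells of the `i`-th line of the path `x`. -/
def lineCells (x : Fin (j + 2) → Fin K) (i : Fin (j + 2)) : Finset (Fin K × Fin K) :=
  Finset.univ.image fun y => cell i (x i) y

lemma mem_lineCells (i : Fin (j + 2)) (y : Fin K) : cell i (x i) y ∈ lineCells x i :=
  Finset.mem_image_of_mem _ (Finset.mem_univ _)

lemma card_lineCells_le (i : Fin (j + 2)) : (lineCells x i).card ≤ K :=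
  Finset.card_image_le.trans (by simp)

/-- The value of the best cell of the `i`-th line, when `v` are the values along the path. -/
def lineVal {m : ℕ} (v : Fin (j + 1) → Fin m) (i : Fin (j + 2)) : Fin m :=
  v ⟨min i j, by omega⟩

lemma lineVal_castSucc {m : ℕ} (v : Fin (j + 1) → Fin m) (t : Fin (j + 1)) :
    lineVal v t.castSucc = v t := by
  unfold lineVal
  congr 1
  ext
  simp only [Fin.val_castSucc]
  omega

lemma lineVal_last {m : ℕ} (v : Fin (j + 1) → Fin m) :
    lineVal v (Fin.last (j + 1)) = v (Fin.last j) := by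
  unfold lineVal
  congr 1
  ext
  simp

/-- The bijections for which `x` is a path with values `v`. -/
def pathEquivs (x : Fin (j + 2) → Fin K) (v : Fin (j + 1) → Fin (K ^ 2)) :
    Finset ((Fin K × Fin K) ≃ Fin (K ^ 2)) :=
  Finset.univ.filter fun Ψ => IsPath Ψ x ∧ ∀ t, Ψ (pathCell x t) = v t

lemma constrainedEquivs_subset_pathEquivs (hx : Function.Injective x)
    (v : Fin (j + 1) → Fin (K ^ 2)) (hv : StrictAnti v) :
    constrainedEquivs (Finset.univ.image (pathCell x))
      (Function.extend (pathCell x) v fun _ => v 0)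
      (Finset.univ.biUnion (lineCells x) \ Finset.univ.image (pathCell x))
      (fun p => Finset.univ.filter fun y => ∀ i, p ∈ lineCells x i → lineVal v i < y)
    ⊆ pathEquivs x v := by
  intro Ψ hΨ
  simp only [constrainedEquivs, Finset.mem_filter, Finset.mem_univ, true_and,
    Finset.mem_image, forall_exists_index, forall_apply_eq_imp_iff,
    (pathCell_injective hx).extend_apply, Finset.mem_sdiff, Finset.mem_biUnion, not_exists,
    and_imp] at hΨ
  obtain ⟨h1, h2⟩ := hΨ
  have key : ∀ (i : Fin (j + 2)) (y : Fin K), (∀ s : Fin (j + 1), i = s.castSucc → y ≠ x s.succ) →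
      (i = Fin.last (j + 1) → y ≠ x (Fin.last j).castSucc) →
      lineVal v i < Ψ (cell i (x i) y) := by
    intro i y hy hy'
    by_cases hC : ∃ s, pathCell x s = cell i (x i) y
    · obtain ⟨s, hs⟩ := hC
      rw [← hs, h1 s]
      rcases cell_eq_cell hx hs.symm with ⟨h, h'⟩ | ⟨h, h'⟩
      · exact absurd h' (hy s h)
      · rcases Fin.eq_castSucc_or_eq_last i with ⟨t, rfl⟩ | rfl
        · rw [lineVal_castSucc]
          apply hv
          have := congrArg Fin.val h
          simp only [Fin.val_castSucc, Fin.val_succ] at this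
          rw [Fin.lt_def]
          omega
        · have : s = Fin.last j := by
            rw [← Fin.succ_last] at h
            exact (Fin.succ_injective _ h).symm
          subst this
          exact absurd h' (hy' rfl)
    · push Not at hC
      exact h2 _ i (mem_lineCells i y) hC i (mem_lineCells i y)
  simp only [pathEquivs, Finset.mem_filter, Finset.mem_univ, true_and]
  refine ⟨⟨hx, fun t y hy => ?_, fun y hy => ?_⟩, h1⟩
  · have := key t.castSucc y (fun s hs => by rwa [← Fin.castSucc_injective _ hs])
      (fun h => absurd h (Fin.castSucc_lt_last t).ne)
    rw [lineVal_castSucc, ← h1 t] at this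
    exact this
  · have := key (Fin.last (j + 1)) y (fun s h => absurd h (Fin.castSucc_lt_last s).ne')
      (fun _ => hy)
    rw [lineVal_last, ← h1 (Fin.last j)] at this
    exact this

lemma le_card_pathEquivs (hx : Function.Injective x) (v : Fin (j + 1) → Fin (K ^ 2))
    (hv : StrictAnti v) (hvN : ∀ t, (v t : ℕ) < K ^ 2 - (j + 2) * K) :
    ((K ^ 2 - (j + 1)).factorial : ℝ) *
      ((∏ t, tailFrac (K ^ 2 - (j + 2) * K) (v t + 1) ^ K) *
        tailFrac (K ^ 2 - (j + 2) * K) (v (Fin.last j) + 1) ^ K)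
      ≤ (pathEquivs x v).card := by
  set N := K ^ 2 - (j + 2) * K with hN
  have hcard : Fintype.card (Fin K × Fin K) = K ^ 2 := by simp [sq]
  set C := Finset.univ.image (pathCell x) with hC
  set B := Finset.univ.biUnion (lineCells x) with hB
  set T : Fin K × Fin K → Finset (Fin (K ^ 2)) := fun p =>
    Finset.univ.filter fun y => ∀ i, p ∈ lineCells x i → lineVal v i < y with hT
  set r : Fin K × Fin K → ℝ := fun p =>
    ∏ i, if p ∈ lineCells x i then tailFrac N (lineVal v i + 1) else 1 with hr
  have hCcard : C.card = j + 1 := by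
    rw [hC, Finset.card_image_of_injective _ (pathCell_injective hx)]; simp
  have hCB : C ⊆ B := by
    intro p hp
    obtain ⟨t, -, rfl⟩ := Finset.mem_image.1 hp
    exact Finset.mem_biUnion.2 ⟨t.castSucc, Finset.mem_univ _, mem_lineCells t.castSucc _⟩
  have hBcard : B.card ≤ (j + 2) * K := by
    refine Finset.card_biUnion_le.trans ?_
    refine (Finset.sum_le_card_nsmul _ _ K fun i _ => card_lineCells_le i).trans ?_
    simp
  have hz0 : ∀ i p, 0 ≤ (if p ∈ lineCells x i then tailFrac N (lineVal v i + 1) else 1) := by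
    intro i p; split_ifs
    · exact tailFrac_nonneg _ _
    · exact zero_le_one
  have hz1 : ∀ i p, (if p ∈ lineCells x i then tailFrac N (lineVal v i + 1) else 1) ≤ 1 := by
    intro i p; split_ifs
    · exact tailFrac_le_one _ _
    · exact le_rfl
  have hinj : Set.InjOn (Function.extend (pathCell x) v fun _ => v 0) C := by
    intro p hp q hq h
    obtain ⟨t, -, rfl⟩ := Finset.mem_image.1 hp
    obtain ⟨s, -, rfl⟩ := Finset.mem_image.1 hq
    rw [(pathCell_injective hx).extend_apply, (pathCell_injective hx).extend_apply] at h
    rw [hv.injective h]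
  have hmain := le_card_constrainedEquivs (X := Fin K × Fin K) (Y := Fin (K ^ 2))
    (by rw [hcard, Fintype.card_fin]) ((j + 2) * K) T r (B \ C) C
    (Function.extend (pathCell x) v fun _ => v 0) hinj Finset.disjoint_sdiff
    (by
      rw [Finset.card_sdiff_of_subset hCB]
      have := Finset.card_le_card hCB
      omega)
    (by
      intro p hp
      refine ⟨Finset.prod_nonneg fun i _ => hz0 i p,
        Finset.prod_le_one (fun i _ => hz0 i p) fun i _ => hz1 i p, ?_⟩
      obtain ⟨i, -, hi⟩ := Finset.mem_biUnion.1 (Finset.mem_sdiff.1 hp).1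
      obtain ⟨i₀, hi₀, hmax⟩ := Finset.exists_max_image
        (Finset.univ.filter fun i => p ∈ lineCells x i) (lineVal v) ⟨i, by simpa using hi⟩
      simp only [Finset.mem_filter, Finset.mem_univ, true_and] at hi₀ hmax
      have hT' : Finset.Ioi (lineVal v i₀) ⊆ T p := by
        intro y hy
        simp only [hT, Finset.mem_filter, Finset.mem_univ, true_and]
        exact fun i hi => (hmax i hi).trans_lt (Finset.mem_Ioi.1 hy)
      have hTc := Finset.card_le_card hT'
      rw [Fin.card_Ioi] at hTc
      have hrp : r p ≤ tailFrac N (lineVal v i₀ + 1) := by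
        simp only [hr]
        rw [← Finset.mul_prod_erase _ _ (Finset.mem_univ i₀), if_pos hi₀]
        exact mul_le_of_le_one_right (tailFrac_nonneg _ _)
          (Finset.prod_le_one (fun i _ => hz0 i p) fun i _ => hz1 i p)
      have hlt : (lineVal v i₀ : ℕ) < N := hvN _
      have hNpos : (0 : ℝ) < N := by exact_mod_cast (by omega : 0 < N)
      have hcast : ((Fintype.card (Fin K × Fin K) : ℕ) : ℝ) - ((j + 2) * K : ℕ) = N := by
        rw [hcard, hN, Nat.cast_sub (by omega)]
      rw [hcast]
      have h1 : r p * N ≤ ((N - (lineVal v i₀ + 1) : ℕ) : ℝ) := by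
        refine (mul_le_mul_of_nonneg_right hrp hNpos.le).trans ?_
        rw [tailFrac, div_mul_cancel₀ _ hNpos.ne']
      have h2 : ((N - (lineVal v i₀ + 1) : ℕ) : ℝ) + ((j + 2) * K : ℕ) ≤ (T p).card := by
        have : N - (lineVal v i₀ + 1) + (j + 2) * K ≤ (T p).card := by omega
        exact_mod_cast this
      linarith)
  rw [hcard, hCcard] at hmain
  have hsub := Finset.card_le_card (constrainedEquivs_subset_pathEquivs hx v hv)
  refine le_trans ?_ (hmain.trans (by exact_mod_cast hsub))
  refine mul_le_mul_of_nonneg_left ?_ (by positivity)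
  rw [Finset.prod_comm]
  have : ∀ i : Fin (j + 2), tailFrac N (lineVal v i + 1) ^ K ≤
      ∏ p ∈ B \ C, if p ∈ lineCells x i then tailFrac N (lineVal v i + 1) else 1 := by
    intro i
    rw [Finset.prod_ite, Finset.prod_const, Finset.prod_const_one, mul_one]
    refine pow_le_pow_of_le_one (tailFrac_nonneg _ _) (tailFrac_le_one _ _) ?_
    refine (Finset.card_le_card ?_).trans (card_lineCells_le (x := x) i)
    intro p hp
    exact (Finset.mem_filter.1 hp).2
  refine le_trans (le_of_eq ?_)
    (Finset.prod_le_prod (fun i _ => pow_nonneg (tailFrac_nonneg _ _) K) fun i _ => this i)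
  rw [Fin.prod_univ_castSucc (fun i => tailFrac N (lineVal v i + 1) ^ K)]
  simp only [lineVal_castSucc, lineVal_last]

end PathCount

lemma pow_succ_sub_pow_succ_le {a b : ℝ} (ha : 0 ≤ a) (hab : a ≤ b) (e : ℕ) :
    b ^ (e + 1) - a ^ (e + 1) ≤ (e + 1) * (b - a) * b ^ e := by
  induction e with
  | zero => simp
  | succ e ih =>
    have h1 : a ^ (e + 1) ≤ b ^ (e + 1) := pow_le_pow_left₀ ha hab _
    have h2 := mul_le_mul_of_nonneg_left ih (ha.trans hab)
    have h3 := mul_le_mul_of_nonneg_left h1 (sub_nonneg.2 hab)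
    push_cast
    calc b ^ (e + 1 + 1) - a ^ (e + 1 + 1)
        = b * (b ^ (e + 1) - a ^ (e + 1)) + (b - a) * a ^ (e + 1) := by ring
      _ ≤ b * ((e + 1) * (b - a) * b ^ e) + (b - a) * b ^ (e + 1) := add_le_add h2 h3
      _ = _ := by ring

lemma tailFrac_anti (N : ℕ) {k l : ℕ} (h : k ≤ l) : tailFrac N l ≤ tailFrac N k := by
  unfold tailFrac
  have : ((N - l : ℕ) : ℝ) ≤ (N - k : ℕ) := by exact_mod_cast Nat.sub_le_sub_left h N
  gcongr

lemma tailFrac_eq_zero {N k : ℕ} (h : N ≤ k) : tailFrac N k = 0 := by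
  simp [tailFrac, Nat.sub_eq_zero_of_le h]

lemma tailFrac_pow_sub_le (N k e : ℕ) :
    (N : ℝ) / (e + 1) * (tailFrac N k ^ (e + 1) - tailFrac N (k + 1) ^ (e + 1))
      ≤ tailFrac N k ^ e := by
  have h1 := pow_succ_sub_pow_succ_le (tailFrac_nonneg N (k + 1))
    (tailFrac_anti N (Nat.le_succ k)) e
  have h2 : N * (tailFrac N k - tailFrac N (k + 1)) ≤ 1 := by
    rcases Nat.eq_zero_or_pos N with rfl | hN
    · simp
    have hN' : (N : ℝ) ≠ 0 := by positivity
    unfold tailFrac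
    rw [← sub_div, mul_div_cancel₀ _ hN']
    have : N - k ≤ N - (k + 1) + 1 := by omega
    have : ((N - k : ℕ) : ℝ) ≤ (N - (k + 1) : ℕ) + 1 := by exact_mod_cast this
    linarith
  have h3 : 0 ≤ tailFrac N k ^ e := pow_nonneg (tailFrac_nonneg _ _) _
  calc _ ≤ (N : ℝ) / (e + 1) * ((e + 1) * (tailFrac N k - tailFrac N (k + 1)) * tailFrac N k ^ e) :=
        mul_le_mul_of_nonneg_left h1 (by positivity)
    _ = (N * (tailFrac N k - tailFrac N (k + 1))) * tailFrac N k ^ e := by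
        have : (e : ℝ) + 1 ≠ 0 := by positivity
        field_simp
    _ ≤ _ := mul_le_of_le_one_left h3 h2

lemma le_sum_tailFrac_pow (N e c : ℕ) {α β : ℕ} (h : α ≤ β) :
    (N : ℝ) / (e + 1) * (tailFrac N (α + c) ^ (e + 1) - tailFrac N (β + c) ^ (e + 1))
      ≤ ∑ a ∈ Finset.Ico α β, tailFrac N (a + c) ^ e := by
  induction β, h using Nat.le_induction with
  | base => simp
  | succ β h ih =>
    rw [Finset.sum_Ico_succ_top h]
    have := tailFrac_pow_sub_le N (β + c) e
    rw [show β + 1 + c = β + c + 1 by ring]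
    linarith

lemma sum_fin_ite_eq_sum_Ico {n α β : ℕ} (hβ : β ≤ n) (g : ℕ → ℝ) :
    (∑ a : Fin n, if α ≤ (a : ℕ) ∧ (a : ℕ) < β then g a else 0) = ∑ a ∈ Finset.Ico α β, g a := by
  rw [Fin.sum_univ_eq_sum_range (fun a => if α ≤ a ∧ a < β then g a else 0) n,
    ← Finset.sum_filter]
  congr 1
  ext a
  simp only [Finset.mem_filter, Finset.mem_range, Finset.mem_Ico]
  omega

lemma strictAnti_snoc {j n : ℕ} {u : Fin j → Fin n} {a : Fin n} (hu : StrictAnti u)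
    (h : ∀ i, a < u i) : StrictAnti (Fin.snoc u a : Fin (j + 1) → Fin n) := by
  intro i k hik
  induction k using Fin.lastCases with
  | last =>
    induction i using Fin.lastCases with
    | last => exact absurd hik (lt_irrefl _)
    | cast i => simpa using h i
  | cast k =>
    induction i using Fin.lastCases with
    | last => exact absurd hik (not_lt.2 (Fin.le_last _))
    | cast i =>
      simp only [Fin.snoc_castSucc]
      exact hu (Fin.castSucc_lt_castSucc_iff.1 hik)

lemma le_sum_snoc {j n α β N : ℕ} (hβn : β ≤ n) (hβN : β ≤ N) (g h : ℕ → ℝ)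
    (hg : ∀ a, 0 ≤ g a) (hh : ∀ a, 0 ≤ h a) :
    ∑ a ∈ Finset.Ico α β, h a * ∑ u : Fin j → Fin n,
        (if StrictAnti u ∧ ∀ i, a < (u i : ℕ) ∧ (u i : ℕ) < N then ∏ i, g (u i) else 0)
      ≤ ∑ v : Fin (j + 1) → Fin n,
        if (StrictAnti v ∧ (∀ i, (v i : ℕ) < N)) ∧
            α ≤ (v (Fin.last j) : ℕ) ∧ (v (Fin.last j) : ℕ) < β
          then (∏ i : Fin j, g (v i.castSucc)) * h (v (Fin.last j)) else 0 := by
  rw [← (Fin.snocEquiv fun _ => Fin n).sum_comp, Fintype.sum_prod_type,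
    ← sum_fin_ite_eq_sum_Ico hβn]
  refine Finset.sum_le_sum fun a _ => ?_
  split_ifs with ha
  · rw [Finset.mul_sum]
    refine Finset.sum_le_sum fun u _ => ?_
    simp only [Fin.snocEquiv_apply, Fin.snoc_last, Fin.snoc_castSucc]
    split_ifs with h1 h2 h2
    · rw [mul_comm]
    · refine absurd ⟨⟨strictAnti_snoc h1.1 fun i => (h1.2 i).1, fun i => ?_⟩, ha⟩ h2
      induction i using Fin.lastCases with
      | last => simp only [Fin.snoc_last]; omega
      | cast i => simpa using (h1.2 i).2
    · rw [mul_zero]; exact mul_nonneg (Finset.prod_nonneg fun i _ => hg _) (hh _)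
    · rw [mul_zero]
  · refine Finset.sum_nonneg fun u _ => ?_
    split_ifs
    · exact mul_nonneg (Finset.prod_nonneg fun i _ => hg _) (hh _)
    · exact le_rfl

lemma le_sum_strictAnti {n N : ℕ} (hN : N ≤ n) (K : ℕ) (j : ℕ) : ∀ w : ℕ,
    (N : ℝ) ^ j / ((K + 1) ^ j * j.factorial) * tailFrac N (w + 1 + j) ^ ((K + 1) * j)
      ≤ ∑ v : Fin j → Fin n, if StrictAnti v ∧ ∀ i, w < (v i : ℕ) ∧ (v i : ℕ) < N
          then ∏ i, tailFrac N (v i + 1) ^ K else 0 := by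
  induction j with
  | zero =>
    intro w
    simp [Subsingleton.strictAnti]
  | succ j ih =>
    intro w
    have hg : ∀ a, 0 ≤ tailFrac N (a + 1) ^ K := fun a => pow_nonneg (tailFrac_nonneg _ _) _
    rcases le_or_gt N (w + 1) with hw | hw
    · rw [tailFrac_eq_zero (by omega), zero_pow (by positivity), mul_zero]
      refine Finset.sum_nonneg fun v _ => ?_
      split_ifs
      · exact Finset.prod_nonneg fun i _ => hg _
      · exact le_rfl
    have h1 := le_sum_snoc (j := j) (n := n) (α := w + 1) (β := N) (N := N) hN le_rfl
      (fun a => tailFrac N (a + 1) ^ K) (fun a => tailFrac N (a + 1) ^ K) hg hg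
    refine le_trans ?_ (h1.trans (Finset.sum_le_sum fun v _ => ?_))
    · set c : ℝ := (N : ℝ) ^ j / ((K + 1) ^ j * j.factorial) with hc
      have hc0 : 0 ≤ c := by positivity
      have h2 := le_sum_tailFrac_pow N ((K + 1) * j + K) (1 + j) hw.le
      rw [tailFrac_eq_zero (N := N) (k := N + (1 + j)) (by omega),
        zero_pow (Nat.succ_ne_zero _), sub_zero] at h2
      calc _ = c * ((N : ℝ) / (((K + 1) * j + K : ℕ) + 1) *
            tailFrac N (w + 1 + (1 + j)) ^ ((K + 1) * j + K + 1)) := by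
            rw [show w + 1 + (1 + j) = w + 1 + (j + 1) by ring,
              show (K + 1) * j + K + 1 = (K + 1) * (j + 1) by ring, ← mul_assoc, hc]
            congr 1
            push_cast [Nat.factorial_succ]
            rw [div_mul_div_comm]
            congr 1
            ring
        _ ≤ c * ∑ a ∈ Finset.Ico (w + 1) N, tailFrac N (a + (1 + j)) ^ ((K + 1) * j + K) :=
            mul_le_mul_of_nonneg_left h2 hc0
        _ ≤ _ := by
            rw [Finset.mul_sum]
            refine Finset.sum_le_sum fun a _ => ?_
            calc _ = tailFrac N (a + 1 + j) ^ K *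
                    (c * tailFrac N (a + 1 + j) ^ ((K + 1) * j)) := by
                    rw [pow_add, ← add_assoc]; ring
              _ ≤ _ := by
                    refine mul_le_mul ?_ (ih a) ?_ (hg a)
                    · exact pow_le_pow_left₀ (tailFrac_nonneg _ _)
                        (tailFrac_anti N (by omega)) _
                    · exact mul_nonneg hc0 (pow_nonneg (tailFrac_nonneg _ _) _)
    · rw [← Fin.prod_univ_castSucc (fun i => tailFrac N (v i + 1) ^ K)]
      split_ifs with h3 h4 h4
      · exact le_rfl
      · refine absurd ⟨h3.1.1, fun i => ⟨?_, h3.1.2 i⟩⟩ h4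
        have := Fin.le_def.1 (h3.1.1.antitone (Fin.le_last i))
        omega
      · exact Finset.prod_nonneg fun i _ => hg _
      · exact le_rfl

lemma le_sum_strictAnti_last {n N : ℕ} (hN : N ≤ n) (K j : ℕ) {α β : ℕ} (hαβ : α ≤ β)
    (hβ : β ≤ N) :
    (N : ℝ) ^ (j + 1) / ((K + 1) ^ j * j.factorial * ((K + 1) * j + 2 * K + 1)) *
        (tailFrac N (α + (1 + j)) ^ ((K + 1) * j + 2 * K + 1) -
          tailFrac N (β + (1 + j)) ^ ((K + 1) * j + 2 * K + 1))
      ≤ ∑ v : Fin (j + 1) → Fin n,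
        if (StrictAnti v ∧ (∀ i, (v i : ℕ) < N)) ∧
            α ≤ (v (Fin.last j) : ℕ) ∧ (v (Fin.last j) : ℕ) < β
          then (∏ i, tailFrac N (v i + 1) ^ K) * tailFrac N (v (Fin.last j) + 1) ^ K else 0 := by
  have hg : ∀ k a, 0 ≤ tailFrac N (a + 1) ^ k := fun k a => pow_nonneg (tailFrac_nonneg _ _) _
  have h1 := le_sum_snoc (j := j) (n := n) (α := α) (β := β) (N := N) (hβ.trans hN) hβ
    (fun a => tailFrac N (a + 1) ^ K) (fun a => tailFrac N (a + 1) ^ (2 * K)) (hg K) (hg (2 * K))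
  refine le_trans ?_ (h1.trans (le_of_eq (Finset.sum_congr rfl fun v _ => ?_)))
  · set c : ℝ := (N : ℝ) ^ j / ((K + 1) ^ j * j.factorial) with hc
    have hc0 : 0 ≤ c := by positivity
    have h2 := le_sum_tailFrac_pow N ((K + 1) * j + 2 * K) (1 + j) hαβ
    calc _ = c * ((N : ℝ) / (((K + 1) * j + 2 * K : ℕ) + 1) *
          (tailFrac N (α + (1 + j)) ^ ((K + 1) * j + 2 * K + 1) -
          tailFrac N (β + (1 + j)) ^ ((K + 1) * j + 2 * K + 1))) := by
          rw [hc]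
          push_cast
          rw [← mul_assoc, div_mul_div_comm, ← pow_succ]
      _ ≤ c * ∑ a ∈ Finset.Ico α β, tailFrac N (a + (1 + j)) ^ ((K + 1) * j + 2 * K) :=
          mul_le_mul_of_nonneg_left h2 hc0
      _ ≤ _ := by
          rw [Finset.mul_sum]
          refine Finset.sum_le_sum fun a _ => ?_
          calc _ = tailFrac N (a + 1 + j) ^ (2 * K) *
                  (c * tailFrac N (a + 1 + j) ^ ((K + 1) * j)) := by
                  rw [pow_add, ← add_assoc]; ring
            _ ≤ _ := by
                  refine mul_le_mul ?_ (le_sum_strictAnti hN K j a) ?_ (hg (2 * K) a)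
                  · exact pow_le_pow_left₀ (tailFrac_nonneg _ _)
                      (tailFrac_anti N (by omega)) _
                  · exact mul_nonneg hc0 (pow_nonneg (tailFrac_nonneg _ _) _)
  · rw [Fin.prod_univ_castSucc (fun i => tailFrac N (v i + 1) ^ K), mul_assoc, ← pow_add,
      ← two_mul]

section PathSum

variable {K : ℕ}

lemma le_sum_card_paths (j : ℕ) {α β : ℕ} (hαβ : α ≤ β) (hβ : β ≤ K ^ 2 - (j + 2) * K) :
    (K.descFactorial (j + 2) : ℝ) * ((K ^ 2 - (j + 1)).factorial *
      (((K ^ 2 - (j + 2) * K : ℕ) : ℝ) ^ (j + 1) /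
          ((K + 1) ^ j * j.factorial * ((K + 1) * j + 2 * K + 1)) *
        (tailFrac (K ^ 2 - (j + 2) * K) (α + (1 + j)) ^ ((K + 1) * j + 2 * K + 1) -
          tailFrac (K ^ 2 - (j + 2) * K) (β + (1 + j)) ^ ((K + 1) * j + 2 * K + 1))))
      ≤ ∑ Ψ : (Fin K × Fin K) ≃ Fin (K ^ 2), ((paths Ψ j α β).card : ℝ) := by
  set N := K ^ 2 - (j + 2) * K with hN
  have hswap : ∑ Ψ : (Fin K × Fin K) ≃ Fin (K ^ 2), ((paths Ψ j α β).card : ℝ) =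
      ∑ x : Fin (j + 2) → Fin K, ((Finset.univ.filter fun Ψ : (Fin K × Fin K) ≃ Fin (K ^ 2) =>
        IsPath Ψ x ∧ α ≤ (Ψ (endCell x) : ℕ) ∧ (Ψ (endCell x) : ℕ) < β).card : ℝ) := by
    simp only [paths, Finset.card_filter, Nat.cast_sum]
    exact Finset.sum_comm
  have hinj : (Finset.univ.filter fun x : Fin (j + 2) → Fin K => Function.Injective x).card
      = K.descFactorial (j + 2) := by
    rw [← Fintype.card_subtype, Fintype.card_congr (Equiv.subtypeInjectiveEquivEmbedding _ _),
      Fintype.card_embedding_eq, Fintype.card_fin, Fintype.card_fin]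
  rw [hswap, ← hinj, ← nsmul_eq_mul, ← Finset.sum_const]
  refine le_trans (Finset.sum_le_sum fun x hx => ?_)
    (Finset.sum_le_sum_of_subset_of_nonneg (Finset.subset_univ _) fun _ _ _ => Nat.cast_nonneg _)
  have hx : Function.Injective x := (Finset.mem_filter.1 hx).2
  refine (mul_le_mul_of_nonneg_left (le_sum_strictAnti_last (n := K ^ 2) (Nat.sub_le _ _) K j
    hαβ hβ) (Nat.cast_nonneg _)).trans ?_
  rw [← Finset.sum_filter, Finset.mul_sum]
  refine (Finset.sum_le_sum fun v hv => ?_ : _ ≤ ∑ v ∈ _, ((pathEquivs x v).card : ℝ)).trans ?_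
  · have := (Finset.mem_filter.1 hv).2
    exact le_card_pathEquivs hx v this.1.1 this.1.2
  · rw [← Nat.cast_sum, ← Finset.card_biUnion]
    · refine Nat.cast_le.2 (Finset.card_le_card fun Ψ hΨ => ?_)
      simp only [Finset.mem_biUnion, Finset.mem_filter, Finset.mem_univ, true_and,
        pathEquivs] at hΨ ⊢
      obtain ⟨v, hv, hp, he⟩ := hΨ
      have := he (Fin.last j)
      rw [show endCell x = pathCell x (Fin.last j) from rfl, this]
      exact ⟨hp, hv.2⟩
    · intro v _ v' _ hne
      rw [Function.onFun, Finset.disjoint_left]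
      intro Ψ h h'
      simp only [pathEquivs, Finset.mem_filter, Finset.mem_univ, true_and] at h h'
      exact hne (funext fun t => (h.2 t).symm.trans (h'.2 t))

end PathSum

section SecondMoment

variable {K : ℕ}

/-- An upper bound for the proportion of values in `{0, …, n - 1}` exceeding `i`. -/
def expTail (n i : ℕ) : ℝ := Real.exp (-((i - 1 : ℕ) : ℝ) / n)

lemma expTail_nonneg (n i : ℕ) : 0 ≤ expTail n i := (Real.exp_pos _).le

lemma expTail_le_one (n i : ℕ) : expTail n i ≤ 1 := by
  unfold expTail
  rw [Real.exp_le_one_iff, neg_div]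
  exact neg_nonpos.2 (by positivity)

lemma card_Ioi_sdiff_pair_le {n : ℕ} {i i' : Fin n} (hne : i ≠ i') (l : Fin n) :
    ((Finset.Ioi l \ {i, i'}).card : ℝ) ≤ expTail n l * (n - (2 : ℕ)) := by
  have h1 : (Finset.Ioi l \ {i, i'}).card ≤ n - 2 := by
    have := Finset.card_le_card
      (Finset.sdiff_subset_sdiff (Finset.subset_univ (Finset.Ioi l)) (le_refl {i, i'}))
    rwa [Finset.card_sdiff_of_subset (Finset.subset_univ _), Finset.card_pair hne,
      Finset.card_univ, Fintype.card_fin] at this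
  have h2 : (Finset.Ioi l \ {i, i'}).card ≤ n - 1 - l := by
    refine (Finset.card_le_card Finset.sdiff_subset).trans ?_
    rw [Fin.card_Ioi]
  have hn : 2 ≤ n := by
    have := Finset.card_le_univ ({i, i'} : Finset (Fin n))
    rwa [Finset.card_pair hne, Fintype.card_fin] at this
  have hl := l.2
  have hn' : (2 : ℝ) ≤ n := by exact_mod_cast hn
  have h3 : ((Finset.Ioi l \ {i, i'}).card : ℝ) ≤ n - 2 - ((l - 1 : ℕ) : ℝ) := by
    have : (Finset.Ioi l \ {i, i'}).card + (l - 1) + 2 ≤ n := by omega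
    have : ((Finset.Ioi l \ {i, i'}).card : ℝ) + ((l - 1 : ℕ) : ℝ) + 2 ≤ n := by exact_mod_cast this
    linarith
  have h4 : 1 - ((l - 1 : ℕ) : ℝ) / n ≤ expTail n l := by
    have := Real.add_one_le_exp (-((l - 1 : ℕ) : ℝ) / n)
    unfold expTail
    rw [neg_div] at this ⊢
    linarith
  have h5 : ((l - 1 : ℕ) : ℝ) / n * (n - 2) ≤ ((l - 1 : ℕ) : ℝ) := by
    rw [div_mul_eq_mul_div, div_le_iff₀ (by linarith)]
    exact mul_le_mul_of_nonneg_left (by linarith) (by positivity)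
  have h6 := mul_le_mul_of_nonneg_right h4 (sub_nonneg.2 hn')
  push_cast
  linarith

/-- The cells in the cross of `p` and not in the cross of `p'`, other than `p`. -/
def crossDiff (p p' : Fin K × Fin K) : Finset (Fin K × Fin K) :=
  ({p.1, p'.1}ᶜ ×ˢ {p.2}) ∪ ({p.1} ×ˢ {p.2, p'.2}ᶜ)

lemma mem_crossDiff {p p' q : Fin K × Fin K} : q ∈ crossDiff p p' ↔
    (q.1 ≠ p.1 ∧ q.1 ≠ p'.1 ∧ q.2 = p.2) ∨ (q.1 = p.1 ∧ q.2 ≠ p.2 ∧ q.2 ≠ p'.2) := by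
  simp only [crossDiff, Finset.mem_union, Finset.mem_product, Finset.mem_compl, Finset.mem_insert,
    Finset.mem_singleton, not_or, ne_eq, and_assoc]

lemma card_crossDiff {p p' : Fin K × Fin K} (h1 : p.1 ≠ p'.1) (h2 : p.2 ≠ p'.2) :
    (crossDiff p p').card = 2 * K - 4 := by
  rw [crossDiff, Finset.card_union_of_disjoint]
  · rw [Finset.card_product, Finset.card_product, Finset.card_compl, Finset.card_compl,
      Finset.card_pair h1, Finset.card_pair h2, Fintype.card_fin]
    simp only [Finset.card_singleton]
    omega
  · rw [Finset.disjoint_left]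
    rintro q hq hq'
    simp only [Finset.mem_product, Finset.mem_compl, Finset.mem_insert, Finset.mem_singleton,
      not_or] at hq hq'
    exact hq.1.1 hq'.1

lemma card_pair_isPNE_le {p p' : Fin K × Fin K} (h1 : p.1 ≠ p'.1) (h2 : p.2 ≠ p'.2)
    (i i' : Fin (K ^ 2)) :
    ((Finset.univ.filter fun Ψ : (Fin K × Fin K) ≃ Fin (K ^ 2) =>
      (IsPNE (pot Ψ) p ∧ IsPNE (pot Ψ) p') ∧ Ψ p = i ∧ Ψ p' = i').card : ℝ)
      ≤ (K ^ 2 - 2).factorial *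
        (expTail (K ^ 2) i ^ (2 * K - 4) * expTail (K ^ 2) i' ^ (2 * K - 4)) := by
  have hpp : p ≠ p' := fun h => h1 (h ▸ rfl)
  rcases eq_or_ne i i' with rfl | hne
  · rw [Finset.filter_false_of_mem, Finset.card_empty, Nat.cast_zero]
    · have := expTail_nonneg (K ^ 2) i
      positivity
    · rintro Ψ - ⟨-, h, h'⟩
      exact hpp (Ψ.injective (h.trans h'.symm))
  have hcard : Fintype.card (Fin K × Fin K) = K ^ 2 := by simp [sq]
  set val : Fin K × Fin K → Fin (K ^ 2) := fun q => if q ∈ crossDiff p p' then i else i' with hval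
  set v : Fin K × Fin K → Fin (K ^ 2) := fun q => if q = p then i else i' with hv
  have hvp : v p = i := if_pos rfl
  have hvp' : v p' = i' := if_neg hpp.symm
  have himg : ({p, p'} : Finset (Fin K × Fin K)).image v = {i, i'} := by
    rw [Finset.image_insert, Finset.image_singleton, hvp, hvp']
  have hdisj : Disjoint (crossDiff p p') (crossDiff p' p) := by
    rw [Finset.disjoint_left]
    intro q hq hq'
    rw [mem_crossDiff] at hq hq'
    rcases hq with hq | hq <;> rcases hq' with hq' | hq'
    · exact h2 (hq.2.2.symm.trans hq'.2.2)
    · exact hq.2.1 hq'.1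
    · exact hq'.2.1 hq.1
    · exact h1 (hq.1.symm.trans hq'.1)
  have hmain := card_constrainedEquivs_le (X := Fin K × Fin K) (Y := Fin (K ^ 2))
    (by rw [hcard, Fintype.card_fin]) (fun q => Finset.Ioi (val q))
    (fun q => expTail (K ^ 2) (val q)) (fun q => K ^ 2 - val q)
    (fun q q' h => by
      refine Finset.Ioi_subset_Ioi ?_
      have h3 := (val q).2
      have h4 := (val q').2
      rw [Fin.le_def]
      omega)
    (crossDiff p p' ∪ crossDiff p' p) {p, p'} v
    (by
      intro a ha b hb hab
      simp only [Finset.coe_insert, Finset.coe_singleton, Set.mem_insert_iff,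
        Set.mem_singleton_iff] at ha hb
      rcases ha with rfl | rfl <;> rcases hb with rfl | rfl
      · rfl
      · exact absurd (hvp.symm.trans (hab.trans hvp')) hne
      · exact absurd (hvp'.symm.trans (hab.trans hvp)) hne.symm
      · rfl)
    (by
      rw [Finset.disjoint_left]
      intro q hq
      simp only [Finset.mem_insert, Finset.mem_singleton] at hq
      simp only [Finset.mem_union, mem_crossDiff]
      rcases hq with rfl | rfl <;> simp [h1, h2, h1.symm, h2.symm])
    (by
      intro q _
      refine ⟨expTail_nonneg _ _, expTail_le_one _ _, ?_⟩
      have h := card_Ioi_sdiff_pair_le hne (val q)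
      rw [← himg] at h
      rw [hcard, Finset.card_pair hpp]
      convert h)
  rw [hcard, Finset.card_pair hpp, Finset.prod_union hdisj] at hmain
  have e1 : ∏ q ∈ crossDiff p p', expTail (K ^ 2) (val q) = expTail (K ^ 2) i ^ (2 * K - 4) := by
    rw [← card_crossDiff h1 h2, ← Finset.prod_const]
    exact Finset.prod_congr rfl fun q hq => by rw [hval]; simp only [if_pos hq]
  have e2 : ∏ q ∈ crossDiff p' p, expTail (K ^ 2) (val q) = expTail (K ^ 2) i' ^ (2 * K - 4) := by
    rw [← card_crossDiff h1.symm h2.symm, ← Finset.prod_const]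
    refine Finset.prod_congr rfl fun q hq => ?_
    have : q ∉ crossDiff p p' := fun h => Finset.disjoint_left.1 hdisj h hq
    rw [hval]; simp only [if_neg this]
  rw [e1, e2] at hmain
  refine le_trans (Nat.cast_le.2 (Finset.card_le_card fun Ψ hΨ => ?_)) hmain
  simp only [constrainedEquivs, Finset.mem_filter, Finset.mem_univ, true_and,
    Finset.forall_mem_insert, Finset.mem_singleton, forall_eq, hvp, hvp', Finset.mem_union,
    Finset.mem_Ioi, IsPNE, pot_lt_pot] at hΨ ⊢
  obtain ⟨⟨hp, hp'⟩, hi, hi'⟩ := hΨ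
  refine ⟨⟨hi, hi'⟩, fun q hq => ?_⟩
  by_cases hq1 : q ∈ crossDiff p p'
  · simp only [hval, if_pos hq1]
    rw [← hi]
    rcases mem_crossDiff.1 hq1 with h | h
    · have := hp.1 q.1 h.1
      rwa [← h.2.2] at this
    · have := hp.2 q.2 h.2.1
      rwa [← h.1] at this
  · simp only [hval, if_neg hq1]
    rw [← hi']
    rcases mem_crossDiff.1 (hq.resolve_left hq1) with h | h
    · have := hp'.1 q.1 h.1
      rwa [← h.2.2] at this
    · have := hp'.2 q.2 h.2.1
      rwa [← h.1] at this

lemma card_pair_mem_pneBelow_le (V : ℕ) {p p' : Fin K × Fin K} (hpp : p ≠ p') :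
    ((Finset.univ.filter fun Ψ : (Fin K × Fin K) ≃ Fin (K ^ 2) =>
      p ∈ pneBelow Ψ V ∧ p' ∈ pneBelow Ψ V).card : ℝ)
      ≤ (K ^ 2 - 2).factorial * (∑ i ∈ Finset.range V, expTail (K ^ 2) i ^ (2 * K - 4)) ^ 2 := by
  by_cases h : p.1 ≠ p'.1 ∧ p.2 ≠ p'.2
  · set I := Finset.univ.filter fun i : Fin (K ^ 2) => (i : ℕ) < V with hI
    have hsub : (Finset.univ.filter fun Ψ : (Fin K × Fin K) ≃ Fin (K ^ 2) =>
        p ∈ pneBelow Ψ V ∧ p' ∈ pneBelow Ψ V) ⊆ (I ×ˢ I).biUnion fun ii =>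
        Finset.univ.filter fun Ψ : (Fin K × Fin K) ≃ Fin (K ^ 2) =>
          (IsPNE (pot Ψ) p ∧ IsPNE (pot Ψ) p') ∧ Ψ p = ii.1 ∧ Ψ p' = ii.2 := by
      intro Ψ hΨ
      simp only [pneBelow, pneFinset, Finset.mem_filter, Finset.mem_univ, true_and] at hΨ
      simp only [hI, Finset.mem_biUnion, Finset.mem_product, Finset.mem_filter, Finset.mem_univ,
        true_and]
      exact ⟨(Ψ p, Ψ p'), ⟨hΨ.1.2, hΨ.2.2⟩, ⟨hΨ.1.1, hΨ.2.1⟩, rfl, rfl⟩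
    have hIsum : ∑ i ∈ I, expTail (K ^ 2) i ^ (2 * K - 4)
        ≤ ∑ i ∈ Finset.range V, expTail (K ^ 2) i ^ (2 * K - 4) := by
      rw [← Finset.sum_image (s := I) (g := fun i : Fin (K ^ 2) => (i : ℕ))
        (f := fun i => expTail (K ^ 2) i ^ (2 * K - 4)) fun a _ b _ hab => Fin.ext hab]
      refine Finset.sum_le_sum_of_subset_of_nonneg ?_
        fun i _ _ => pow_nonneg (expTail_nonneg _ _) _
      intro i hi
      obtain ⟨a, ha, rfl⟩ := Finset.mem_image.1 hi
      exact Finset.mem_range.2 (Finset.mem_filter.1 ha).2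
    calc _ ≤ ((∑ ii ∈ I ×ˢ I, (Finset.univ.filter fun Ψ : (Fin K × Fin K) ≃ Fin (K ^ 2) =>
          (IsPNE (pot Ψ) p ∧ IsPNE (pot Ψ) p') ∧ Ψ p = ii.1 ∧ Ψ p' = ii.2).card : ℕ) : ℝ) :=
          Nat.cast_le.2 ((Finset.card_le_card hsub).trans Finset.card_biUnion_le)
      _ ≤ ∑ ii ∈ I ×ˢ I, ((K ^ 2 - 2).factorial : ℝ) *
          (expTail (K ^ 2) ii.1 ^ (2 * K - 4) * expTail (K ^ 2) ii.2 ^ (2 * K - 4)) := by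
          rw [Nat.cast_sum]
          exact Finset.sum_le_sum fun ii _ => card_pair_isPNE_le h.1 h.2 _ _
      _ = (K ^ 2 - 2).factorial * (∑ i ∈ I, expTail (K ^ 2) i ^ (2 * K - 4)) ^ 2 := by
          rw [← Finset.mul_sum, sq (∑ i ∈ I, expTail (K ^ 2) i ^ (2 * K - 4)), Finset.sum_mul_sum,
            Finset.sum_product]
      _ ≤ _ := by
          refine mul_le_mul_of_nonneg_left (pow_le_pow_left₀ ?_ hIsum 2) (Nat.cast_nonneg _)
          exact Finset.sum_nonneg fun i _ => pow_nonneg (expTail_nonneg _ _) _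
  · rw [Finset.filter_false_of_mem, Finset.card_empty, Nat.cast_zero]
    · positivity
    · rintro Ψ - ⟨hp, hp'⟩
      simp only [pneBelow, pneFinset, Finset.mem_filter, Finset.mem_univ, true_and, IsPNE,
        pot_lt_pot] at hp hp'
      obtain ⟨a, b⟩ := p
      obtain ⟨a', b'⟩ := p'
      rw [not_and_or, not_ne_iff, not_ne_iff] at h
      rcases h with (rfl : a = a') | (rfl : b = b')
      · have hb : b' ≠ b := fun h => hpp (by rw [h])
        exact lt_asymm (hp.1.2 b' hb) (hp'.1.2 b hb.symm)
      · have ha : a' ≠ a := fun h => hpp (by rw [h])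
        exact lt_asymm (hp.1.1 a' ha) (hp'.1.1 a ha.symm)

lemma card_potentials (K : ℕ) :
    Fintype.card ((Fin K × Fin K) ≃ Fin (K ^ 2)) = (K ^ 2).factorial := by
  have hcard : Fintype.card (Fin K × Fin K) = K ^ 2 := by simp [sq]
  rw [Fintype.card_equiv (Fintype.equivOfCardEq (by rw [hcard, Fintype.card_fin])), hcard]

lemma sum_card_pneBelow_sq_le (hK : 2 ≤ K) (V : ℕ) :
    ∑ Ψ : (Fin K × Fin K) ≃ Fin (K ^ 2), ((pneBelow Ψ V).card : ℝ) ^ 2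
      ≤ (K ^ 2).factorial *
        (K + (∑ i ∈ Finset.range V, expTail (K ^ 2) i ^ (2 * K - 4)) ^ 2) := by
  set G := ∑ i ∈ Finset.range V, expTail (K ^ 2) i ^ (2 * K - 4)
  have hcard : Fintype.card (Fin K × Fin K) = K ^ 2 := by simp [sq]
  have h1 : ∀ Ψ : (Fin K × Fin K) ≃ Fin (K ^ 2), ((pneBelow Ψ V).card : ℝ) ^ 2 ≤
      K + ∑ pp ∈ (Finset.univ : Finset (Fin K × Fin K)).offDiag,
        if pp.1 ∈ pneBelow Ψ V ∧ pp.2 ∈ pneBelow Ψ V then (1 : ℝ) else 0 := by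
    intro Ψ
    have e1 : (pneBelow Ψ V).card ^ 2
        = (pneBelow Ψ V).card + (pneBelow Ψ V).offDiag.card := by
      rw [Finset.offDiag_card, sq]
      have := Nat.le_mul_self (pneBelow Ψ V).card
      omega
    have e2 : (pneBelow Ψ V).offDiag =
        (Finset.univ : Finset (Fin K × Fin K)).offDiag.filter fun pp =>
          pp.1 ∈ pneBelow Ψ V ∧ pp.2 ∈ pneBelow Ψ V := by
      ext pp
      simp only [Finset.mem_offDiag, Finset.mem_filter, Finset.mem_univ, true_and]
      tauto
    rw [← Finset.sum_filter, ← e2, Finset.sum_const, nsmul_eq_mul, mul_one]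
    have e3 := card_pneBelow_le Ψ V
    have : (pneBelow Ψ V).card ^ 2 ≤ K + (pneBelow Ψ V).offDiag.card := by omega
    exact_mod_cast this
  refine (Finset.sum_le_sum fun Ψ _ => h1 Ψ).trans ?_
  rw [Finset.sum_add_distrib, Finset.sum_const, Finset.card_univ, card_potentials, nsmul_eq_mul,
    mul_add, Finset.sum_comm]
  refine add_le_add le_rfl ?_
  calc _ ≤ ∑ pp ∈ (Finset.univ : Finset (Fin K × Fin K)).offDiag,
        ((K ^ 2 - 2).factorial : ℝ) * G ^ 2 := by
        refine Finset.sum_le_sum fun pp hpp => ?_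
        rw [← Finset.sum_filter, Finset.sum_const, nsmul_eq_mul, mul_one]
        exact card_pair_mem_pneBelow_le V (Finset.mem_offDiag.1 hpp).2.2
    _ = _ := by
        rw [Finset.sum_const, Finset.offDiag_card, Finset.card_univ, hcard, nsmul_eq_mul,
          ← mul_assoc, ← Nat.cast_mul]
        congr 2
        have hn : 2 ≤ K ^ 2 := by nlinarith
        obtain ⟨m, hm⟩ := Nat.exists_eq_add_of_le hn
        rw [hm, show 2 + m - 2 = m by omega, show 2 + m = m + 1 + 1 by ring, Nat.factorial_succ,
          Nat.factorial_succ, ← mul_assoc]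
        congr 1
        rw [show (m + 1 + 1) * (m + 1 + 1) = (m + 1 + 1) * (m + 1) + (m + 1 + 1) by ring]
        omega

end SecondMoment

section Asymptotics

open Filter Topology

/-- The lower bound for the normalised expected number of paths obtained from
`le_sum_card_paths`. -/
def pathBound (j K α β : ℕ) : ℝ :=
  (K.descFactorial (j + 2) : ℝ) * ((K ^ 2 - (j + 1)).factorial *
    (((K ^ 2 - (j + 2) * K : ℕ) : ℝ) ^ (j + 1) /
      ((K + 1) ^ j * j.factorial * ((K + 1) * j + 2 * K + 1)) *
      (tailFrac (K ^ 2 - (j + 2) * K) (α + (1 + j)) ^ ((K + 1) * j + 2 * K + 1)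
        - tailFrac (K ^ 2 - (j + 2) * K) (β + (1 + j)) ^ ((K + 1) * j + 2 * K + 1)))) /
    ((K ^ 2).factorial * K)

lemma pathBound_le (j : ℕ) {K α β : ℕ} (hαβ : α ≤ β) (hβ : β ≤ K ^ 2 - (j + 2) * K) :
    pathBound j K α β ≤ (∑ Ψ : (Fin K × Fin K) ≃ Fin (K ^ 2), ((paths Ψ j α β).card : ℝ)) /
      ((K ^ 2).factorial * K) :=
  div_le_div_of_nonneg_right (le_sum_card_paths j hαβ hβ) (by positivity)

lemma tendsto_natCast_div_sq_sub (m : ℕ) :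
    Tendsto (fun K : ℕ => ((K ^ 2 - m * K : ℕ) : ℝ) / K ^ 2) atTop (𝓝 1) := by
  have h : Tendsto (fun K : ℕ => 1 - (m : ℝ) / K) atTop (𝓝 (1 - 0)) :=
    tendsto_const_nhds.sub (tendsto_const_div_atTop_nhds_zero_nat _)
  rw [sub_zero] at h
  refine h.congr' ?_
  filter_upwards [eventually_ge_atTop (m + 1)] with K hK
  have hK0 : (0 : ℝ) < K := by exact_mod_cast (by omega : 0 < K)
  rw [Nat.cast_sub (by nlinarith)]
  push_cast
  field_simp

lemma tendsto_tailFrac_const (i : ℕ) :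
    Tendsto (fun K : ℕ => tailFrac K i) atTop (𝓝 1) := by
  have h : Tendsto (fun K : ℕ => 1 - (i : ℝ) / K) atTop (𝓝 (1 - 0)) :=
    tendsto_const_nhds.sub (tendsto_const_div_atTop_nhds_zero_nat _)
  rw [sub_zero] at h
  refine h.congr' ?_
  filter_upwards [eventually_ge_atTop (i + 1)] with K hK
  have hK0 : (0 : ℝ) < K := by exact_mod_cast (by omega : 0 < K)
  rw [tailFrac, Nat.cast_sub (by omega)]
  field_simp

lemma tendsto_descFactorial_div_pow (m : ℕ) :
    Tendsto (fun K : ℕ => (K.descFactorial m : ℝ) / (K : ℝ) ^ m) atTop (𝓝 1) := by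
  have h : Tendsto (fun K : ℕ => ∏ i ∈ Finset.range m, tailFrac K i) atTop
      (𝓝 (∏ _i ∈ Finset.range m, 1)) := tendsto_finsetProd _ fun i _ => tendsto_tailFrac_const i
  rw [Finset.prod_const_one] at h
  refine h.congr fun K => ?_
  simp only [tailFrac, Finset.prod_div_distrib, Finset.prod_const, Finset.card_range,
    Nat.descFactorial_eq_prod_range, Nat.cast_prod]

lemma tendsto_div_sq_sub {α : ℕ → ℕ} {u : ℝ}
    (hα : Tendsto (fun K : ℕ => (α K : ℝ) / K) atTop (𝓝 u)) (i m : ℕ) :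
    Tendsto (fun K : ℕ => (K : ℝ) * (((α K + i : ℕ) : ℝ) / ((K ^ 2 - m * K : ℕ) : ℝ))) atTop
      (𝓝 u) := by
  have h := ((hα.add (tendsto_const_div_atTop_nhds_zero_nat (i : ℝ))).div
    (tendsto_natCast_div_sq_sub m) one_ne_zero)
  rw [add_zero, div_one] at h
  refine h.congr' ?_
  filter_upwards [eventually_ge_atTop (m + 1)] with K hK
  have hK0 : (0 : ℝ) < K := by exact_mod_cast (by omega : 0 < K)
  have hN : ((K ^ 2 - m * K : ℕ) : ℝ) ≠ 0 := by
    have : m * K < K ^ 2 := by nlinarith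
    exact_mod_cast (by omega : K ^ 2 - m * K ≠ 0)
  simp only [Pi.div_apply]
  push_cast
  field_simp

lemma tendsto_tailFrac_pow (j : ℕ) {α : ℕ → ℕ} {u : ℝ}
    (hα : Tendsto (fun K : ℕ => (α K : ℝ) / K) atTop (𝓝 u)) :
    Tendsto (fun K : ℕ => tailFrac (K ^ 2 - (j + 2) * K) (α K + (1 + j)) ^
      ((K + 1) * j + 2 * K + 1)) atTop (𝓝 (Real.exp (-u) ^ (j + 2))) := by
  set g : ℕ → ℝ := fun K => -(((α K + (1 + j) : ℕ) : ℝ) / ((K ^ 2 - (j + 2) * K : ℕ) : ℝ)) with hg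
  have hKg : Tendsto (fun K : ℕ => (K : ℝ) * g K) atTop (𝓝 (-u)) := by
    simpa only [hg, mul_neg] using (tendsto_div_sq_sub hα (1 + j) (j + 2)).neg
  have hg0 : Tendsto g atTop (𝓝 0) := by
    have := hKg.mul (tendsto_inv_atTop_nhds_zero_nat (𝕜 := ℝ))
    rw [mul_zero] at this
    refine this.congr' ?_
    filter_upwards [eventually_ge_atTop 1] with K hK
    have hK0 : (0 : ℝ) < K := by exact_mod_cast hK
    field_simp
  have h1 := (Real.tendsto_one_add_pow_exp_of_tendsto hKg).pow (j + 2)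
  have h2 := (hg0.const_add 1).pow (j + 1)
  have h3 := h1.mul h2
  rw [add_zero, one_pow, mul_one] at h3
  refine h3.congr' ?_
  filter_upwards [eventually_ge_atTop (j + 3),
    hg0.eventually (lt_mem_nhds (show (-1 : ℝ) < 0 by norm_num))] with K hK hgK
  rw [← pow_mul, ← pow_add]
  have hN : (0 : ℝ) < ((K ^ 2 - (j + 2) * K : ℕ) : ℝ) := by
    have : (j + 2) * K < K ^ 2 := by nlinarith
    exact_mod_cast (by omega : 0 < K ^ 2 - (j + 2) * K)
  have hle : α K + (1 + j) ≤ K ^ 2 - (j + 2) * K := by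
    simp only [hg, neg_lt_neg_iff] at hgK
    rw [div_lt_one hN] at hgK
    exact_mod_cast hgK.le
  congr 1
  · rw [tailFrac, Nat.cast_sub hle, sub_div, div_self hN.ne', hg]
    ring
  · ring

lemma tendsto_pathBound_prefactor (j : ℕ) :
    Tendsto (fun K : ℕ => (K.descFactorial (j + 2) : ℝ) * (K ^ 2 - (j + 1)).factorial *
      ((K ^ 2 - (j + 2) * K : ℕ) : ℝ) ^ (j + 1) /
        ((K + 1) ^ j * ((K + 1) * j + 2 * K + 1)) / ((K ^ 2).factorial * K)) atTop
      (𝓝 (1 / (j + 2))) := by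
  have h1 := tendsto_descFactorial_div_pow (j + 2)
  have h2 := (tendsto_descFactorial_div_pow (j + 1)).comp
    (tendsto_pow_atTop (α := ℕ) (two_ne_zero))
  have h3 := (tendsto_natCast_div_sq_sub (j + 2)).pow (j + 1)
  have h4 := (tendsto_natCast_div_add_atTop (1 : ℝ)).pow j
  have h5 : Tendsto (fun K : ℕ => ((j : ℝ) + 2) + (j + 1) / K) atTop (𝓝 ((j + 2) + 0)) :=
    tendsto_const_nhds.add (tendsto_const_div_atTop_nhds_zero_nat _)
  have h := ((((h1.div h2 one_ne_zero).mul h3).mul h4).div h5 (by positivity))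
  simp only [one_pow, mul_one, add_zero, div_one] at h
  refine h.congr' ?_
  filter_upwards [eventually_ge_atTop (j + 3)] with K hK
  have hK0 : (0 : ℝ) < K := by exact_mod_cast (by omega : 0 < K)
  have hle : j + 1 ≤ K ^ 2 := by nlinarith
  have hfac := Nat.factorial_mul_descFactorial hle
  have hd : ((K ^ 2).descFactorial (j + 1) : ℝ) ≠ 0 := by
    exact_mod_cast (Nat.descFactorial_pos.2 hle).ne'
  have hf : ((K ^ 2 - (j + 1)).factorial : ℝ) ≠ 0 := by positivity
  rw [← hfac]
  simp only [Pi.div_apply, Function.comp_apply, div_pow]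
  push_cast
  field_simp
  ring

lemma tendsto_pathBound (j : ℕ) {α β : ℕ → ℕ} {L L' : ℝ}
    (hα : Tendsto (fun K : ℕ => tailFrac (K ^ 2 - (j + 2) * K) (α K + (1 + j)) ^
      ((K + 1) * j + 2 * K + 1)) atTop (𝓝 L))
    (hβ : Tendsto (fun K : ℕ => tailFrac (K ^ 2 - (j + 2) * K) (β K + (1 + j)) ^
      ((K + 1) * j + 2 * K + 1)) atTop (𝓝 L')) :
    Tendsto (fun K => pathBound j K (α K) (β K)) atTop
      (𝓝 ((L - L') / ((j + 2) * j.factorial))) := by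
  have h := ((tendsto_pathBound_prefactor j).mul (hα.sub hβ)).div_const (j.factorial : ℝ)
  have e : 1 / ((j : ℝ) + 2) * (L - L') / j.factorial = (L - L') / ((j + 2) * j.factorial) := by
    field_simp
  rw [e] at h
  refine h.congr fun K => ?_
  unfold pathBound
  field_simp

lemma hasSum_pow_div (s : ℝ) :
    HasSum (fun j : ℕ => s ^ (j + 2) / ((j + 2) * j.factorial)) (1 - (1 - s) * Real.exp s) := by
  have h0 : HasSum (fun k : ℕ => s ^ k / k.factorial) (Real.exp s) := by
    have := NormedSpace.expSeries_div_hasSum_exp s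
    rwa [← Real.exp_eq_exp_ℝ] at this
  have h1 := (hasSum_nat_add_iff' 1).2 h0
  have h2 := (hasSum_nat_add_iff' 2).2 h0
  have h := (h1.mul_left s).sub h2
  have e1 : 1 - (1 - s) * Real.exp s =
      s * (Real.exp s - ∑ i ∈ Finset.range 1, s ^ i / i.factorial) -
        (Real.exp s - ∑ i ∈ Finset.range 2, s ^ i / i.factorial) := by
    simp [Finset.sum_range_succ]
    ring
  rw [e1]
  refine h.congr_fun fun j => ?_
  rw [Nat.factorial_succ (j + 1), Nat.factorial_succ j]
  push_cast
  field_simp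
  ring

lemma hasSum_one_sub_pow_div (s : ℝ) :
    HasSum (fun j : ℕ => (1 - s ^ (j + 2)) / ((j + 2) * j.factorial)) ((1 - s) * Real.exp s) := by
  have h := (hasSum_pow_div 1).sub (hasSum_pow_div s)
  rw [show (1 - (1 - 1) * Real.exp 1 - (1 - (1 - s) * Real.exp s)) = (1 - s) * Real.exp s by
    ring] at h
  exact h.congr_fun fun j => by rw [one_pow, sub_div]

end Asymptotics

section Limits

open Filter Topology

lemma lt_endProb_of_hasSum {α β : ℕ → ℕ → ℕ} {P : (K : ℕ) → Fin (K ^ 2) → Prop}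
    [∀ K, DecidablePred (P K)] {f : ℕ → ℝ} {L : ℝ} (hf : HasSum f L)
    (hP : ∀ K j (y : Fin (K ^ 2)), α K j ≤ y → y < β K j → P K y)
    (hαβ : ∀ j, ∀ᶠ K in atTop, α K j ≤ β K j ∧ β K j ≤ K ^ 2 - (j + 2) * K)
    (hlim : ∀ j, Tendsto (fun K => pathBound j K (α K j) (β K j)) atTop (𝓝 (f j)))
    {c : ℝ} (hc : c < L) :
    ∀ᶠ K : ℕ in atTop, c < (∑ Ψ : (Fin K × Fin K) ≃ Fin (K ^ 2),
      ((Finset.univ.filter fun p : Fin K × Fin K =>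
        P K (Ψ (BRD (pot Ψ) p (2 * K)))).card : ℝ)) / ((K ^ 2).factorial * K ^ 2) := by
  obtain ⟨J, hJ⟩ := (hf.tendsto_sum_nat.eventually (lt_mem_nhds hc)).exists
  have hsum := tendsto_finsetSum (Finset.range J) fun j _ => hlim j
  filter_upwards [hsum.eventually (lt_mem_nhds hJ), eventually_ge_atTop 1,
    (Finset.eventually_all (Finset.range J)).2 fun j _ => hαβ j] with K hK hK1 hαβK
  refine hK.trans_le ((Finset.sum_le_sum fun j hj =>
    pathBound_le j (hαβK j hj).1 (hαβK j hj).2).trans ?_)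
  have hK0 : (0 : ℝ) < K := by exact_mod_cast hK1
  rw [← Finset.sum_div, Finset.sum_comm, div_le_div_iff₀ (by positivity) (by positivity)]
  have h : (K : ℝ) * ∑ Ψ : (Fin K × Fin K) ≃ Fin (K ^ 2), ∑ j ∈ Finset.range J,
      ((paths Ψ j (α K j) (β K j)).card : ℝ) ≤ ∑ Ψ : (Fin K × Fin K) ≃ Fin (K ^ 2),
      ((Finset.univ.filter fun p : Fin K × Fin K =>
        P K (Ψ (BRD (pot Ψ) p (2 * K)))).card : ℝ) := by
    rw [Finset.mul_sum]
    refine Finset.sum_le_sum fun Ψ _ => ?_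
    exact_mod_cast sum_card_paths_le Ψ J (α K) (β K) (P K) (hP K)
  have := mul_le_mul_of_nonneg_right h (by positivity : 0 ≤ ((K ^ 2).factorial : ℝ) * K)
  linarith

lemma tendsto_floor_mul_div {u : ℝ} (hu : 0 ≤ u) :
    Tendsto (fun K : ℕ => ((⌊u * K⌋₊ : ℕ) : ℝ) / K) atTop (𝓝 u) :=
  (tendsto_nat_floor_mul_div_atTop hu).comp tendsto_natCast_atTop_atTop

lemma eventually_floor_mul_le (u : ℝ) (m : ℕ) :
    ∀ᶠ K : ℕ in atTop, ⌊u * K⌋₊ ≤ K ^ 2 - m * K := by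
  filter_upwards [eventually_ge_atTop (⌈u⌉₊ + m)] with K hK
  have h1 : ⌊u * K⌋₊ ≤ ⌈u⌉₊ * K := by
    refine Nat.floor_le_of_le ?_
    push_cast
    exact mul_le_mul_of_nonneg_right (Nat.le_ceil u) (Nat.cast_nonneg _)
  have h2 : ⌈u⌉₊ * K + m * K ≤ K ^ 2 := by nlinarith
  omega

lemma tendsto_tailFrac_pow_zero (j : ℕ) :
    Tendsto (fun K : ℕ => tailFrac (K ^ 2 - (j + 2) * K) (0 + (1 + j)) ^
      ((K + 1) * j + 2 * K + 1)) atTop (𝓝 1) := by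
  have := tendsto_tailFrac_pow j (α := fun _ => 0) (u := 0) (by simp)
  simpa using this

lemma tendsto_tailFrac_pow_top (j : ℕ) :
    Tendsto (fun K : ℕ => tailFrac (K ^ 2 - (j + 2) * K) (K ^ 2 - (j + 2) * K + (1 + j)) ^
      ((K + 1) * j + 2 * K + 1)) atTop (𝓝 0) := by
  refine tendsto_const_nhds.congr fun K => ?_
  rw [tailFrac_eq_zero (Nat.le_add_right _ _), zero_pow (by omega)]

lemma lt_endProb_below {u c : ℝ} (hu : 0 ≤ u)
    (hc : c < (1 - Real.exp (-u)) * Real.exp (Real.exp (-u))) :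
    ∀ᶠ K : ℕ in atTop, c < (∑ Ψ : (Fin K × Fin K) ≃ Fin (K ^ 2),
      ((Finset.univ.filter fun p : Fin K × Fin K =>
        (Ψ (BRD (pot Ψ) p (2 * K)) : ℕ) < ⌊u * K⌋₊).card : ℝ)) /
          ((K ^ 2).factorial * K ^ 2) :=
  lt_endProb_of_hasSum (α := fun _ _ => 0) (β := fun K _ => ⌊u * K⌋₊)
    (P := fun K y => (y : ℕ) < ⌊u * K⌋₊) (hasSum_one_sub_pow_div _) (fun _ _ _ _ h => h)
    (fun j => (eventually_floor_mul_le u (j + 2)).mono fun _ h => ⟨Nat.zero_le _, h⟩)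
    (fun j => tendsto_pathBound j (tendsto_tailFrac_pow_zero j)
      (tendsto_tailFrac_pow j (tendsto_floor_mul_div hu))) hc

lemma lt_endProb_above {u c : ℝ} (hu : 0 ≤ u)
    (hc : c < 1 - (1 - Real.exp (-u)) * Real.exp (Real.exp (-u))) :
    ∀ᶠ K : ℕ in atTop, c < (∑ Ψ : (Fin K × Fin K) ≃ Fin (K ^ 2),
      ((Finset.univ.filter fun p : Fin K × Fin K =>
        ⌊u * K⌋₊ ≤ (Ψ (BRD (pot Ψ) p (2 * K)) : ℕ)).card : ℝ)) /
          ((K ^ 2).factorial * K ^ 2) :=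
  lt_endProb_of_hasSum (α := fun K _ => ⌊u * K⌋₊) (β := fun K j => K ^ 2 - (j + 2) * K)
    (P := fun K y => ⌊u * K⌋₊ ≤ (y : ℕ)) (hasSum_pow_div _) (fun _ _ _ h _ => h)
    (fun j => (eventually_floor_mul_le u (j + 2)).mono fun _ h => ⟨h, le_rfl⟩)
    (fun j => by
      simpa using tendsto_pathBound j (tendsto_tailFrac_pow j (tendsto_floor_mul_div hu))
        (tendsto_tailFrac_pow_top j)) hc

lemma sum_expTail_pow_le {K : ℕ} (hK : 3 ≤ K) (V : ℕ) :
    ∑ i ∈ Finset.range V, expTail (K ^ 2) i ^ (2 * K - 4) ≤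
      1 + (1 - Real.exp (-(((2 * K - 4 : ℕ) : ℝ) / K ^ 2)) ^ V) *
        (1 + 1 / (((2 * K - 4 : ℕ) : ℝ) / K ^ 2)) := by
  set x : ℝ := ((2 * K - 4 : ℕ) : ℝ) / K ^ 2 with hx
  have hx0 : 0 < x := by
    have h1 : (0 : ℝ) < K := by exact_mod_cast (by omega : 0 < K)
    have h2 : (0 : ℝ) < ((2 * K - 4 : ℕ) : ℝ) := by exact_mod_cast (by omega : 0 < 2 * K - 4)
    positivity
  have hterm : ∀ i, expTail (K ^ 2) i ^ (2 * K - 4) = Real.exp (-x) ^ (i - 1) := by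
    intro i
    rw [expTail, ← Real.exp_nat_mul, ← Real.exp_nat_mul, hx]
    congr 1
    push_cast
    ring
  simp only [hterm]
  have hq : Real.exp (-x) < 1 := by rw [Real.exp_lt_one_iff]; linarith
  have hgeom : ∑ i ∈ Finset.range V, Real.exp (-x) ^ i
      = (1 - Real.exp (-x) ^ V) / (1 - Real.exp (-x)) := by
    rw [geom_sum_eq hq.ne, ← neg_div_neg_eq, neg_sub, neg_sub]
  have hinv : 1 / (1 - Real.exp (-x)) ≤ 1 + 1 / x := by
    have h1 : (1 + x) * Real.exp (-x) ≤ 1 := by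
      calc (1 + x) * Real.exp (-x) ≤ Real.exp x * Real.exp (-x) := by
            gcongr
            linarith [Real.add_one_le_exp x]
        _ = 1 := by rw [← Real.exp_add, add_neg_cancel, Real.exp_zero]
    rw [div_le_iff₀ (by linarith), ← mul_le_mul_iff_of_pos_left hx0]
    have : x * ((1 + 1 / x) * (1 - Real.exp (-x))) = (1 + x) - (1 + x) * Real.exp (-x) := by
      field_simp
      ring
    linarith
  have hqV : 0 ≤ 1 - Real.exp (-x) ^ V := by
    linarith [pow_le_one₀ (n := V) (Real.exp_pos (-x)).le hq.le]
  calc ∑ i ∈ Finset.range V, Real.exp (-x) ^ (i - 1)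
      ≤ ∑ i ∈ Finset.range (V + 1), Real.exp (-x) ^ (i - 1) :=
        Finset.sum_le_sum_of_subset_of_nonneg (Finset.range_mono (Nat.le_succ V))
          fun i _ _ => by positivity
    _ = 1 + (1 - Real.exp (-x) ^ V) * (1 / (1 - Real.exp (-x))) := by
        rw [Finset.sum_range_succ']
        simp only [add_tsub_cancel_right, zero_tsub, pow_zero, hgeom]
        ring
    _ ≤ _ := by gcongr

lemma tendsto_two_mul_sub_div : Tendsto (fun K : ℕ => ((2 * K - 4 : ℕ) : ℝ) / K) atTop (𝓝 2) := by
  have h : Tendsto (fun K : ℕ => 2 - (4 : ℝ) / K) atTop (𝓝 (2 - 0)) :=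
    tendsto_const_nhds.sub (tendsto_const_div_atTop_nhds_zero_nat _)
  rw [sub_zero] at h
  refine h.congr' ?_
  filter_upwards [eventually_ge_atTop 2] with K hK
  have hK0 : (0 : ℝ) < K := by exact_mod_cast (by omega : 0 < K)
  rw [Nat.cast_sub (by omega)]
  push_cast
  field_simp

lemma tendsto_sum_expTail_bound {u : ℝ} (hu : 0 ≤ u) :
    Tendsto (fun K : ℕ => (1 + (1 - Real.exp (-(((2 * K - 4 : ℕ) : ℝ) / K ^ 2)) ^ ⌊u * K⌋₊) *
      (1 + 1 / (((2 * K - 4 : ℕ) : ℝ) / K ^ 2))) / K) atTop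
      (𝓝 ((1 - Real.exp (-u) ^ 2) / 2)) := by
  have h0 := tendsto_inv_atTop_nhds_zero_nat (𝕜 := ℝ)
  have h1 : Tendsto (fun K : ℕ => Real.exp (-(((2 * K - 4 : ℕ) : ℝ) / K ^ 2)) ^ ⌊u * K⌋₊) atTop
      (𝓝 (Real.exp (-u) ^ 2)) := by
    have h := (tendsto_two_mul_sub_div.mul (tendsto_floor_mul_div hu)).neg
    have h := (Real.continuous_exp.tendsto _).comp h
    rw [show -(2 * u) = (2 : ℕ) * -u by push_cast; ring, Real.exp_nat_mul] at h
    refine h.congr fun K => ?_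
    rw [Function.comp_apply, ← Real.exp_nat_mul]
    congr 1
    ring
  have h2 := h0.add (tendsto_two_mul_sub_div.inv₀ two_ne_zero)
  have h3 := h0.add ((h1.const_sub 1).mul h2)
  rw [zero_add, zero_add, ← div_eq_mul_inv] at h3
  refine h3.congr' ?_
  filter_upwards [eventually_ge_atTop 3] with K hK
  have hK0 : (0 : ℝ) < K := by exact_mod_cast (by omega : 0 < K)
  have h4 : (0 : ℝ) < ((2 * K - 4 : ℕ) : ℝ) := by exact_mod_cast (by omega : 0 < 2 * K - 4)
  field_simp

end Limits

section Concentration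

open Filter Topology

lemma sum_card_pneBelow_sub_sq_le {K : ℕ} (hK : 3 ≤ K) {V : ℕ} (hV : V ≤ K ^ 2 - 2 * K) {μ : ℝ}
    (hμ : 0 ≤ μ) :
    (∑ Ψ : (Fin K × Fin K) ≃ Fin (K ^ 2), (((pneBelow Ψ V).card : ℝ) - K * μ) ^ 2) /
      ((K ^ 2).factorial * K ^ 2) ≤
      1 / K + ((∑ i ∈ Finset.range V, expTail (K ^ 2) i ^ (2 * K - 4)) / K) ^ 2
        - 2 * μ * pathBound 0 K 0 V + μ ^ 2 := by
  have hK0 : (0 : ℝ) < K := by exact_mod_cast (by omega : 0 < K)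
  set G := ∑ i ∈ Finset.range V, expTail (K ^ 2) i ^ (2 * K - 4)
  have h1 := sum_card_pneBelow_sq_le (by omega : 2 ≤ K) V
  have h2 : pathBound 0 K 0 V * ((K ^ 2).factorial * K) ≤
      ∑ Ψ : (Fin K × Fin K) ≃ Fin (K ^ 2), ((pneBelow Ψ V).card : ℝ) := by
    rw [← le_div_iff₀ (by positivity)]
    refine (pathBound_le 0 (Nat.zero_le V) (by simpa using hV)).trans ?_
    gcongr with Ψ
    exact card_paths_zero_le Ψ V
  have h3 : ∑ Ψ : (Fin K × Fin K) ≃ Fin (K ^ 2), (((pneBelow Ψ V).card : ℝ) - K * μ) ^ 2 =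
      ∑ Ψ : (Fin K × Fin K) ≃ Fin (K ^ 2), ((pneBelow Ψ V).card : ℝ) ^ 2
        - 2 * (K * μ) * ∑ Ψ : (Fin K × Fin K) ≃ Fin (K ^ 2), ((pneBelow Ψ V).card : ℝ)
        + (K ^ 2).factorial * (K * μ) ^ 2 := by
    rw [Finset.mul_sum, ← Finset.sum_sub_distrib, ← card_potentials,
      ← nsmul_eq_mul _ ((K * μ) ^ 2), ← Finset.card_univ, ← Finset.sum_const,
      ← Finset.sum_add_distrib]
    exact Finset.sum_congr rfl fun Ψ _ => by ring
  have h4 := mul_le_mul_of_nonneg_left h2 (by positivity : 0 ≤ 2 * (K * μ))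
  rw [h3, div_le_iff₀ (by positivity)]
  have h5 : (1 / K + (G / K) ^ 2 - 2 * μ * pathBound 0 K 0 V + μ ^ 2) *
      ((K ^ 2).factorial * K ^ 2) = (K ^ 2).factorial * (K + G ^ 2) -
      2 * (K * μ) * (pathBound 0 K 0 V * ((K ^ 2).factorial * K)) +
      (K ^ 2).factorial * (K * μ) ^ 2 := by
    field_simp
  linarith

/-- The number of equilibria with value below `uK` is concentrated around
`K * (1 - exp (-2 * u)) / 2`. -/
lemma card_deviation_lt {u δ c : ℝ} (hu : 0 ≤ u) (hδ : 0 < δ) (hc : 0 < c) :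
    ∀ᶠ K : ℕ in atTop, ((Finset.univ.filter fun Ψ : (Fin K × Fin K) ≃ Fin (K ^ 2) =>
      δ * K ≤ |((pneBelow Ψ ⌊u * K⌋₊).card : ℝ) - K * ((1 - Real.exp (-u) ^ 2) / 2)|).card : ℝ) /
        (K ^ 2).factorial < c := by
  set μ := (1 - Real.exp (-u) ^ 2) / 2 with hμ
  have hμ0 : 0 ≤ μ := by
    have := pow_le_one₀ (n := 2) (Real.exp_pos (-u)).le (Real.exp_le_one_iff.2 (by linarith))
    rw [hμ]
    linarith
  have hlow : Tendsto (fun K : ℕ => pathBound 0 K 0 ⌊u * K⌋₊) atTop (𝓝 μ) := by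
    have := tendsto_pathBound 0 (tendsto_tailFrac_pow_zero 0)
      (tendsto_tailFrac_pow 0 (tendsto_floor_mul_div hu))
    convert this using 2
    simp [hμ]
  have hlim := (((tendsto_const_div_atTop_nhds_zero_nat (1 : ℝ)).add
    ((tendsto_sum_expTail_bound hu).pow 2)).sub (hlow.const_mul (2 * μ))).add_const (μ ^ 2)
  rw [show 0 + μ ^ 2 - 2 * μ * μ + μ ^ 2 = 0 by ring] at hlim
  filter_upwards [hlim.eventually (gt_mem_nhds (by positivity : 0 < c * δ ^ 2)),
    eventually_ge_atTop 3, eventually_floor_mul_le u 2] with K hK hK3 hV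
  have hK0 : (0 : ℝ) < K := by exact_mod_cast (by omega : 0 < K)
  have h1 := sum_card_pneBelow_sub_sq_le hK3 hV hμ0
  have h2 : ((∑ i ∈ Finset.range ⌊u * K⌋₊, expTail (K ^ 2) i ^ (2 * K - 4)) / K) ^ 2 ≤ _ :=
    pow_le_pow_left₀ (div_nonneg (Finset.sum_nonneg fun i _ => pow_nonneg (expTail_nonneg _ _) _)
      hK0.le) (div_le_div_of_nonneg_right (sum_expTail_pow_le hK3 ⌊u * K⌋₊) hK0.le) 2
  have h3 : (((Finset.univ.filter fun Ψ : (Fin K × Fin K) ≃ Fin (K ^ 2) =>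
      δ * K ≤ |((pneBelow Ψ ⌊u * K⌋₊).card : ℝ) - K * μ|).card : ℝ)) * (δ * K) ^ 2 ≤
      ∑ Ψ : (Fin K × Fin K) ≃ Fin (K ^ 2), (((pneBelow Ψ ⌊u * K⌋₊).card : ℝ) - K * μ) ^ 2 := by
    rw [← nsmul_eq_mul, ← Finset.sum_const]
    refine (Finset.sum_le_sum fun Ψ hΨ => ?_).trans
      (Finset.sum_le_sum_of_subset_of_nonneg (Finset.subset_univ _) fun _ _ _ => sq_nonneg _)
    rw [← sq_abs (_ - _)]
    exact pow_le_pow_left₀ (by positivity) (Finset.mem_filter.1 hΨ).2 2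
  have h4 := (h1.trans (by linarith)).trans_lt hK
  rw [div_lt_iff₀ (by positivity)] at h4 ⊢
  have h5 := h3.trans_lt h4
  have h6 : c * δ ^ 2 * ((K ^ 2).factorial * K ^ 2) = c * (K ^ 2).factorial * (δ * K) ^ 2 := by ring
  rw [h6] at h5
  exact lt_of_mul_lt_mul_right h5 (by positivity)

lemma rankPNE_le {K V : ℕ} {Ψ : (Fin K × Fin K) ≃ Fin (K ^ 2)} {η : Fin K × Fin K}
    (h : (Ψ η : ℕ) < V) : rankPNE Ψ η ≤ (pneBelow Ψ V).card :=
  Finset.card_le_card fun _ hp => Finset.mem_filter.2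
    ⟨(Finset.mem_filter.1 hp).1, (Fin.le_def.1 (Finset.mem_filter.1 hp).2).trans_lt h⟩

lemma le_rankPNE {K V : ℕ} {Ψ : (Fin K × Fin K) ≃ Fin (K ^ 2)} {η : Fin K × Fin K}
    (h : V ≤ (Ψ η : ℕ)) : (pneBelow Ψ V).card ≤ rankPNE Ψ η :=
  Finset.card_le_card fun _ hp => Finset.mem_filter.2
    ⟨(Finset.mem_filter.1 hp).1, Fin.le_def.2 ((Finset.mem_filter.1 hp).2.le.trans h)⟩

lemma sum_card_filter_le {K : ℕ} {P Q : (Fin K × Fin K) ≃ Fin (K ^ 2) → Fin K × Fin K → Prop}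
    {B : (Fin K × Fin K) ≃ Fin (K ^ 2) → Prop} (h : ∀ Ψ p, P Ψ p → ¬ B Ψ → Q Ψ p)
    [∀ Ψ, DecidablePred (P Ψ)] [∀ Ψ, DecidablePred (Q Ψ)] [DecidablePred B] (hK : 0 < K) :
    (∑ Ψ, ((Finset.univ.filter (P Ψ)).card : ℝ)) / ((K ^ 2).factorial * K ^ 2) ≤
      (∑ Ψ, ((Finset.univ.filter (Q Ψ)).card : ℝ)) / ((K ^ 2).factorial * K ^ 2) +
        ((Finset.univ.filter B).card : ℝ) / (K ^ 2).factorial := by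
  have hK0 : (0 : ℝ) < K := by exact_mod_cast hK
  have hcard : Fintype.card (Fin K × Fin K) = K ^ 2 := by simp [sq]
  rw [← mul_div_mul_right ((Finset.univ.filter B).card : ℝ) _ (pow_pos hK0 2).ne', ← add_div]
  refine div_le_div_of_nonneg_right ?_ (by positivity)
  rw [Finset.card_filter B, Nat.cast_sum, Finset.sum_mul, ← Finset.sum_add_distrib]
  refine Finset.sum_le_sum fun Ψ _ => ?_
  by_cases hB : B Ψ
  · have := Finset.card_le_univ (Finset.univ.filter (P Ψ))
    rw [hcard] at this
    have : ((Finset.univ.filter (P Ψ)).card : ℝ) ≤ (K : ℝ) ^ 2 := by exact_mod_cast this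
    rw [if_pos hB, Nat.cast_one, one_mul]
    exact this.trans (le_add_of_nonneg_left (Nat.cast_nonneg _))
  · rw [if_neg hB, Nat.cast_zero, zero_mul, add_zero]
    refine Nat.cast_le.2 (Finset.card_le_card fun p hp => ?_)
    simp only [Finset.mem_filter, Finset.mem_univ, true_and] at hp ⊢
    exact h Ψ p hp hB

lemma lt_prob_rank_le {ε u c : ℝ} (hu : 0 ≤ u) (hε : (1 - Real.exp (-u) ^ 2) / 2 < ε)
    (hc : c < (1 - Real.exp (-u)) * Real.exp (Real.exp (-u))) :
    ∀ᶠ K : ℕ in atTop, c < (∑ Ψ : (Fin K × Fin K) ≃ Fin (K ^ 2),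
      ((Finset.univ.filter fun p : Fin K × Fin K =>
        (rankPNE Ψ (BRD (pot Ψ) p (2 * K)) : ℝ) ≤ ε * K).card : ℝ)) /
          ((K ^ 2).factorial * K ^ 2) := by
  obtain ⟨c', hc1, hc2⟩ := exists_between hc
  filter_upwards [lt_endProb_below hu hc2, card_deviation_lt hu (sub_pos.2 hε) (sub_pos.2 hc1),
    eventually_ge_atTop 1] with K h1 h2 hK
  have h3 := sum_card_filter_le (K := K)
    (P := fun Ψ p => (Ψ (BRD (pot Ψ) p (2 * K)) : ℕ) < ⌊u * K⌋₊)
    (Q := fun Ψ p => (rankPNE Ψ (BRD (pot Ψ) p (2 * K)) : ℝ) ≤ ε * K)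
    (B := fun Ψ => (ε - (1 - Real.exp (-u) ^ 2) / 2) * K ≤
      |((pneBelow Ψ ⌊u * K⌋₊).card : ℝ) - K * ((1 - Real.exp (-u) ^ 2) / 2)|)
    (fun Ψ p hp hB => by
      refine (Nat.cast_le.2 (rankPNE_le hp)).trans ?_
      have := (le_abs_self _).trans_lt (not_le.1 hB)
      linarith) hK
  linarith

lemma lt_prob_lt_rank {ε u c : ℝ} (hu : 0 ≤ u) (hε : ε < (1 - Real.exp (-u) ^ 2) / 2)
    (hc : c < 1 - (1 - Real.exp (-u)) * Real.exp (Real.exp (-u))) :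
    ∀ᶠ K : ℕ in atTop, c < (∑ Ψ : (Fin K × Fin K) ≃ Fin (K ^ 2),
      ((Finset.univ.filter fun p : Fin K × Fin K =>
        ¬ (rankPNE Ψ (BRD (pot Ψ) p (2 * K)) : ℝ) ≤ ε * K).card : ℝ)) /
          ((K ^ 2).factorial * K ^ 2) := by
  obtain ⟨c', hc1, hc2⟩ := exists_between hc
  filter_upwards [lt_endProb_above hu hc2, card_deviation_lt hu (sub_pos.2 hε) (sub_pos.2 hc1),
    eventually_ge_atTop 1] with K h1 h2 hK
  have h3 := sum_card_filter_le (K := K)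
    (P := fun Ψ p => ⌊u * K⌋₊ ≤ (Ψ (BRD (pot Ψ) p (2 * K)) : ℕ))
    (Q := fun Ψ p => ¬ (rankPNE Ψ (BRD (pot Ψ) p (2 * K)) : ℝ) ≤ ε * K)
    (B := fun Ψ => ((1 - Real.exp (-u) ^ 2) / 2 - ε) * K ≤
      |((pneBelow Ψ ⌊u * K⌋₊).card : ℝ) - K * ((1 - Real.exp (-u) ^ 2) / 2)|)
    (fun Ψ p hp hB => by
      have h4 : ((pneBelow Ψ ⌊u * K⌋₊).card : ℝ) ≤ _ := Nat.cast_le.2 (le_rankPNE hp)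
      have := (neg_abs_le _).trans_lt' (neg_lt_neg (not_le.1 hB))
      rw [not_le]
      linarith) hK
  linarith

lemma prob_rank_le_add {K : ℕ} (hK : 0 < K) (ε : ℝ) :
    (∑ Ψ : (Fin K × Fin K) ≃ Fin (K ^ 2), ((Finset.univ.filter fun p : Fin K × Fin K =>
        (rankPNE Ψ (BRD (pot Ψ) p (2 * K)) : ℝ) ≤ ε * K).card : ℝ)) /
          ((K ^ 2).factorial * K ^ 2) +
      (∑ Ψ : (Fin K × Fin K) ≃ Fin (K ^ 2), ((Finset.univ.filter fun p : Fin K × Fin K =>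
        ¬ (rankPNE Ψ (BRD (pot Ψ) p (2 * K)) : ℝ) ≤ ε * K).card : ℝ)) /
          ((K ^ 2).factorial * K ^ 2) = 1 := by
  have hK0 : (0 : ℝ) < K := by exact_mod_cast hK
  rw [← add_div, ← Finset.sum_add_distrib, div_eq_one_iff_eq (by positivity), ← card_potentials,
    ← Finset.card_univ, ← nsmul_eq_mul, ← Finset.sum_const]
  refine Finset.sum_congr rfl fun Ψ _ => ?_
  rw [← Nat.cast_add, Finset.card_filter_add_card_filter_not, Finset.card_univ]
  simp [sq]

lemma continuous_limit : Continuous fun s : ℝ => (1 - s) * Real.exp s := by fun_prop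

end Concentration

/-- For a uniformly random potential and a uniformly random (independent) starting
profile, the probability that the best-response dynamics is absorbed at one of the
`⌊εK⌋`-best equilibria converges: `P(Λ(BRD(2K)) ≤ εK) → (1-√(1-2ε))·exp(√(1-2ε))`. -/
theorem stmt7 (ε : ℝ) (hε1 : 0 ≤ ε) (hε2 : ε < 1 / 2) :
    Filter.Tendsto (fun K : ℕ =>
        (∑ Ψ : (Fin K × Fin K) ≃ Fin (K ^ 2),
            ((Finset.univ.filter fun p : Fin K × Fin K =>
                (rankPNE Ψ (BRD (pot Ψ) p (2 * K)) : ℝ) ≤ ε * K).card : ℝ)) /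
          ((Fintype.card ((Fin K × Fin K) ≃ Fin (K ^ 2)) : ℝ) * K ^ 2))
      Filter.atTop
      (nhds ((1 - Real.sqrt (1 - 2 * ε)) * Real.exp (Real.sqrt (1 - 2 * ε)))) := by
  simp only [card_potentials]
  set t := Real.sqrt (1 - 2 * ε) with ht
  have ht0 : 0 < t := Real.sqrt_pos.2 (by linarith)
  have htsq : t ^ 2 = 1 - 2 * ε := Real.sq_sqrt (by linarith)
  have ht1 : t ≤ 1 := by nlinarith
  have hcont := continuous_limit.tendsto t
  refine tendsto_order.2 ⟨fun c hc => ?_, fun c hc => ?_⟩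
  · rcases ht1.lt_or_eq with ht1 | ht1
    · obtain ⟨s, hs, hst, hs1⟩ := (((hcont.eventually (lt_mem_nhds hc)).filter_mono
        nhdsWithin_le_nhds).and (Ioo_mem_nhdsGT ht1)).exists
      have hs0 : 0 < s := ht0.trans hst
      have hexp : Real.exp (- -Real.log s) = s := by rw [neg_neg, Real.exp_log hs0]
      refine lt_prob_rank_le (u := -Real.log s)
        (neg_nonneg.2 (Real.log_nonpos hs0.le hs1.le)) ?_ ?_
      · rw [hexp]
        nlinarith
      · rwa [hexp]
    · rw [ht1] at hc
      refine Filter.Eventually.of_forall fun K => lt_of_lt_of_le (by simpa using hc) ?_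
      exact div_nonneg (Finset.sum_nonneg fun _ _ => Nat.cast_nonneg _) (by positivity)
  · obtain ⟨s, hs, hs0, hst⟩ := (((hcont.eventually (gt_mem_nhds hc)).filter_mono
      nhdsWithin_le_nhds).and (Ioo_mem_nhdsLT ht0)).exists
    have hexp : Real.exp (- -Real.log s) = s := by rw [neg_neg, Real.exp_log hs0]
    have h := lt_prob_lt_rank (u := -Real.log s) (ε := ε) (c := 1 - c)
      (neg_nonneg.2 (Real.log_nonpos hs0.le (hst.le.trans ht1)))
      (by rw [hexp]; nlinarith) (by rw [hexp]; linarith)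
    filter_upwards [h, Filter.eventually_ge_atTop 1] with K hK hK1
    have := prob_rank_le_add hK1 ε
    linarith
end
end

section
/- Let Ψ_K be a uniformly random bijection from [K]×[K] to {1,…,K²} and let the starting profile BRD(0) be chosen uniformly at random on [K]×[K], independently of Ψ_K. Let Λ(BRD(2K)) be the rank (by increasing potential value) of the pure Nash equilibrium reached by the best-response dynamics. Then lim_{K→∞} E[ Λ(BRD(2K)) / K ] = e − 5/2. -/
open scoped Classical

noncomputable section

/-- `c` is a minimizer of `f` over the finite set `S`. -/
def IsArgminOn {α β : Type*} [LE β] (f : α → β) (S : Finset α) (c : α) : Prop :=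
  c ∈ S ∧ ∀ d ∈ S, f c ≤ f d

lemma isArgminOn_swap_iff {α β : Type*} [DecidableEq α] [LE β] (f : α ≃ β) {S : Finset α}
    {c d e : α} (hc : c ∈ S) (hd : d ∈ S) :
    IsArgminOn ((Equiv.swap c d).trans f) S e ↔ IsArgminOn f S (Equiv.swap c d e) := by
  have key : ∀ x, Equiv.swap c d x ∈ S ↔ x ∈ S := by
    intro x
    rw [Equiv.swap_apply_def]
    split_ifs with h1 h2 <;> simp [*]
  unfold IsArgminOn
  rw [key]
  refine and_congr_right fun _ => ⟨fun h x hx => ?_, fun h x hx => h _ ((key x).2 hx)⟩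
  have := h (Equiv.swap c d x) ((key x).2 hx)
  simpa using this

/-- If a property of bijections is unaffected by exchanging `c` with elements of `S`, then
it is independent of the event that `c` is the minimizer over `S`. -/
lemma card_filter_isArgminOn_mul {α β : Type*} [Fintype α] [DecidableEq α] [Fintype β]
    [LinearOrder β] {S : Finset α} {c : α} (hc : c ∈ S) (P : (α ≃ β) → Prop)
    (hP : ∀ d ∈ S, ∀ f, P f → P ((Equiv.swap c d).trans f)) :
    (Finset.univ.filter fun f : α ≃ β => IsArgminOn f S c ∧ P f).card * S.card =
      (Finset.univ.filter fun f : α ≃ β => P f).card := by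
  have hfib : (Finset.univ.filter fun f : α ≃ β => P f) =
      S.biUnion fun d => Finset.univ.filter fun f : α ≃ β => IsArgminOn f S d ∧ P f := by
    ext f
    simp only [Finset.mem_filter, Finset.mem_univ, true_and, Finset.mem_biUnion]
    constructor
    · intro h
      obtain ⟨d, hd, hmin⟩ := S.exists_min_image f ⟨c, hc⟩
      exact ⟨d, hd, ⟨hd, hmin⟩, h⟩
    · rintro ⟨d, -, -, h⟩
      exact h
  have hdisj : ∀ d ∈ S, ∀ e ∈ S, d ≠ e → Disjoint
      (Finset.univ.filter fun f : α ≃ β => IsArgminOn f S d ∧ P f)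
      (Finset.univ.filter fun f : α ≃ β => IsArgminOn f S e ∧ P f) := by
    intro d hd e he hde
    rw [Finset.disjoint_left]
    intro f hf hf'
    simp only [Finset.mem_filter, Finset.mem_univ, true_and] at hf hf'
    exact hde (f.injective (le_antisymm (hf.1.2 e he) (hf'.1.2 d hd)))
  rw [hfib, Finset.card_biUnion hdisj, Finset.sum_const_nat (m := _), mul_comm]
  intro d hd
  refine Finset.card_bij' (fun f _ => (Equiv.swap c d).trans f)
    (fun f _ => (Equiv.swap c d).trans f) ?_ ?_ ?_ ?_
  · intro f hf
    simp only [Finset.mem_filter, Finset.mem_univ, true_and] at hf ⊢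
    rw [isArgminOn_swap_iff f hc hd]
    simpa using ⟨hf.1, hP d hd f hf.2⟩
  · intro f hf
    simp only [Finset.mem_filter, Finset.mem_univ, true_and] at hf ⊢
    rw [isArgminOn_swap_iff f hc hd]
    simpa using ⟨hf.1, hP d hd f hf.2⟩
  · intro f _
    ext x
    simp
  · intro f _
    ext x
    simp

/-- For an increasing chain of finite sets with marked points, each lying outside the earlier
sets, the events that the marked points are the minimizers are independent. -/
lemma card_filter_chain_mul {α β : Type*} [Fintype α] [DecidableEq α] [Fintype β]
    [LinearOrder β] (l : List (Finset α × α)) (hmem : ∀ x ∈ l, x.2 ∈ x.1)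
    (hl : l.Pairwise fun x y => x.1 ⊆ y.1 ∧ y.2 ∉ x.1) :
    (Finset.univ.filter fun f : α ≃ β => ∀ x ∈ l, IsArgminOn f x.1 x.2).card *
      (l.map fun x => x.1.card).prod = Fintype.card (α ≃ β) := by
  induction l with
  | nil => simp [Finset.card_univ]
  | cons a l ih =>
    rw [List.pairwise_cons] at hl
    rw [← ih (fun x hx => hmem x (List.mem_cons_of_mem _ hx)) hl.2]
    simp only [List.map_cons, List.prod_cons, List.forall_mem_cons]
    rw [← mul_assoc]
    congr 1
    convert card_filter_isArgminOn_mul (hmem a List.mem_cons_self)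
      (fun f : α ≃ β => ∀ x ∈ l, IsArgminOn f x.1 x.2) ?_
    intro d hd f hf x hx
    obtain ⟨hsub, hnot⟩ := hl.1 x hx
    have ha := hmem a List.mem_cons_self
    have hne : ∀ e ∈ a.1, x.2 ≠ e := fun e he h => hnot (h ▸ he)
    rw [isArgminOn_swap_iff f (hsub ha) (hsub hd),
      Equiv.swap_apply_of_ne_of_ne (hne _ ha) (hne _ hd)]
    exact hf x hx

/-- `p` lies on the line with index `v` in direction `j`: column `v` for even `j`,
row `v` for odd `j`. -/
def OnLine {K : ℕ} (j : ℕ) (v : Fin K) (p : Fin K × Fin K) : Prop :=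
  if Even j then p.2 = v else p.1 = v

/-- The intersection of the consecutive (perpendicular) lines `z j` and `z (j + 1)`. -/
def lineCell {K : ℕ} (z : ℕ → Fin K) (j : ℕ) : Fin K × Fin K :=
  if Even j then (z (j + 1), z j) else (z j, z (j + 1))

/-- The union of the first `m` lines of the sequence `z`. -/
def lineUnion {K : ℕ} (z : ℕ → Fin K) (m : ℕ) : Finset (Fin K × Fin K) :=
  Finset.univ.filter fun p => ∃ i < m, OnLine i (z i) p

/-- The first `m` lines of the sequence `z` are pairwise distinct. -/
def DistinctLines {K : ℕ} (m : ℕ) (z : ℕ → Fin K) : Prop :=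
  ∀ i < m, ∀ j < m, i % 2 = j % 2 → z i = z j → i = j

lemma mem_lineUnion {K : ℕ} {z : ℕ → Fin K} {m : ℕ} {p : Fin K × Fin K} :
    p ∈ lineUnion z m ↔ ∃ i < m, OnLine i (z i) p := by
  simp [lineUnion]

lemma lineUnion_subset {K : ℕ} (z : ℕ → Fin K) {m n : ℕ} (h : m ≤ n) :
    lineUnion z m ⊆ lineUnion z n := by
  intro p
  rw [mem_lineUnion, mem_lineUnion]
  rintro ⟨i, hi, hp⟩
  exact ⟨i, hi.trans_le h, hp⟩

lemma onLine_lineCell {K : ℕ} (z : ℕ → Fin K) (j : ℕ) : OnLine j (z j) (lineCell z j) := by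
  unfold OnLine lineCell
  split_ifs <;> rfl

lemma onLine_succ_lineCell {K : ℕ} (z : ℕ → Fin K) (j : ℕ) :
    OnLine (j + 1) (z (j + 1)) (lineCell z j) := by
  unfold OnLine lineCell
  by_cases h : Even j <;> simp [h, Nat.even_add_one]

lemma eq_of_onLine {K : ℕ} {i j : ℕ} (h : i % 2 = j % 2) {u v : Fin K} {p : Fin K × Fin K}
    (hu : OnLine i u p) (hv : OnLine j v p) : u = v := by
  have : Even i ↔ Even j := by rw [Nat.even_iff, Nat.even_iff, h]
  unfold OnLine at hu hv
  by_cases hj : Even j <;> simp_all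

lemma onLine_congr {K : ℕ} {i j : ℕ} (h : i % 2 = j % 2) {u : Fin K} {p : Fin K × Fin K} :
    OnLine i u p ↔ OnLine j u p := by
  have : Even i ↔ Even j := by rw [Nat.even_iff, Nat.even_iff, h]
  unfold OnLine
  simp [this]

lemma lineCell_eq_iff {K : ℕ} (z : ℕ → Fin K) (j : ℕ) (p : Fin K × Fin K) :
    lineCell z j = p ↔ OnLine j (z j) p ∧ OnLine (j + 1) (z (j + 1)) p := by
  unfold OnLine lineCell
  by_cases h : Even j <;> simp [h, Nat.even_add_one, Prod.ext_iff, eq_comm, and_comm]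

lemma lineCell_notMem_lineUnion {K : ℕ} {z : ℕ → Fin K} {n m j : ℕ} (hz : DistinctLines n z)
    (hj : j + 1 < n) (hm : m ≤ j) : lineCell z j ∉ lineUnion z m := by
  rw [mem_lineUnion]
  rintro ⟨i, hi, hp⟩
  rcases Nat.mod_two_eq_zero_or_one (i + j) with h | h
  · have hij : i % 2 = j % 2 := by omega
    have := hz i (by omega) j (by omega) hij (eq_of_onLine hij hp (onLine_lineCell z j))
    omega
  · have hij : i % 2 = (j + 1) % 2 := by omega
    have := hz i (by omega) (j + 1) (by omega) hij
      (eq_of_onLine hij hp (onLine_succ_lineCell z j))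
    omega

/-- The number of cells covered by `j` distinct alternating lines. -/
def coveredCells (K j : ℕ) : ℕ := K ^ 2 - (K - (j + 1) / 2) * (K - j / 2)

lemma card_lineUnion {K : ℕ} {z : ℕ → Fin K} {n m : ℕ} (hz : DistinctLines n z) (hm : m ≤ n) :
    (lineUnion z m).card = coveredCells K m := by
  set C := (Finset.range ((m + 1) / 2)).image fun i => z (2 * i) with hC
  set R := (Finset.range (m / 2)).image fun i => z (2 * i + 1) with hR
  have hCc : C.card = (m + 1) / 2 := by
    rw [hC, Finset.card_image_of_injOn, Finset.card_range]
    intro i hi j hj hij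
    simp only [Finset.coe_range, Set.mem_Iio] at hi hj
    have := hz (2 * i) (by omega) (2 * j) (by omega) (by omega) hij
    omega
  have hRc : R.card = m / 2 := by
    rw [hR, Finset.card_image_of_injOn, Finset.card_range]
    intro i hi j hj hij
    simp only [Finset.coe_range, Set.mem_Iio] at hi hj
    have := hz (2 * i + 1) (by omega) (2 * j + 1) (by omega) (by omega) hij
    omega
  have hU : lineUnion z m = (Rᶜ ×ˢ Cᶜ)ᶜ := by
    ext p
    simp only [mem_lineUnion, Finset.mem_compl, Finset.mem_product, hC, hR, Finset.mem_image,
      Finset.mem_range, OnLine]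
    constructor
    · rintro ⟨i, hi, hp⟩ ⟨h1, h2⟩
      split_ifs at hp with h
      · obtain ⟨k, rfl⟩ := h
        exact h2 ⟨k, by omega, by rw [hp, two_mul]⟩
      · obtain ⟨k, rfl⟩ := Nat.not_even_iff_odd.mp h
        exact h1 ⟨k, by omega, hp.symm⟩
    · intro h
      by_cases h1 : ∃ a < m / 2, z (2 * a + 1) = p.1
      · obtain ⟨a, ha, hp⟩ := h1
        exact ⟨2 * a + 1, by omega, by simp [hp]⟩
      · by_cases h2 : ∃ a < (m + 1) / 2, z (2 * a) = p.2
        · obtain ⟨a, ha, hp⟩ := h2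
          exact ⟨2 * a, by omega, by simp [hp]⟩
        · exact absurd ⟨h1, h2⟩ h
  rw [hU, Finset.card_compl, Finset.card_product, Finset.card_compl, Finset.card_compl, hCc, hRc]
  simp [coveredCells, sq, mul_comm]

/-- Extension of a finite sequence by an arbitrary value. -/
def extendSeq {K m : ℕ} [NeZero K] (z : Fin m → Fin K) (j : ℕ) : Fin K :=
  if h : j < m then z ⟨j, h⟩ else 0

/-- Sequences of `m` distinct alternating lines. -/
def lineSeqs (K m : ℕ) [NeZero K] : Finset (Fin m → Fin K) :=
  Finset.univ.filter fun z => DistinctLines m (extendSeq z)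

lemma extendSeq_of_lt {K m : ℕ} [NeZero K] (z : Fin m → Fin K) {j : ℕ} (h : j < m) :
    extendSeq z j = z ⟨j, h⟩ := dif_pos h

/-- A sequence of distinct alternating lines amounts to a sequence of distinct columns and a
sequence of distinct rows. -/
def lineSeqsEquiv (K m : ℕ) [NeZero K] :
    {z : Fin m → Fin K // DistinctLines m (extendSeq z)} ≃
      (Fin ((m + 1) / 2) ↪ Fin K) × (Fin (m / 2) ↪ Fin K) where
  toFun z :=
    (⟨fun i => z.1 ⟨2 * i, by omega⟩, fun i j h => by
        have := z.2 (2 * i) (by omega) (2 * j) (by omega) (by omega)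
          (by simpa only [extendSeq_of_lt _ (show 2 * (i : ℕ) < m by omega),
            extendSeq_of_lt _ (show 2 * (j : ℕ) < m by omega)] using h)
        omega⟩,
      ⟨fun i => z.1 ⟨2 * i + 1, by omega⟩, fun i j h => by
        have := z.2 (2 * i + 1) (by omega) (2 * j + 1) (by omega) (by omega)
          (by simpa only [extendSeq_of_lt _ (show 2 * (i : ℕ) + 1 < m by omega),
            extendSeq_of_lt _ (show 2 * (j : ℕ) + 1 < m by omega)] using h)
        omega⟩)
  invFun w :=
    ⟨fun j => if h : (j : ℕ) % 2 = 0 then w.1 ⟨j / 2, by omega⟩ else w.2 ⟨j / 2, by omega⟩, by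
      intro i hi j hj hij h
      rw [extendSeq_of_lt _ hi, extendSeq_of_lt _ hj] at h
      by_cases h0 : i % 2 = 0
      · have h1 : j % 2 = 0 := by omega
        simp only [h0, h1, dif_pos] at h
        have := congrArg Fin.val (w.1.injective h)
        simp only at this
        omega
      · have h1 : ¬ j % 2 = 0 := by omega
        simp only [h0, h1, dif_neg, not_false_eq_true] at h
        have := congrArg Fin.val (w.2.injective h)
        simp only at this
        omega⟩
  left_inv z := by
    ext j
    by_cases h0 : (j : ℕ) % 2 = 0
    · simp only [h0, dif_pos]
      exact congrArg (fun i => (z.1 i : ℕ)) (Fin.ext (by simp only; omega))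
    · simp only [h0, dif_neg, not_false_eq_true]
      exact congrArg (fun i => (z.1 i : ℕ)) (Fin.ext (by simp only; omega))
  right_inv w := by
    ext i
    · simp
    · have h1 : (2 * (i : ℕ) + 1) / 2 = i := by omega
      simp [h1]

lemma card_lineSeqs (K m : ℕ) [NeZero K] :
    (lineSeqs K m).card = K.descFactorial ((m + 1) / 2) * K.descFactorial (m / 2) := by
  rw [lineSeqs, ← Fintype.card_subtype, Fintype.card_congr (lineSeqsEquiv K m),
    Fintype.card_prod, Fintype.card_embedding_eq, Fintype.card_embedding_eq]
  simp

/-- The event that the dynamics follows the lines of `z`, is absorbed in the cell `lineCell z k`,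
and that the cell `lineCell z (k + 2)` is a pure Nash equilibrium of smaller potential. -/
def PathEvent {K : ℕ} (Ψ : (Fin K × Fin K) ≃ Fin (K ^ 2)) (k : ℕ) (z : ℕ → Fin K) : Prop :=
  (∀ j < k, IsArgminOn Ψ (lineUnion z (j + 1)) (lineCell z j)) ∧
    IsArgminOn Ψ (lineUnion z (k + 2)) (lineCell z k) ∧
    IsArgminOn Ψ (lineUnion z (k + 4)) (lineCell z (k + 2))

lemma lineCell_mem_lineUnion {K : ℕ} (z : ℕ → Fin K) {j m : ℕ} (h : j < m) :
    lineCell z j ∈ lineUnion z m :=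
  mem_lineUnion.2 ⟨j, h, onLine_lineCell z j⟩

lemma card_pathEvent_mul {K k : ℕ} {z : ℕ → Fin K} (hz : DistinctLines (k + 4) z) :
    (Finset.univ.filter fun Ψ : (Fin K × Fin K) ≃ Fin (K ^ 2) => PathEvent Ψ k z).card *
      ((∏ j ∈ Finset.range k, coveredCells K (j + 1)) *
        (coveredCells K (k + 2) * coveredCells K (k + 4))) =
      Fintype.card ((Fin K × Fin K) ≃ Fin (K ^ 2)) := by
  have h := card_filter_chain_mul (β := Fin (K ^ 2))
    ((List.range k).map (fun j => (lineUnion z (j + 1), lineCell z j)) ++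
      [(lineUnion z (k + 2), lineCell z k), (lineUnion z (k + 4), lineCell z (k + 2))]) ?_ ?_
  · convert h using 2
    · congr 1
      ext Ψ
      simp only [Finset.mem_filter, Finset.mem_univ, true_and]
      simp [PathEvent, or_imp, forall_and]
    · rw [List.map_append, List.prod_append, List.map_map]
      congr 1
      · rw [Finset.prod_range, ← List.prod_ofFn, List.ofFn_eq_map, ← List.map_coe_finRange_eq_range,
          List.map_map]
        congr 1
        apply List.map_congr_left
        intro j _
        exact (card_lineUnion hz (by omega)).symm
      · simp [card_lineUnion hz]
  · intro x hx
    simp only [List.mem_append, List.mem_map, List.mem_range, List.mem_cons, List.not_mem_nil,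
      or_false] at hx
    rcases hx with ⟨j, -, rfl⟩ | rfl | rfl <;> exact lineCell_mem_lineUnion z (by omega)
  · rw [List.pairwise_append, List.pairwise_map]
    refine ⟨?_, ?_, ?_⟩
    · refine List.pairwise_lt_range.imp_of_mem ?_
      intro i j _ hj hij
      rw [List.mem_range] at hj
      exact ⟨lineUnion_subset z (by omega), lineCell_notMem_lineUnion hz (by omega) (by omega)⟩
    · simpa using ⟨lineUnion_subset z (by omega),
        lineCell_notMem_lineUnion hz (by omega) (by omega)⟩
    · intro x hx y hy
      simp only [List.mem_map, List.mem_range, List.mem_cons, List.not_mem_nil, or_false] at hx hy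
      obtain ⟨j, hj, rfl⟩ := hx
      rcases hy with rfl | rfl <;>
        exact ⟨lineUnion_subset z (by omega), lineCell_notMem_lineUnion hz (by omega) (by omega)⟩

/-- The sequence of lines visited by the best-response dynamics started in column `b`. -/
def brLines {K : ℕ} (Ψ : (Fin K × Fin K) ≃ Fin (K ^ 2)) (b : Fin K) : ℕ → Fin K
  | 0 => b
  | j + 1 =>
    if Even j then argminRow (pot Ψ) (brLines Ψ b j) else argminCol (pot Ψ) (brLines Ψ b j)

lemma pot_le_iff {K : ℕ} (Ψ : (Fin K × Fin K) ≃ Fin (K ^ 2)) (p q : Fin K × Fin K) :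
    pot Ψ p ≤ pot Ψ q ↔ Ψ p ≤ Ψ q := by
  simp [pot]

lemma pot_lt_iff {K : ℕ} (Ψ : (Fin K × Fin K) ≃ Fin (K ^ 2)) (p q : Fin K × Fin K) :
    pot Ψ p < pot Ψ q ↔ Ψ p < Ψ q := by
  simp [pot]

lemma BRD_succ_eq_lineCell {K : ℕ} (Ψ : (Fin K × Fin K) ≃ Fin (K ^ 2)) (p : Fin K × Fin K)
    (t : ℕ) : BRD (pot Ψ) p (t + 1) = lineCell (brLines Ψ p.2) t := by
  induction t with
  | zero => simp [BRD, lineCell, brLines]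
  | succ t ih =>
    rw [BRD, ih]
    by_cases h : Even t <;> simp [lineCell, brLines, h, Nat.even_add_one]

section Dynamics

variable {K : ℕ} (Ψ : (Fin K × Fin K) ≃ Fin (K ^ 2)) (b : Fin K)

lemma brLines_min {j : ℕ} {p : Fin K × Fin K} (hp : OnLine j (brLines Ψ b j) p) :
    Ψ (lineCell (brLines Ψ b) j) ≤ Ψ p := by
  obtain ⟨p1, p2⟩ := p
  rw [← pot_le_iff]
  have : Nonempty (Fin K) := ⟨b⟩
  by_cases h : Even j
  · simp only [OnLine, h, if_true] at hp
    subst hp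
    simp only [lineCell, brLines, h, if_true]
    exact Classical.choose_spec (Finite.exists_min fun a => pot Ψ (a, brLines Ψ b j)) p1
  · simp only [OnLine, h, if_false] at hp
    subst hp
    simp only [lineCell, brLines, h, if_false]
    exact Classical.choose_spec (Finite.exists_min fun a => pot Ψ (brLines Ψ b j, a)) p2

lemma eq_lineCell_brLines {j : ℕ} {c : Fin K × Fin K} (hc : OnLine j (brLines Ψ b j) c)
    (hmin : ∀ p, OnLine j (brLines Ψ b j) p → Ψ c ≤ Ψ p) : c = lineCell (brLines Ψ b) j :=
  Ψ.injective (le_antisymm (hmin _ (onLine_lineCell _ _)) (brLines_min Ψ b hc))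

lemma lineCell_brLines_congr {i j : ℕ} (hij : i % 2 = j % 2)
    (h : brLines Ψ b i = brLines Ψ b j) :
    lineCell (brLines Ψ b) i = lineCell (brLines Ψ b) j := by
  apply eq_lineCell_brLines
  · rw [← h, ← onLine_congr hij]
    exact onLine_lineCell _ _
  · intro p hp
    apply brLines_min
    rwa [h, onLine_congr hij]

lemma brLines_antitone : Antitone fun j => Ψ (lineCell (brLines Ψ b) j) :=
  antitone_nat_of_succ_le fun j => brLines_min Ψ b (onLine_succ_lineCell _ j)

lemma lineCell_succ_eq_iff (j : ℕ) :
    lineCell (brLines Ψ b) (j + 1) = lineCell (brLines Ψ b) j ↔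
      brLines Ψ b (j + 2) = brLines Ψ b j := by
  rw [lineCell_eq_iff]
  constructor
  · rintro ⟨-, h⟩
    exact eq_of_onLine (by omega) h (onLine_lineCell _ j)
  · intro h
    refine ⟨onLine_succ_lineCell _ _, ?_⟩
    rw [show j + 1 + 1 = j + 2 from rfl, h, onLine_congr (j := j) (by omega)]
    exact onLine_lineCell _ _

lemma lineCell_brLines_of_le {k : ℕ} (hk : brLines Ψ b (k + 2) = brLines Ψ b k) {j : ℕ}
    (hj : k ≤ j) : lineCell (brLines Ψ b) j = lineCell (brLines Ψ b) k := by
  have key : ∀ i, lineCell (brLines Ψ b) (k + i) = lineCell (brLines Ψ b) k ∧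
      brLines Ψ b (k + i + 2) = brLines Ψ b (k + i) := by
    intro i
    induction i with
    | zero => exact ⟨rfl, hk⟩
    | succ i ih =>
      have h1 := (lineCell_succ_eq_iff Ψ b (k + i)).2 ih.2
      refine ⟨h1.trans ih.1, ?_⟩
      have h2 := lineCell_brLines_congr Ψ b (i := k + i + 2) (j := k + i) (by omega) ih.2
      rw [← add_assoc]
      exact (lineCell_succ_eq_iff Ψ b (k + i + 1)).1 (h2.trans h1.symm)
  obtain ⟨i, rfl⟩ := Nat.exists_eq_add_of_le hj
  exact (key i).1

lemma distinctLines_brLines {k : ℕ} (hk : ∀ j < k, brLines Ψ b (j + 2) ≠ brLines Ψ b j) :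
    DistinctLines (k + 2) (brLines Ψ b) := by
  have key : ∀ i j, i < j → j < k + 2 → i % 2 = j % 2 → brLines Ψ b i ≠ brLines Ψ b j := by
    intro i j hij hj hmod h
    have h1 := lineCell_brLines_congr Ψ b hmod h
    have h2 : Ψ (lineCell (brLines Ψ b) j) ≤ Ψ (lineCell (brLines Ψ b) (i + 1)) :=
      brLines_antitone Ψ b hij
    have h3 : Ψ (lineCell (brLines Ψ b) (i + 1)) ≤ Ψ (lineCell (brLines Ψ b) i) :=
      brLines_antitone Ψ b (Nat.le_succ i)
    rw [← h1] at h2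
    exact hk i (by omega) ((lineCell_succ_eq_iff Ψ b i).1 (Ψ.injective (le_antisymm h3 h2)))
  intro i hi j hj hmod h
  by_contra hne
  rcases lt_or_gt_of_ne hne with hlt | hlt
  · exact key i j hlt hj hmod h
  · exact key j i hlt hi hmod.symm h.symm

lemma DistinctLines.le_two_mul {m : ℕ} {z : ℕ → Fin K} (hz : DistinctLines m z) :
    m ≤ 2 * K := by
  have : Function.Injective fun i : Fin ((m + 1) / 2) => z (2 * i) := by
    intro i j h
    have := hz (2 * i) (by omega) (2 * j) (by omega) (by omega) h
    omega
  have := Fintype.card_le_of_injective _ this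
  simp only [Fintype.card_fin] at this
  omega

lemma exists_absorption : ∃ k, k + 2 ≤ 2 * K ∧ brLines Ψ b (k + 2) = brLines Ψ b k ∧
    ∀ j < k, brLines Ψ b (j + 2) ≠ brLines Ψ b j := by
  have hex : ∃ k, brLines Ψ b (k + 2) = brLines Ψ b k := by
    by_contra! h
    have := (distinctLines_brLines Ψ b (k := 2 * K) fun j _ => h j).le_two_mul
    omega
  refine ⟨Nat.find hex, ?_, Nat.find_spec hex, fun j hj => Nat.find_min hex hj⟩
  exact (distinctLines_brLines Ψ b fun j hj => Nat.find_min hex hj).le_two_mul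

lemma isPNE_pot_iff (p : Fin K × Fin K) :
    IsPNE (pot Ψ) p ↔ ∀ q, q.1 = p.1 ∨ q.2 = p.2 → Ψ p ≤ Ψ q := by
  simp only [IsPNE, pot_lt_iff]
  constructor
  · rintro ⟨h1, h2⟩ ⟨q1, q2⟩ (h | h)
    · simp only at h
      subst h
      by_cases h : q2 = p.2
      · subst h; rfl
      · exact (h2 q2 h).le
    · simp only at h
      subst h
      by_cases h : q1 = p.1
      · subst h; rfl
      · exact (h1 q1 h).le
  · intro h
    refine ⟨fun a ha => lt_of_le_of_ne (h _ (Or.inr rfl)) ?_,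
      fun a ha => lt_of_le_of_ne (h _ (Or.inl rfl)) ?_⟩
    · intro he
      exact ha (congrArg Prod.fst (Ψ.injective he)).symm
    · intro he
      exact ha (congrArg Prod.snd (Ψ.injective he)).symm

/-- A cell is an equilibrium iff it is minimal on the two lines through it. -/
lemma isPNE_lineCell_iff (z : ℕ → Fin K) (j : ℕ) :
    IsPNE (pot Ψ) (lineCell z j) ↔
      ∀ q, OnLine j (z j) q ∨ OnLine (j + 1) (z (j + 1)) q → Ψ (lineCell z j) ≤ Ψ q := by
  rw [isPNE_pot_iff]
  refine forall_congr' fun q => ?_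
  by_cases h : Even j <;> simp [OnLine, lineCell, h, Nat.even_add_one, or_comm]

lemma lineCell_congr {z w : ℕ → Fin K} {j : ℕ} (h : z j = w j) (h' : z (j + 1) = w (j + 1)) :
    lineCell z j = lineCell w j := by
  unfold lineCell
  rw [h, h']

variable {Ψ b} in
lemma brLines_le_of_onLine {k : ℕ} (hk : brLines Ψ b (k + 2) = brLines Ψ b k) {i : ℕ}
    {p : Fin K × Fin K} (hp : OnLine i (brLines Ψ b i) p) :
    Ψ (lineCell (brLines Ψ b) k) ≤ Ψ p := by
  refine le_trans ?_ (brLines_min Ψ b hp)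
  rcases le_total i k with h | h
  · exact brLines_antitone Ψ b h
  · rw [lineCell_brLines_of_le Ψ b hk h]

variable {Ψ} in
/-- On the path event, the sequence `z` consists of the lines visited by the dynamics. -/
lemma PathEvent.eq_brLines {k : ℕ} {z : ℕ → Fin K} (h : PathEvent Ψ k z) :
    ∀ j < k + 2, z j = brLines Ψ (z 0) j := by
  intro j
  induction j with
  | zero => intro _; rfl
  | succ j ih =>
    intro hj
    have hz := ih (by omega)
    have hcell : lineCell z j = lineCell (brLines Ψ (z 0)) j := by
      apply eq_lineCell_brLines
      · rw [← hz]
        exact onLine_lineCell z j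
      · intro p hp
        rw [← hz] at hp
        rcases Nat.lt_or_ge j k with hjk | hjk
        · exact (h.1 j hjk).2 p (mem_lineUnion.2 ⟨j, by omega, hp⟩)
        · obtain rfl : j = k := by omega
          exact h.2.1.2 p (mem_lineUnion.2 ⟨j, by omega, hp⟩)
    have h1 := onLine_succ_lineCell z j
    rw [hcell] at h1
    exact eq_of_onLine rfl h1 (onLine_succ_lineCell _ j)

variable {Ψ} in
lemma PathEvent.lineCell_eq {k : ℕ} {z : ℕ → Fin K} (h : PathEvent Ψ k z) :
    lineCell z k = lineCell (brLines Ψ (z 0)) k :=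
  lineCell_congr (h.eq_brLines k (by omega)) (h.eq_brLines (k + 1) (by omega))

variable {Ψ} in
lemma PathEvent.absorbed {k : ℕ} {z : ℕ → Fin K} (h : PathEvent Ψ k z) :
    brLines Ψ (z 0) (k + 2) = brLines Ψ (z 0) k := by
  rw [← lineCell_succ_eq_iff, ← h.lineCell_eq]
  symm
  have hz := h.eq_brLines (k + 1) (by omega)
  apply eq_lineCell_brLines
  · rw [← hz]
    exact onLine_succ_lineCell z k
  · intro p hp
    rw [← hz] at hp
    exact h.2.1.2 p (mem_lineUnion.2 ⟨k + 1, by omega, hp⟩)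

variable {Ψ} in
lemma PathEvent.not_absorbed {k : ℕ} {z : ℕ → Fin K} (h : PathEvent Ψ k z)
    (hz : DistinctLines (k + 4) z) {j : ℕ} (hj : j < k) :
    brLines Ψ (z 0) (j + 2) ≠ brLines Ψ (z 0) j := by
  rw [← h.eq_brLines j (by omega), ← h.eq_brLines (j + 2) (by omega)]
  intro he
  have := hz (j + 2) (by omega) j (by omega) (by omega) he
  omega

/-- The equilibria of smaller potential than the one reached from column `b`. -/
def lowerPNE : Finset (Fin K × Fin K) :=
  Finset.univ.filter fun q =>
    IsPNE (pot Ψ) q ∧ Ψ q < Ψ (lineCell (brLines Ψ b) (2 * K - 1))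

variable {Ψ} in
lemma PathEvent.mem_lowerPNE {k : ℕ} {z : ℕ → Fin K} (h : PathEvent Ψ k z)
    (hz : DistinctLines (k + 4) z) : lineCell z (k + 2) ∈ lowerPNE Ψ (z 0) := by
  have hkK := hz.le_two_mul
  rw [lowerPNE, Finset.mem_filter, lineCell_brLines_of_le Ψ (z 0) h.absorbed (by omega),
    ← h.lineCell_eq]
  refine ⟨Finset.mem_univ _, ?_, ?_⟩
  · rw [isPNE_lineCell_iff]
    rintro q (hq | hq)
    · exact h.2.2.2 q (mem_lineUnion.2 ⟨k + 2, by omega, hq⟩)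
    · exact h.2.2.2 q (mem_lineUnion.2 ⟨k + 3, by omega, hq⟩)
  · refine lt_of_le_of_ne (h.2.2.2 _ (lineCell_mem_lineUnion z (by omega))) fun he => ?_
    refine lineCell_notMem_lineUnion hz (j := k + 2) (m := k + 1) (by omega) (by omega) ?_
    rw [Ψ.injective he]
    exact lineCell_mem_lineUnion z (by omega)

variable {Ψ b} in
/-- Appending to the lines of the dynamics the two lines through a lower equilibrium gives a
sequence of lines satisfying the path event. -/
lemma pathEvent_of_lower {k : ℕ} (hk : brLines Ψ b (k + 2) = brLines Ψ b k)
    (hmin : ∀ j < k, brLines Ψ b (j + 2) ≠ brLines Ψ b j) {q : Fin K × Fin K}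
    (hq : IsPNE (pot Ψ) q) (hlt : Ψ q < Ψ (lineCell (brLines Ψ b) k)) {w : ℕ → Fin K}
    (hw : ∀ j < k + 2, w j = brLines Ψ b j)
    (hwq : ∀ j < k + 4, k + 2 ≤ j → OnLine j (w j) q) :
    DistinctLines (k + 4) w ∧ PathEvent Ψ k w ∧ lineCell w (k + 2) = q := by
  have hcell : ∀ j ≤ k, lineCell w j = lineCell (brLines Ψ b) j := fun j hj =>
    lineCell_congr (hw j (by omega)) (hw (j + 1) (by omega))
  have hcq : lineCell w (k + 2) = q :=
    (lineCell_eq_iff w (k + 2) q).2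
      ⟨hwq (k + 2) (by omega) (by omega), hwq (k + 3) (by omega) (by omega)⟩
  have hoff : ∀ i < k + 2, ¬ OnLine i (w i) q := by
    intro i hi h
    rw [hw i hi] at h
    exact absurd hlt (not_lt.2 (brLines_le_of_onLine hk h))
  refine ⟨?_, ⟨?_, ⟨lineCell_mem_lineUnion w (by omega), ?_⟩,
    lineCell_mem_lineUnion w (by omega), ?_⟩, hcq⟩
  · have key : ∀ i j, i < j → j < k + 4 → i % 2 = j % 2 → w i ≠ w j := by
      intro i j hij hj hmod h
      rcases Nat.lt_or_ge j (k + 2) with hjk | hjk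
      · rw [hw i (by omega), hw j hjk] at h
        have := distinctLines_brLines Ψ b hmin i (by omega) j hjk hmod h
        omega
      · refine hoff i (by omega) ?_
        rw [h, onLine_congr hmod]
        exact hwq j hj hjk
    intro i hi j hj hmod h
    by_contra hne
    rcases lt_or_gt_of_ne hne with hlt | hlt
    · exact key i j hlt hj hmod h
    · exact key j i hlt hi hmod.symm h.symm
  · intro j hj
    refine ⟨lineCell_mem_lineUnion w (by omega), fun d hd => ?_⟩
    obtain ⟨i, hi, hd⟩ := mem_lineUnion.1 hd
    rw [hw i (by omega)] at hd
    rw [hcell j hj.le]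
    exact (brLines_antitone Ψ b (show i ≤ j by omega)).trans (brLines_min Ψ b hd)
  · intro d hd
    obtain ⟨i, hi, hd⟩ := mem_lineUnion.1 hd
    rw [hw i hi] at hd
    rw [hcell k le_rfl]
    exact brLines_le_of_onLine hk hd
  · intro d hd
    obtain ⟨i, hi, hd⟩ := mem_lineUnion.1 hd
    rcases Nat.lt_or_ge i (k + 2) with hik | hik
    · rw [hw i hik] at hd
      rw [hcq]
      exact hlt.le.trans (brLines_le_of_onLine hk hd)
    · rw [← hcq, isPNE_lineCell_iff] at hq
      refine hq d ?_
      rcases (show i = k + 2 ∨ i = k + 3 by omega) with rfl | rfl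
      · exact Or.inl hd
      · exact Or.inr hd

lemma sum_card_lowerPNE [NeZero K] :
    ∑ b : Fin K, (lowerPNE Ψ b).card = ∑ k ∈ Finset.range (2 * K),
      ((lineSeqs K (k + 4)).filter fun z => PathEvent Ψ k (extendSeq z)).card := by
  rw [← Finset.card_sigma, ← Finset.card_sigma]
  symm
  refine Finset.card_bij
    (fun x _ => ⟨extendSeq x.2 0, lineCell (extendSeq x.2) (x.1 + 2)⟩) ?_ ?_ ?_
  · rintro ⟨k, z⟩ h
    simp only [Finset.mem_sigma, Finset.mem_filter, Finset.mem_univ, true_and, lineSeqs] at h ⊢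
    exact h.2.2.mem_lowerPNE h.2.1
  · rintro ⟨k, z⟩ h ⟨k', z'⟩ h' heq
    simp only [Finset.mem_sigma, Finset.mem_filter, Finset.mem_univ, true_and, lineSeqs,
      Sigma.mk.injEq, heq_eq_eq] at h h' heq
    obtain ⟨-, hz, hP⟩ := h
    obtain ⟨-, hz', hP'⟩ := h'
    obtain ⟨hb, hq⟩ := heq
    obtain rfl : k = k' := by
      rcases lt_trichotomy k k' with hlt | he | hlt
      · exact absurd (hb ▸ hP.absorbed) (hP'.not_absorbed hz' hlt)
      · exact he
      · exact absurd (hb ▸ hP'.absorbed) (hP.not_absorbed hz hlt)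
    congr 1
    funext j
    have hj := j.2
    rw [show z j = extendSeq z j from (extendSeq_of_lt z hj).symm,
      show z' j = extendSeq z' j from (extendSeq_of_lt z' hj).symm]
    rcases Nat.lt_or_ge (j : ℕ) (k + 2) with hjk | hjk
    · rw [hP.eq_brLines j hjk, hP'.eq_brLines j hjk, hb]
    · rcases (show (j : ℕ) = k + 2 ∨ (j : ℕ) = k + 3 by omega) with he | he
      · rw [he]
        have h1 := onLine_lineCell (extendSeq z) (k + 2)
        rw [hq] at h1
        exact eq_of_onLine rfl h1 (onLine_lineCell _ _)
      · rw [he]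
        have h1 := onLine_succ_lineCell (extendSeq z) (k + 2)
        rw [hq] at h1
        exact eq_of_onLine rfl h1 (onLine_succ_lineCell _ _)
  · rintro ⟨b, q⟩ h
    simp only [Finset.mem_sigma, Finset.mem_univ, true_and, lowerPNE, Finset.mem_filter] at h
    obtain ⟨k, hkK, hk, hmin⟩ := exists_absorption Ψ b
    rw [lineCell_brLines_of_le Ψ b hk (by omega)] at h
    let z : Fin (k + 4) → Fin K := fun j =>
      if (j : ℕ) < k + 2 then brLines Ψ b j else if Even (j : ℕ) then q.2 else q.1
    have hw : ∀ j < k + 2, extendSeq z j = brLines Ψ b j := by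
      intro j hj
      rw [extendSeq_of_lt z (show j < k + 4 by omega)]
      simp [z, hj]
    have hwq : ∀ j < k + 4, k + 2 ≤ j → OnLine j (extendSeq z j) q := by
      intro j hj hj'
      rw [extendSeq_of_lt z hj]
      by_cases he : Even j <;> simp [z, OnLine, he, not_lt.2 hj']
    obtain ⟨h1, h2, h3⟩ := pathEvent_of_lower hk hmin h.1 h.2 hw hwq
    refine ⟨⟨k, z⟩, ?_, ?_⟩
    · simp only [Finset.mem_sigma, Finset.mem_filter, Finset.mem_univ, true_and, lineSeqs,
        Finset.mem_range]
      exact ⟨by omega, h1, h2⟩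
    · rw [h3, hw 0 (by omega)]
      rfl

lemma rankPNE_BRD (hK : 0 < K) (p : Fin K × Fin K) :
    rankPNE Ψ (BRD (pot Ψ) p (2 * K)) = (lowerPNE Ψ p.2).card + 1 := by
  rw [show 2 * K = 2 * K - 1 + 1 by omega, BRD_succ_eq_lineCell]
  have hPNE : IsPNE (pot Ψ) (lineCell (brLines Ψ p.2) (2 * K - 1)) := by
    obtain ⟨k, hkK, hk, -⟩ := exists_absorption Ψ p.2
    rw [lineCell_brLines_of_le Ψ p.2 hk (by omega), isPNE_lineCell_iff]
    rintro q (hq | hq) <;> exact brLines_le_of_onLine hk hq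
  have hset : (pneFinset Ψ).filter (fun q => Ψ q ≤ Ψ (lineCell (brLines Ψ p.2) (2 * K - 1))) =
      insert (lineCell (brLines Ψ p.2) (2 * K - 1)) (lowerPNE Ψ p.2) := by
    ext q
    simp only [pneFinset, lowerPNE, Finset.mem_filter, Finset.mem_univ, true_and,
      Finset.mem_insert, le_iff_lt_or_eq, Ψ.injective.eq_iff]
    constructor
    · rintro ⟨h1, h2 | h2⟩
      · exact Or.inr ⟨h1, h2⟩
      · exact Or.inl h2
    · rintro (rfl | ⟨h1, h2⟩)
      · exact ⟨hPNE, Or.inr rfl⟩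
      · exact ⟨h1, Or.inl h2⟩
  rw [rankPNE, hset, Finset.card_insert_of_notMem (by simp [lowerPNE])]

end Dynamics

/-- The contribution of the dynamics absorbed after visiting `k + 2` lines. -/
def pathTerm (K k : ℕ) : ℝ :=
  (K.descFactorial ((k + 5) / 2) * K.descFactorial ((k + 4) / 2) : ℝ) /
    (K ^ 2 * ((∏ j ∈ Finset.range k, (coveredCells K (j + 1) : ℝ)) *
      (coveredCells K (k + 2) * coveredCells K (k + 4))))

lemma expected_rank_eq {K : ℕ} (hK : 0 < K) :
    (∑ Ψ : (Fin K × Fin K) ≃ Fin (K ^ 2), ∑ p : Fin K × Fin K,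
        (rankPNE Ψ (BRD (pot Ψ) p (2 * K)) : ℝ) / K) /
          ((Fintype.card ((Fin K × Fin K) ≃ Fin (K ^ 2)) : ℝ) * K ^ 2) =
      1 / K + ∑ k ∈ Finset.range (2 * K), pathTerm K k := by
  have : NeZero K := ⟨hK.ne'⟩
  have hK' : (K : ℝ) ≠ 0 := by positivity
  set N := Fintype.card ((Fin K × Fin K) ≃ Fin (K ^ 2)) with hN
  have hNpos : 0 < N := Fintype.card_pos_iff.2 ⟨Fintype.equivFinOfCardEq (by simp [sq])⟩
  have hNne : (N : ℝ) ≠ 0 := by positivity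
  have hinner : ∀ Ψ : (Fin K × Fin K) ≃ Fin (K ^ 2), ∑ p : Fin K × Fin K,
      (rankPNE Ψ (BRD (pot Ψ) p (2 * K)) : ℝ) / K =
        (∑ b : Fin K, (lowerPNE Ψ b).card : ℕ) + K := by
    intro Ψ
    simp only [rankPNE_BRD Ψ hK, Fintype.sum_prod_type, Finset.sum_const, Finset.card_univ,
      Fintype.card_fin, nsmul_eq_mul, ← Finset.sum_div]
    rw [mul_div_cancel_left₀ _ hK']
    push_cast
    simp [Finset.sum_add_distrib]
  have hcount : ∀ k, (∑ Ψ : (Fin K × Fin K) ≃ Fin (K ^ 2),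
      (((lineSeqs K (k + 4)).filter fun z => PathEvent Ψ k (extendSeq z)).card : ℝ)) =
        N * K ^ 2 * pathTerm K k := by
    intro k
    set Q := (∏ j ∈ Finset.range k, coveredCells K (j + 1)) *
        (coveredCells K (k + 2) * coveredCells K (k + 4)) with hQ
    have hterm : pathTerm K k = ((lineSeqs K (k + 4)).card : ℝ) / (K ^ 2 * Q) := by
      rw [pathTerm, card_lineSeqs, hQ]
      push_cast
      rfl
    have hswap : (∑ Ψ : (Fin K × Fin K) ≃ Fin (K ^ 2),
        ((lineSeqs K (k + 4)).filter fun z => PathEvent Ψ k (extendSeq z)).card) =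
        ∑ z ∈ lineSeqs K (k + 4), (Finset.univ.filter
          fun Ψ : (Fin K × Fin K) ≃ Fin (K ^ 2) => PathEvent Ψ k (extendSeq z)).card := by
      simp only [Finset.card_filter]
      exact Finset.sum_comm
    have hz : ∀ z ∈ lineSeqs K (k + 4), (((Finset.univ.filter
        fun Ψ : (Fin K × Fin K) ≃ Fin (K ^ 2) => PathEvent Ψ k (extendSeq z)).card : ℕ) : ℝ) =
          N / Q := by
      intro z hz
      have h := card_pathEvent_mul (Finset.mem_filter.1 hz).2
      rw [← hQ, ← hN] at h
      have hQ0 : (Q : ℝ) ≠ 0 := by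
        intro h0
        rw [Nat.cast_eq_zero] at h0
        rw [h0, mul_zero] at h
        omega
      rw [eq_div_iff hQ0]
      exact_mod_cast h
    rw [← Nat.cast_sum, hswap, Nat.cast_sum, Finset.sum_congr rfl hz, hterm]
    simp only [Finset.sum_const, nsmul_eq_mul]
    field_simp
  simp only [hinner, sum_card_lowerPNE]
  push_cast
  rw [Finset.sum_add_distrib, Finset.sum_comm]
  simp only [hcount, ← Finset.mul_sum, Finset.sum_const, Finset.card_univ, nsmul_eq_mul, ← hN]
  field_simp
  ring

lemma tendsto_coveredCells_div (j : ℕ) :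
    Filter.Tendsto (fun K : ℕ => (coveredCells K j : ℝ) / K) Filter.atTop (nhds j) := by
  have h : Filter.Tendsto
      (fun K : ℕ => (j : ℝ) - (((j + 1) / 2 : ℕ) * (j / 2 : ℕ) : ℝ) / K)
      Filter.atTop (nhds (j - 0)) :=
    tendsto_const_nhds.sub (tendsto_const_div_atTop_nhds_zero_nat _)
  rw [sub_zero] at h
  refine h.congr' ?_
  filter_upwards [Filter.eventually_ge_atTop (j + 1)] with K hK
  have hK' : (K : ℝ) ≠ 0 := by
    have : 0 < K := by omega
    positivity
  have hle : (K - (j + 1) / 2) * (K - j / 2) ≤ K ^ 2 := by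
    rw [sq]
    exact Nat.mul_le_mul (Nat.sub_le _ _) (Nat.sub_le _ _)
  have hj : (j : ℝ) = ((j + 1) / 2 : ℕ) + (j / 2 : ℕ) := by
    norm_cast
    omega
  rw [coveredCells, Nat.cast_sub hle, Nat.cast_mul, Nat.cast_sub (by omega),
    Nat.cast_sub (by omega), Nat.cast_pow, hj]
  field_simp
  ring

lemma tendsto_descFactorial_div_pow_s8 (c : ℕ) :
    Filter.Tendsto (fun K : ℕ => (K.descFactorial c : ℝ) / K ^ c) Filter.atTop (nhds 1) := by
  refine (Asymptotics.isEquivalent_iff_tendsto_one ?_).1 (isEquivalent_descFactorial c)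
  filter_upwards [Filter.eventually_gt_atTop 0] with K hK
  positivity

lemma pathTerm_eq {K : ℕ} (hK : 0 < K) (k : ℕ) :
    pathTerm K k = ((K.descFactorial ((k + 5) / 2) : ℝ) / K ^ ((k + 5) / 2) *
      ((K.descFactorial ((k + 4) / 2) : ℝ) / K ^ ((k + 4) / 2))) /
        ((∏ j ∈ Finset.range k, (coveredCells K (j + 1) : ℝ) / K) *
          ((coveredCells K (k + 2) : ℝ) / K * ((coveredCells K (k + 4) : ℝ) / K))) := by
  have hK' : (K : ℝ) ≠ 0 := by positivity
  have hpow : (K : ℝ) ^ ((k + 5) / 2) * K ^ ((k + 4) / 2) = K ^ 2 * (K ^ k * (K * K)) := by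
    rw [← pow_add, show (k + 5) / 2 + (k + 4) / 2 = 2 + (k + 2) by omega]
    ring
  rw [pathTerm, Finset.prod_div_distrib, Finset.prod_const, Finset.card_range,
    div_mul_div_comm, div_mul_div_comm, div_mul_div_comm, hpow, div_div_div_eq]
  rw [mul_div_mul_comm, mul_div_mul_comm]
  field_simp

lemma tendsto_pathTerm (k : ℕ) :
    Filter.Tendsto (fun K => pathTerm K k) Filter.atTop
      (nhds (1 / (k.factorial * ((k + 2) * (k + 4))))) := by
  have h := ((tendsto_descFactorial_div_pow_s8 ((k + 5) / 2)).mul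
    (tendsto_descFactorial_div_pow_s8 ((k + 4) / 2))).div
    ((tendsto_finsetProd (Finset.range k) fun j _ => tendsto_coveredCells_div (j + 1)).mul
      ((tendsto_coveredCells_div (k + 2)).mul (tendsto_coveredCells_div (k + 4)))) (by
        refine mul_ne_zero (Finset.prod_ne_zero_iff.2 fun j _ => ?_) (mul_ne_zero ?_ ?_) <;>
          positivity)
  have hfac : ∏ j ∈ Finset.range k, ((j + 1 : ℕ) : ℝ) = k.factorial := by
    rw [← Nat.cast_prod, Finset.prod_range_add_one_eq_factorial]
  rw [hfac, one_mul] at h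
  push_cast at h
  refine h.congr' ?_
  filter_upwards [Filter.eventually_gt_atTop 0] with K hK
  exact (pathTerm_eq hK k).symm

lemma le_coveredCells_div {K j : ℕ} (hK : 0 < K) (hj : j ≤ 2 * K) :
    (j : ℝ) / 2 ≤ (coveredCells K j : ℝ) / K := by
  have h1 : (K - (j + 1) / 2) * (K - j / 2) ≤ (K - (j + 1) / 2) * K :=
    Nat.mul_le_mul_left _ (Nat.sub_le _ _)
  have h2 : (j + 1) / 2 * K + (K - (j + 1) / 2) * K = K ^ 2 := by
    rw [← add_mul, Nat.add_sub_cancel' (by omega), sq]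
  have h3 : (j + 1) / 2 * K ≤ coveredCells K j := by
    unfold coveredCells
    omega
  have h4 : j * K ≤ 2 * coveredCells K j := by
    calc j * K ≤ 2 * ((j + 1) / 2) * K := Nat.mul_le_mul_right _ (by omega)
      _ ≤ 2 * coveredCells K j := by rw [mul_assoc]; omega
  have h5 : (j : ℝ) * K ≤ 2 * coveredCells K j := by exact_mod_cast h4
  rw [div_le_div_iff₀ two_pos (by positivity)]
  linarith

lemma pathTerm_nonneg (K k : ℕ) : 0 ≤ pathTerm K k := by
  unfold pathTerm
  positivity

lemma descFactorial_div_pow_le_one (K c : ℕ) : (K.descFactorial c : ℝ) / K ^ c ≤ 1 :=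
  div_le_one_of_le₀ (by exact_mod_cast Nat.descFactorial_le_pow K c) (by positivity)

lemma pathTerm_le {K : ℕ} (hK : 0 < K) (k : ℕ) : pathTerm K k ≤ 2 ^ k / k.factorial := by
  rcases Nat.lt_or_ge K ((k + 5) / 2) with h | h
  · rw [pathTerm, Nat.descFactorial_of_lt h]
    simp only [Nat.cast_zero, zero_mul, zero_div]
    positivity
  have hprod : (k.factorial : ℝ) / 2 ^ k ≤
      ∏ j ∈ Finset.range k, (coveredCells K (j + 1) : ℝ) / K := by
    calc (k.factorial : ℝ) / 2 ^ k = ∏ j ∈ Finset.range k, ((j + 1 : ℕ) : ℝ) / 2 := by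
          rw [Finset.prod_div_distrib, Finset.prod_const, Finset.card_range, ← Nat.cast_prod,
            Finset.prod_range_add_one_eq_factorial]
      _ ≤ _ := Finset.prod_le_prod (fun j _ => by positivity) fun j hj =>
          le_coveredCells_div hK (by rw [Finset.mem_range] at hj; omega)
  have hone : ∀ j, 2 ≤ j → j ≤ 2 * K → 1 ≤ (coveredCells K j : ℝ) / K := by
    intro j hj hjK
    have h2 : (2 : ℝ) ≤ j := by exact_mod_cast hj
    linarith [le_coveredCells_div hK hjK]
  rw [pathTerm_eq hK, show (2 : ℝ) ^ k / k.factorial = 1 / (k.factorial / 2 ^ k * (1 * 1)) by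
    field_simp]
  refine div_le_div₀ zero_le_one ?_ (by positivity) ?_
  · exact mul_le_one₀ (descFactorial_div_pow_le_one _ _) (by positivity)
      (descFactorial_div_pow_le_one _ _)
  · exact mul_le_mul hprod (mul_le_mul (hone _ (by omega) (by omega))
      (hone _ (by omega) (by omega)) zero_le_one (by positivity)) (by norm_num)
      (Finset.prod_nonneg fun j _ => by positivity)

lemma hasSum_pathTerm_limit :
    HasSum (fun k : ℕ => (1 / (k.factorial * ((k + 2) * (k + 4))) : ℝ))
      (Real.exp 1 - 5 / 2) := by
  have hexp : HasSum (fun n : ℕ => (1 / n.factorial : ℝ)) (Real.exp 1) := by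
    have := NormedSpace.expSeries_div_hasSum_exp (1 : ℝ)
    rw [← Real.exp_eq_exp_ℝ] at this
    simpa using this
  have h2 := (hasSum_nat_add_iff' 2).2 hexp
  have h3 := (hasSum_nat_add_iff' 3).2 hexp
  have h4 := (hasSum_nat_add_iff' 4).2 hexp
  have hterm : ∀ k : ℕ, (1 / (k.factorial * ((k + 2) * (k + 4))) : ℝ) =
      1 / ((k + 2).factorial : ℝ) - 3 * (1 / ((k + 3).factorial : ℝ)) +
        3 * (1 / ((k + 4).factorial : ℝ)) := by
    intro k
    have hk : (k.factorial : ℝ) ≠ 0 := by positivity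
    have : (k : ℝ) + 1 ≠ 0 := by positivity
    have : (k : ℝ) + 2 ≠ 0 := by positivity
    have : (k : ℝ) + 3 ≠ 0 := by positivity
    have : (k : ℝ) + 4 ≠ 0 := by positivity
    have f2 : ((k + 2).factorial : ℝ) = (k + 2) * (k + 1) * k.factorial := by
      rw [Nat.factorial_succ, Nat.factorial_succ]; push_cast; ring
    have f3 : ((k + 3).factorial : ℝ) = (k + 3) * ((k + 2) * (k + 1) * k.factorial) := by
      rw [Nat.factorial_succ, Nat.cast_mul, f2]; push_cast; ring
    have f4 : ((k + 4).factorial : ℝ) =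
        (k + 4) * ((k + 3) * ((k + 2) * (k + 1) * k.factorial)) := by
      rw [Nat.factorial_succ, Nat.cast_mul, f3]; push_cast; ring
    rw [f2, f3, f4]
    field_simp
    ring
  have hval : Real.exp 1 - 5 / 2 = Real.exp 1 - ∑ i ∈ Finset.range 2, (1 / i.factorial : ℝ) -
      3 * (Real.exp 1 - ∑ i ∈ Finset.range 3, (1 / i.factorial : ℝ)) +
        3 * (Real.exp 1 - ∑ i ∈ Finset.range 4, (1 / i.factorial : ℝ)) := by
    simp [Finset.sum_range_succ, Nat.factorial]
    ring
  rw [funext hterm, hval]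
  exact (h2.sub (h3.mul_left 3)).add (h4.mul_left 3)

lemma tendsto_sum_pathTerm :
    Filter.Tendsto (fun K : ℕ => ∑ k ∈ Finset.range (2 * K), pathTerm K k) Filter.atTop
      (nhds (Real.exp 1 - 5 / 2)) := by
  have hrange : ∀ k, Filter.Tendsto
      (fun K => if k ∈ Finset.range (2 * K) then pathTerm K k else 0) Filter.atTop
      (nhds (1 / (k.factorial * ((k + 2) * (k + 4))))) := by
    intro k
    refine (tendsto_pathTerm k).congr' ?_
    filter_upwards [Filter.eventually_gt_atTop k] with K hK
    rw [if_pos (Finset.mem_range.2 (by omega))]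
  have h := tendsto_tsum_of_dominated_convergence (Real.summable_pow_div_factorial 2) hrange (by
    filter_upwards [Filter.eventually_gt_atTop 0] with K hK k
    split_ifs
    · rw [Real.norm_of_nonneg (pathTerm_nonneg K k)]
      exact pathTerm_le hK k
    · rw [norm_zero]
      positivity)
  rw [hasSum_pathTerm_limit.tsum_eq] at h
  refine h.congr fun K => ?_
  rw [tsum_eq_sum (s := Finset.range (2 * K)) fun k hk => if_neg hk]
  exact Finset.sum_congr rfl fun k hk => if_pos hk

/-- For a uniformly random potential and a uniformly random (independent) starting
profile, the expected rescaled rank of the equilibrium reached by the best-response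
dynamics converges to `e - 5/2`. -/
theorem stmt8 :
    Filter.Tendsto (fun K : ℕ =>
        (∑ Ψ : (Fin K × Fin K) ≃ Fin (K ^ 2), ∑ p : Fin K × Fin K,
            (rankPNE Ψ (BRD (pot Ψ) p (2 * K)) : ℝ) / K) /
          ((Fintype.card ((Fin K × Fin K) ≃ Fin (K ^ 2)) : ℝ) * K ^ 2))
      Filter.atTop (nhds (Real.exp 1 - 5 / 2)) := by
  have h := (tendsto_const_div_atTop_nhds_zero_nat (1 : ℝ)).add tendsto_sum_pathTerm
  rw [zero_add] at h
  refine h.congr' ?_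
  filter_upwards [Filter.eventually_gt_atTop 0] with K hK
  exact (expected_rank_eq hK).symm
end
end

section
/- Let Ψ_K be a uniformly random bijection from [K]×[K] to {1,…,K²}, let W_K be its number of pure Nash equilibria, and let η_{W_K} be the pure Nash equilibrium of Ψ_K with the largest potential value. Then for every δ > 0, lim_{K→∞} P( Ψ_K(η_{W_K}) / (K log K) < 1 + δ ) = 1. -/
open scoped Classical

noncomputable section

/-- Adjoining one point `q` to `S` multiplies the number of bijections mapping `S` into `B` by
`(|B| - |S|) / (|β| - |S|)`. -/
lemma card_filter_equiv_insert_mul {α β : Type*} [Fintype α] [Fintype β]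
    [DecidableEq α] [DecidableEq β]
    (B : Finset β) {S : Finset α} {q : α} (hq : q ∉ S) :
    (Finset.univ.filter fun e : α ≃ β => ∀ x ∈ insert q S, e x ∈ B).card *
        (Fintype.card α - S.card) =
      (B.card - S.card) * (Finset.univ.filter fun e : α ≃ β => ∀ x ∈ S, e x ∈ B).card := by
  have hswap : ∀ r ∈ Sᶜ,
      (Finset.univ.filter fun e : α ≃ β => ∀ x ∈ insert r S, e x ∈ B).card =
        (Finset.univ.filter fun e : α ≃ β => ∀ x ∈ insert q S, e x ∈ B).card := by
    intro r hr
    rw [Finset.mem_compl] at hr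
    have hfix : ∀ x ∈ S, Equiv.swap q r x = x := fun x hx =>
      Equiv.swap_apply_of_ne_of_ne (fun h => hq (h ▸ hx)) (fun h => hr (h ▸ hx))
    refine Finset.card_bij' (fun e _ => (Equiv.swap q r).trans e)
      (fun e _ => (Equiv.swap q r).trans e) ?_ ?_ ?_ ?_
    · intro e he
      simp only [Finset.mem_filter, Finset.mem_univ, true_and, Finset.forall_mem_insert,
        Equiv.trans_apply, Equiv.swap_apply_left] at he ⊢
      exact ⟨he.1, fun x hx => by rw [hfix x hx]; exact he.2 x hx⟩
    · intro e he
      simp only [Finset.mem_filter, Finset.mem_univ, true_and, Finset.forall_mem_insert,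
        Equiv.trans_apply, Equiv.swap_apply_right] at he ⊢
      exact ⟨he.1, fun x hx => by rw [hfix x hx]; exact he.2 x hx⟩
    · intro e _
      ext x
      simp
    · intro e _
      ext x
      simp
  have hcount : ∀ e ∈ Finset.univ.filter (fun e : α ≃ β => ∀ x ∈ S, e x ∈ B),
      (Sᶜ.filter fun r => e r ∈ B).card = B.card - S.card := by
    intro e he
    simp only [Finset.mem_filter, Finset.mem_univ, true_and] at he
    have himg : (Sᶜ.filter fun r => e r ∈ B).map e.toEmbedding = B \ S.map e.toEmbedding := by
      ext y
      obtain ⟨x, rfl⟩ := e.surjective y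
      simp [and_comm]
    rw [← Finset.card_map e.toEmbedding, himg, Finset.card_sdiff_of_subset, Finset.card_map]
    intro y hy
    obtain ⟨x, hx, rfl⟩ := Finset.mem_map.1 hy
    exact he x hx
  calc
    _ = ∑ r ∈ Sᶜ, (Finset.univ.filter fun e : α ≃ β => ∀ x ∈ insert r S, e x ∈ B).card := by
      rw [Finset.sum_congr rfl hswap, Finset.sum_const, Finset.card_compl, smul_eq_mul, mul_comm]
    _ = ∑ r ∈ Sᶜ, ((Finset.univ.filter fun e : α ≃ β => ∀ x ∈ S, e x ∈ B).filter
          fun e => e r ∈ B).card := by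
      refine Finset.sum_congr rfl fun r _ => congrArg _ ?_
      ext e
      simp [and_comm]
    _ = ∑ e ∈ Finset.univ.filter (fun e : α ≃ β => ∀ x ∈ S, e x ∈ B),
          (Sᶜ.filter fun r => e r ∈ B).card := by
      exact Finset.sum_card_bipartiteAbove_eq_sum_card_bipartiteBelow
        (fun (r : α) (e : α ≃ β) => e r ∈ B)
    _ = _ := by
      rw [Finset.sum_congr rfl hcount, Finset.sum_const, smul_eq_mul, mul_comm]

/-- A uniformly random bijection `α ≃ β` maps `S` into `B` with probability at most
`(|B| / |α|) ^ |S|`. -/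
lemma card_filter_equiv_mul_pow_le {α β : Type*} [Fintype α] [Fintype β]
    [DecidableEq α] [DecidableEq β]
    (B : Finset β) (hB : B.card ≤ Fintype.card α) (S : Finset α) :
    (Finset.univ.filter fun e : α ≃ β => ∀ x ∈ S, e x ∈ B).card * Fintype.card α ^ S.card ≤
      B.card ^ S.card * Fintype.card (α ≃ β) := by
  induction S using Finset.induction_on with
  | empty => simp
  | insert q S hq ih =>
    have hS : S.card < Fintype.card α :=
      (Finset.card_lt_univ_of_notMem hq)
    have key := card_filter_equiv_insert_mul B hq
    set A' := (Finset.univ.filter fun e : α ≃ β => ∀ x ∈ insert q S, e x ∈ B).card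
    set A := (Finset.univ.filter fun e : α ≃ β => ∀ x ∈ S, e x ∈ B).card
    have hratio : (B.card - S.card) * Fintype.card α ≤ B.card * (Fintype.card α - S.card) := by
      rw [Nat.sub_mul, Nat.mul_sub, mul_comm B.card S.card]
      rw [mul_comm S.card (Fintype.card α), mul_comm S.card B.card]
      have : B.card * S.card ≤ Fintype.card α * S.card := Nat.mul_le_mul_right _ hB
      omega
    have hstep : A' * Fintype.card α ≤ B.card * A := by
      refine Nat.le_of_mul_le_mul_right ?_ (Nat.sub_pos_of_lt hS)
      calc A' * Fintype.card α * (Fintype.card α - S.card)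
          = ((B.card - S.card) * Fintype.card α) * A := by
            rw [mul_right_comm, key]; ring
        _ ≤ (B.card * (Fintype.card α - S.card)) * A := Nat.mul_le_mul_right _ hratio
        _ = _ := by ring
    rw [Finset.card_insert_of_notMem hq]
    calc A' * Fintype.card α ^ (S.card + 1)
        = (A' * Fintype.card α) * Fintype.card α ^ S.card := by ring
      _ ≤ (B.card * A) * Fintype.card α ^ S.card := Nat.mul_le_mul_right _ hstep
      _ = B.card * (A * Fintype.card α ^ S.card) := by ring
      _ ≤ B.card * (B.card ^ S.card * Fintype.card (α ≃ β)) := Nat.mul_le_mul_left _ ih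
      _ = _ := by ring

/-- The profiles sharing a row or a column with `p`. -/
def cross {K : ℕ} (p : Fin K × Fin K) : Finset (Fin K × Fin K) :=
  ({p.1} ×ˢ Finset.univ) ∪ (({p.1}ᶜ : Finset (Fin K)) ×ˢ {p.2})

lemma card_cross {K : ℕ} (p : Fin K × Fin K) : (cross p).card = 2 * K - 1 := by
  have hK : 0 < K := p.1.pos
  rw [cross, Finset.card_union_of_disjoint]
  · simp [Finset.card_compl]
    omega
  · rw [Finset.disjoint_left]
    rintro ⟨a, b⟩ h h'
    simp only [Finset.mem_product, Finset.mem_singleton, Finset.mem_compl] at h h'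
    exact h'.1 h.1

lemma IsPNE.le_of_mem_cross {K : ℕ} {Ψ : Fin K × Fin K → ℝ} {p q : Fin K × Fin K}
    (hp : IsPNE Ψ p) (hq : q ∈ cross p) : Ψ p ≤ Ψ q := by
  obtain ⟨a, b⟩ := q
  simp only [cross, Finset.mem_union, Finset.mem_product, Finset.mem_singleton,
    Finset.mem_compl, Finset.mem_univ, and_true] at hq
  rcases hq with rfl | ⟨ha, rfl⟩
  · by_cases hb : b = p.2
    · rw [hb]
    · exact (hp.2 b hb).le
  · exact (hp.1 a ha).le

lemma card_filter_le_val_add_one_le (N : ℕ) (t : ℝ) :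
    ((Finset.univ.filter fun j : Fin N => t ≤ (j : ℕ) + 1).card : ℝ) ≤
      N * Real.exp (-(t - 1) / N) := by
  rcases Nat.eq_zero_or_pos N with rfl | hN
  · simp
  have hN' : (0 : ℝ) < N := by exact_mod_cast hN
  have hcard : (Finset.univ.filter fun j : Fin N => t ≤ (j : ℕ) + 1).card ≤
      N - (⌈t⌉₊ - 1) := by
    rw [← Nat.card_Ico, ← Finset.card_map Fin.valEmbedding]
    refine Finset.card_le_card fun x hx => ?_
    obtain ⟨j, hj, rfl⟩ := Finset.mem_map.1 hx
    have hj' : t ≤ ((j + 1 : ℕ) : ℝ) := by simpa using hj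
    have := Nat.ceil_le.2 hj'
    have := j.isLt
    simp only [Fin.valEmbedding_apply, Finset.mem_Ico]
    omega
  rcases le_total N (⌈t⌉₊ - 1) with h | h
  · have h0 : (Finset.univ.filter fun j : Fin N => t ≤ (j : ℕ) + 1).card = 0 := by omega
    rw [h0]
    simp only [Nat.cast_zero]
    positivity
  · have hle : (Finset.univ.filter fun j : Fin N => t ≤ (j : ℕ) + 1).card + ⌈t⌉₊ ≤ N + 1 := by
      omega
    have hle' : ((Finset.univ.filter fun j : Fin N => t ≤ (j : ℕ) + 1).card : ℝ) + ⌈t⌉₊ ≤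
        N + 1 := by exact_mod_cast hle
    have ht := Nat.le_ceil t
    have hexp := Real.add_one_le_exp (-(t - 1) / N)
    calc _ ≤ N * (-(t - 1) / N + 1) := by
          have : N * (-(t - 1) / N + 1) = N + 1 - t := by field_simp; ring
          linarith
      _ ≤ _ := by gcongr

/-- Union bound for the number of bijections having a pure Nash equilibrium of potential at
least `t`. -/
lemma card_exists_isPNE_le {K : ℕ} (hK : 0 < K) (t : ℝ) :
    ((Finset.univ.filter fun Ψ : (Fin K × Fin K) ≃ Fin (K ^ 2) =>
        ∃ p ∈ pneFinset Ψ, t ≤ (Ψ p : ℕ) + 1).card : ℝ) ≤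
      K ^ 2 * Real.exp (-(t - 1) / (K ^ 2 : ℕ)) ^ (2 * K - 1) *
        Fintype.card ((Fin K × Fin K) ≃ Fin (K ^ 2)) := by
  set B := Finset.univ.filter fun j : Fin (K ^ 2) => t ≤ (j : ℕ) + 1 with hB
  have hcard : Fintype.card (Fin K × Fin K) = K ^ 2 := by simp [sq]
  have hBle : B.card ≤ Fintype.card (Fin K × Fin K) := by
    rw [hcard]
    simpa using Finset.card_le_univ B
  have hN : (0 : ℝ) < (K ^ 2 : ℕ) := by positivity
  have hcross : ∀ p : Fin K × Fin K,
      ((Finset.univ.filter fun Ψ : (Fin K × Fin K) ≃ Fin (K ^ 2) =>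
        ∀ q ∈ cross p, Ψ q ∈ B).card : ℝ) ≤
      Real.exp (-(t - 1) / (K ^ 2 : ℕ)) ^ (2 * K - 1) *
        Fintype.card ((Fin K × Fin K) ≃ Fin (K ^ 2)) := by
    intro p
    have h := card_filter_equiv_mul_pow_le B hBle (cross p)
    rw [card_cross, hcard] at h
    have h' : ((Finset.univ.filter fun Ψ : (Fin K × Fin K) ≃ Fin (K ^ 2) =>
        ∀ q ∈ cross p, Ψ q ∈ B).card : ℝ) * ((K ^ 2 : ℕ) : ℝ) ^ (2 * K - 1) ≤
        (B.card : ℝ) ^ (2 * K - 1) * Fintype.card ((Fin K × Fin K) ≃ Fin (K ^ 2)) := by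
      exact_mod_cast h
    refine le_of_mul_le_mul_right (h'.trans ?_) (pow_pos hN (2 * K - 1))
    calc _ ≤ (((K ^ 2 : ℕ) : ℝ) * Real.exp (-(t - 1) / (K ^ 2 : ℕ))) ^ (2 * K - 1) *
          Fintype.card ((Fin K × Fin K) ≃ Fin (K ^ 2)) := by
          gcongr
          exact card_filter_le_val_add_one_le _ t
      _ = _ := by rw [mul_pow]; ring
  have hsub : (Finset.univ.filter fun Ψ : (Fin K × Fin K) ≃ Fin (K ^ 2) =>
        ∃ p ∈ pneFinset Ψ, t ≤ (Ψ p : ℕ) + 1) ⊆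
      Finset.univ.biUnion fun p => Finset.univ.filter fun Ψ : (Fin K × Fin K) ≃ Fin (K ^ 2) =>
        ∀ q ∈ cross p, Ψ q ∈ B := by
    intro Ψ hΨ
    simp only [Finset.mem_filter, Finset.mem_univ, true_and, Finset.mem_biUnion] at hΨ ⊢
    obtain ⟨p, hp, ht⟩ := hΨ
    refine ⟨p, fun q hq => ?_⟩
    rw [hB, Finset.mem_filter]
    exact ⟨Finset.mem_univ _, ht.trans ((Finset.mem_filter.1 hp).2.le_of_mem_cross hq)⟩
  calc _ ≤ ((∑ p : Fin K × Fin K, (Finset.univ.filter fun Ψ : (Fin K × Fin K) ≃ Fin (K ^ 2) =>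
        ∀ q ∈ cross p, Ψ q ∈ B).card : ℕ) : ℝ) := by
        exact_mod_cast (Finset.card_le_card hsub).trans Finset.card_biUnion_le
    _ ≤ ∑ _p : Fin K × Fin K, Real.exp (-(t - 1) / (K ^ 2 : ℕ)) ^ (2 * K - 1) *
        Fintype.card ((Fin K × Fin K) ≃ Fin (K ^ 2)) := by
        rw [Nat.cast_sum]
        exact Finset.sum_le_sum fun p _ => hcross p
    _ = _ := by
        rw [Finset.sum_const, Finset.card_univ, hcard, nsmul_eq_mul]
        push_cast
        ring

lemma sq_mul_exp_pow_le {δ : ℝ} (hδ : 0 < δ) {K : ℕ} (hK : 0 < K) :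
    (K : ℝ) ^ 2 * Real.exp (-((1 + δ) * (K * Real.log K) - 1) / (K ^ 2 : ℕ)) ^ (2 * K - 1) ≤
      Real.exp (3 + δ) * (K : ℝ) ^ (-(2 * δ)) := by
  have hK' : (1 : ℝ) ≤ K := by exact_mod_cast hK
  have hK0 : (0 : ℝ) < K := by linarith
  have hsq : (K : ℝ) ^ 2 = Real.exp (2 * Real.log K) := by
    rw [mul_comm, Real.exp_mul, Real.exp_log hK0]
    norm_num
  have hlog : Real.log K ≤ K := Real.log_le_self hK0.le
  have hsub : ((2 * K - 1 : ℕ) : ℝ) = 2 * K - 1 := by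
    rw [Nat.cast_sub (by omega)]
    push_cast
    ring
  rw [← Real.exp_nat_mul, Real.rpow_def_of_pos hK0, ← Real.exp_add]
  nth_rewrite 1 [hsq]
  rw [← Real.exp_add, Real.exp_le_exp, hsub]
  push_cast
  have hid : 2 * Real.log K +
      (2 * K - 1) * (-((1 + δ) * (K * Real.log K) - 1) / (K : ℝ) ^ 2) =
      -(2 * δ) * Real.log K + (1 + δ) * (Real.log K / K) + 2 / K - 1 / (K : ℝ) ^ 2 := by
    field_simp
    ring
  have h1 : Real.log K / K ≤ 1 := (div_le_one hK0).2 hlog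
  have h2 : 2 / (K : ℝ) ≤ 2 := div_le_self (by norm_num) hK'
  have h3 : 0 ≤ 1 / (K : ℝ) ^ 2 := by positivity
  have h4 : (1 + δ) * (Real.log K / K) ≤ (1 + δ) * 1 := by gcongr
  rw [hid]
  linarith

/-- The largest potential value among the pure Nash equilibria of a uniformly random
potential is, with probability tending to `1`, smaller than `(1+δ)·K log K`. -/
theorem stmt9 (δ : ℝ) (hδ : 0 < δ) :
    Filter.Tendsto (fun K : ℕ =>
        ((Finset.univ.filter fun Ψ : (Fin K × Fin K) ≃ Fin (K ^ 2) =>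
            (((pneFinset Ψ).sup fun p => (Ψ p : ℕ) + 1 : ℕ) : ℝ) /
              (K * Real.log K) < 1 + δ).card : ℝ) /
          (Fintype.card ((Fin K × Fin K) ≃ Fin (K ^ 2)) : ℝ))
      Filter.atTop (nhds 1) := by
  have hlim : Filter.Tendsto (fun K : ℕ => 1 - Real.exp (3 + δ) * (K : ℝ) ^ (-(2 * δ)))
      Filter.atTop (nhds 1) := by
    have h := ((tendsto_rpow_neg_atTop (y := 2 * δ) (by positivity)).comp
      tendsto_natCast_atTop_atTop).const_mul (Real.exp (3 + δ))
    simpa using h.const_sub 1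
  refine tendsto_of_tendsto_of_tendsto_of_le_of_le' hlim tendsto_const_nhds ?_ ?_
  · filter_upwards [Filter.eventually_ge_atTop 2] with K hK
    have hK0 : 0 < K := by omega
    have hpos : 0 < (K : ℝ) * Real.log K :=
      mul_pos (by exact_mod_cast hK0) (Real.log_pos (by exact_mod_cast hK))
    have : Nonempty ((Fin K × Fin K) ≃ Fin (K ^ 2)) :=
      ⟨Fintype.equivOfCardEq (by simp [sq])⟩
    have hN : (0 : ℝ) < Fintype.card ((Fin K × Fin K) ≃ Fin (K ^ 2)) := by
      exact_mod_cast Fintype.card_pos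
    rw [le_div_iff₀ hN]
    set bad := Finset.univ.filter fun Ψ : (Fin K × Fin K) ≃ Fin (K ^ 2) =>
      ∃ p ∈ pneFinset Ψ, (1 + δ) * (K * Real.log K) ≤ (Ψ p : ℕ) + 1 with hbad
    have hle : (bad.card : ℝ) ≤ Real.exp (3 + δ) * (K : ℝ) ^ (-(2 * δ)) *
        Fintype.card ((Fin K × Fin K) ≃ Fin (K ^ 2)) :=
      (card_exists_isPNE_le hK0 _).trans
        (mul_le_mul_of_nonneg_right (sq_mul_exp_pow_le hδ hK0) hN.le)
    have hgood : badᶜ ⊆ Finset.univ.filter fun Ψ : (Fin K × Fin K) ≃ Fin (K ^ 2) =>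
        (((pneFinset Ψ).sup fun p => (Ψ p : ℕ) + 1 : ℕ) : ℝ) / (K * Real.log K) < 1 + δ := by
      intro Ψ hΨ
      simp only [hbad, Finset.mem_compl, Finset.mem_filter, Finset.mem_univ, true_and,
        not_exists, not_and, not_le] at hΨ ⊢
      rw [div_lt_iff₀ hpos]
      rcases (pneFinset Ψ).eq_empty_or_nonempty with h | h
      · rw [h, Finset.sup_empty, Nat.bot_eq_zero, Nat.cast_zero]
        positivity
      · obtain ⟨p, hp, hsup⟩ := Finset.exists_mem_eq_sup _ h fun p => (Ψ p : ℕ) + 1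
        rw [hsup]
        push_cast
        exact hΨ p hp
    have hcard := Finset.card_le_card hgood
    have hadd := Finset.card_add_card_compl bad
    have hge : (Fintype.card ((Fin K × Fin K) ≃ Fin (K ^ 2)) : ℝ) ≤ bad.card +
        (Finset.univ.filter fun Ψ : (Fin K × Fin K) ≃ Fin (K ^ 2) =>
          (((pneFinset Ψ).sup fun p => (Ψ p : ℕ) + 1 : ℕ) : ℝ) /
            (K * Real.log K) < 1 + δ).card := by
      exact_mod_cast hadd.symm.le.trans (Nat.add_le_add_left hcard _)
    linarith
  · refine Filter.Eventually.of_forall fun K => div_le_one_of_le₀ ?_ (Nat.cast_nonneg _)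
    exact_mod_cast Finset.card_le_univ _
end
end
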